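/- Centralizer of the Reeb class: let Ψ be an orientation preserving homeomorphism of ℝ² with Ψ(ℤ₁) = ℤ₁ and Ψ(ℤ₂) = ℤ₂ such that Ψ∘R₀∘Ψ⁻¹ is isotopic to R₀ relative to ℤ₁ ∪ ℤ₂. Then there exist integers n₁, n₂ such that Ψ is isotopic to T₁ⁿ¹∘T₂ⁿ² relative to ℤ₁ ∪ ℤ₂. -/

import Mathlib

open Set

/-- The plane. -/
abbrev Plane : Type := ℝ × ℝ

/-- `f` is (the underlying function of) a homeomorphism of the plane. -/
def IsHomeoFun (f : Plane → Plane) : Prop :=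
  ∃ e : Plane ≃ₜ Plane, ∀ x, e x = f x

/-- `g` and `g'` are isotopic relative to `O` : there is a continuous family
`F (t, ·)`, `t ∈ [0,1]`, of homeomorphisms of the plane going from `g` to `g'`
and agreeing with `g` on `O` for all times. -/
def IsotopicRel (g g' : Plane → Plane) (O : Set Plane) : Prop :=
  ∃ F : ℝ × Plane → Plane, Continuous F ∧
    (∀ t ∈ Icc (0:ℝ) 1, IsHomeoFun fun x => F (t, x)) ∧
    (∀ x, F (0, x) = g x) ∧
    (∀ x, F (1, x) = g' x) ∧
    (∀ t ∈ Icc (0:ℝ) 1, ∀ x ∈ O, F (t, x) = g x)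

/-- A homeomorphism of the plane is orientation preserving iff it is isotopic
to the identity. -/
def OrientationPreserving (h : Plane ≃ₜ Plane) : Prop :=
  IsotopicRel id (⇑h) (∅ : Set Plane)

/-- A Brouwer homeomorphism: orientation preserving and fixed point free. -/
def IsBrouwer (h : Plane ≃ₜ Plane) : Prop :=
  OrientationPreserving h ∧ ∀ x, h x ≠ x

/-- The orbit of a point under a homeomorphism. -/
def horbit (h : Plane ≃ₜ Plane) (x : Plane) : Set Plane :=
  {y | ∃ n : ℤ, y = (h.toEquiv ^ n) x}

/-- `ℤ₁ = ℤ × {1}`. -/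
def Z1 : Set Plane := {p | ∃ n : ℤ, p = ((n : ℝ), 1)}

/-- `ℤ₂ = ℤ × {2}`. -/
def Z2 : Set Plane := {p | ∃ n : ℤ, p = ((n : ℝ), 2)}

/-- The shear homeomorphism `(x, y) ↦ (x + f y, y)`. -/
def shear (f : ℝ → ℝ) (hf : Continuous f) : Plane ≃ₜ Plane where
  toFun p := (p.1 + f p.2, p.2)
  invFun p := (p.1 - f p.2, p.2)
  left_inv p := by simp
  right_inv p := by simp
  continuous_toFun := (continuous_fst.add (hf.comp continuous_snd)).prodMk continuous_snd
  continuous_invFun := (continuous_fst.sub (hf.comp continuous_snd)).prodMk continuous_snd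

/-- The translation `T (x, y) = (x + 1, y)`. -/
def T : Plane ≃ₜ Plane := shear (fun _ => 1) continuous_const

/-- The twist `T₁ (x, y) = (x + 2 - y, y)`. -/
def T₁ : Plane ≃ₜ Plane := shear (fun y => 2 - y) (by continuity)

/-- The twist `T₂ (x, y) = (x + y - 1, y)`. -/
def T₂ : Plane ≃ₜ Plane := shear (fun y => y - 1) (by continuity)

/-- The model Reeb homeomorphism `R₀ = T₁ ∘ T₂⁻¹`, `R₀ (x, y) = (x + 3 - 2y, y)`. -/
def R₀ : Plane ≃ₜ Plane := shear (fun y => 3 - 2 * y) (by continuity)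

/-- The Euclidean norm on the plane. -/
noncomputable def planeNorm (p : Plane) : ℝ := Real.sqrt (p.1 ^ 2 + p.2 ^ 2)

/-- An angle function for a fixed point free map `h'` along a curve `γ`. -/
def IsAngleFunction (h' : Plane → Plane) (γ : ℝ → Plane) (θ : ℝ → ℝ) : Prop :=
  ContinuousOn θ (Icc 0 1) ∧
    ∀ t ∈ Icc (0:ℝ) 1,
      h' (γ t) - γ t =
        planeNorm (h' (γ t) - γ t) • (Real.cos (θ t), Real.sin (θ t))

/-- The conjugate `Φ ∘ h ∘ Φ⁻¹`. -/
def conjH (Φ h : Plane ≃ₜ Plane) : Plane ≃ₜ Plane := Φ.symm.trans (h.trans Φ)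

/-- An admissible straightening `Φ` for `(h, O₁, O₂)` : an orientation preserving
homeomorphism sending `O₁, O₂` to `ℤ₁, ℤ₂` such that `Φ ∘ h ∘ Φ⁻¹` is isotopic
relative to `ℤ₁ ∪ ℤ₂` to a homeomorphism translating each line `ℝ × {i}` by `±1`. -/
def AdmissibleStraightening (h : Plane ≃ₜ Plane) (O₁ O₂ : Set Plane)
    (Φ : Plane ≃ₜ Plane) : Prop :=
  OrientationPreserving Φ ∧ Φ '' O₁ = Z1 ∧ Φ '' O₂ = Z2 ∧
    ∃ ε₁ ε₂ : ℝ, (ε₁ = 1 ∨ ε₁ = -1) ∧ (ε₂ = 1 ∨ ε₂ = -1) ∧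
      ∃ g : Plane ≃ₜ Plane,
        (∀ x : ℝ, g (x, 1) = (x + ε₁, 1)) ∧
        (∀ x : ℝ, g (x, 2) = (x + ε₂, 2)) ∧
        IsotopicRel (⇑(conjH Φ h)) (⇑g) (Z1 ∪ Z2)

/-- A flow on the plane. -/
def IsFlow (φ : ℝ → Plane → Plane) : Prop :=
  Continuous (fun p : ℝ × Plane => φ p.1 p.2) ∧
    (∀ x, φ 0 x = x) ∧ ∀ s t x, φ (s + t) x = φ s (φ t x)

/-- A topological line in the plane: the image of a proper injective continuous
map from `ℝ` to the plane. -/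
def IsTopLine (L : Set Plane) : Prop :=
  ∃ f : ℝ → Plane, Continuous f ∧ Function.Injective f ∧ IsProperMap f ∧ range f = L

section LocalCocycles

open Filter Topology unitInterval

variable {Y Y' H S : Type*} [TopologicalSpace Y] [TopologicalSpace Y'] [Group H]
  [TopologicalSpace S]

/-- `c` is a coboundary near each point of `X`. -/
def IsLoc (X : Set Y) (c : Y → Y → H) : Prop :=
  ∀ z ∈ X, ∃ P : Y → H, ∃ U ∈ 𝓝 z, ∀ p ∈ U, ∀ q ∈ U, c p q = (P p)⁻¹ * P q

/-- `Λ` is a development of `c` along `f`. -/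
def IsLift (c : Y → Y → H) (f : S → Y) (Λ : S → H) : Prop :=
  ∀ s, ∀ᶠ a in 𝓝 s, Λ a = Λ s * c (f s) (f a)

theorem IsLoc.self {X : Set Y} {c : Y → Y → H} (hc : IsLoc X c) {z : Y} (hz : z ∈ X) :
    c z z = 1 := by
  obtain ⟨P, U, hU, h⟩ := hc z hz
  rw [h z (mem_of_mem_nhds hU) z (mem_of_mem_nhds hU), inv_mul_cancel]

theorem IsLoc.map {X : Set Y} {c : Y → Y → H} (hc : IsLoc X c) {H' : Type*} [Group H']
    (φ : H →* H') : IsLoc X fun p q => φ (c p q) := by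
  intro z hz
  obtain ⟨P, U, hU, h⟩ := hc z hz
  exact ⟨fun p => φ (P p), U, hU, fun p hp q hq => by simp [h p hp q hq]⟩

theorem IsLift.comp {c : Y → Y → H} {f : S → Y} {Λ : S → H} (h : IsLift c f Λ) {S' : Type*}
    [TopologicalSpace S'] {g : S' → S} (hg : Continuous g) : IsLift c (f ∘ g) (Λ ∘ g) :=
  fun s => hg.continuousAt.eventually (h (g s))

/-- Developments related by a local gauge transformation differ by a constant. -/
theorem IsLift.compare [PreconnectedSpace S] {c : Y → Y → H} {c' : Y' → Y' → H} {f : S → Y}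
    {f' : S → Y'} {Λ Λ' κ : S → H} (h : IsLift c f Λ) (h' : IsLift c' f' Λ')
    (hκ : ∀ t, ∀ᶠ a in 𝓝 t, c (f t) (f a) * κ a = κ t * c' (f' t) (f' a)) (s t : S) :
    Λ s * κ s * (Λ' s)⁻¹ = Λ t * κ t * (Λ' t)⁻¹ := by
  have : IsLocallyConstant fun s => Λ s * κ s * (Λ' s)⁻¹ := by
    rw [IsLocallyConstant.iff_eventually_eq]
    intro x
    filter_upwards [h x, h' x, hκ x] with a h1 h2 h3
    rw [h1, h2, mul_assoc (Λ x), h3]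
    group
  exact this.apply_eq_of_preconnectedSpace s t

theorem IsLift.unique [PreconnectedSpace S] {c : Y → Y → H} {f : S → Y} {Λ Λ' : S → H}
    (h : IsLift c f Λ) (h' : IsLift c f Λ') (s t : S) : (Λ s)⁻¹ * Λ t = (Λ' s)⁻¹ * Λ' t := by
  have := h.compare (κ := 1) h' (fun t => by simp) s t
  simp only [Pi.one_apply, mul_one] at this
  have h2 : Λ t = (Λ s * (Λ' s)⁻¹) * Λ' t := by rw [this]; group
  rw [h2]; group

theorem IsLoc.exists_isLift {X : Set Y} {c : Y → Y → H} (hc : IsLoc X c) {f : I → Y}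
    (hf : Continuous f) (hX : ∀ t, f t ∈ X) : ∃ Λ, IsLift c f Λ := by
  choose P U hU h using fun t => hc (f t) (hX t)
  obtain ⟨t, ht0, htm, ⟨n, hn⟩, ht⟩ := exists_monotone_Icc_subset_open_cover_unitInterval
    (c := fun t => f ⁻¹' interior (U t)) (fun i => isOpen_interior.preimage hf)
    (fun s _ => Set.mem_iUnion.2 ⟨s, mem_interior_iff_mem_nhds.2 (hU s)⟩)
  have key : ∀ m, ∃ Λ : I → H, ∀ s ≤ t m, ∀ᶠ a in 𝓝 s, a ≤ t m → Λ a = Λ s * c (f s) (f a) := by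
    intro m
    induction m with
    | zero =>
      refine ⟨fun _ => 1, fun s hs => Eventually.of_forall fun a ha => ?_⟩
      rw [ht0] at hs ha
      have h0 : s = 0 := le_antisymm hs bot_le
      have h1 : a = 0 := le_antisymm ha bot_le
      rw [h0, h1, hc.self (hX 0), one_mul]
    | succ m ih =>
      obtain ⟨Λ, hΛ⟩ := ih
      obtain ⟨i, hi⟩ := ht m
      have hloc : ∀ a b, a ∈ Set.Icc (t m) (t (m + 1)) → b ∈ Set.Icc (t m) (t (m + 1)) →
          c (f a) (f b) = (P i (f a))⁻¹ * P i (f b) := fun a b ha hb =>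
        h i _ (interior_subset (hi ha)) _ (interior_subset (hi hb))
      have hmm : t m ∈ Set.Icc (t m) (t (m + 1)) := ⟨le_rfl, htm (Nat.le_succ m)⟩
      refine ⟨fun a => if a ≤ t m then Λ a else Λ (t m) * c (f (t m)) (f a), fun s hs => ?_⟩
      rcases lt_trichotomy s (t m) with h1 | h1 | h1
      · filter_upwards [hΛ s h1.le, Iio_mem_nhds h1] with a ha hlt _
        rw [if_pos (Set.mem_Iio.1 hlt).le, if_pos h1.le, ha (Set.mem_Iio.1 hlt).le]
      · filter_upwards [hΛ s h1.le] with a ha _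
        subst h1
        rw [if_pos le_rfl]
        split_ifs with h2
        · exact ha h2
        · rfl
      · filter_upwards [Ioi_mem_nhds h1] with a ha ham
        rw [if_neg (not_le.2 ha), if_neg (not_le.2 h1),
          hloc _ _ hmm ⟨h1.le, hs⟩, hloc _ _ hmm ⟨(Set.mem_Ioi.1 ha).le, ham⟩,
          hloc _ _ ⟨h1.le, hs⟩ ⟨(Set.mem_Ioi.1 ha).le, ham⟩]
        group
  obtain ⟨Λ, hΛ⟩ := key n
  rw [hn n le_rfl] at hΛ
  exact ⟨Λ, fun s => (hΛ s le_top).mono fun a ha => ha le_top⟩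

open Classical in
/-- The holonomy of `c` along `f`. -/
noncomputable def hol (c : Y → Y → H) (f : I → Y) : H :=
  if h : ∃ Λ, IsLift c f Λ then (h.choose 0)⁻¹ * h.choose 1 else 1

theorem IsLift.hol_eq {c : Y → Y → H} {f : I → Y} {Λ : I → H} (h : IsLift c f Λ) :
    hol c f = (Λ 0)⁻¹ * Λ 1 := by
  have h' : ∃ Λ, IsLift c f Λ := ⟨Λ, h⟩
  rw [hol, dif_pos h']
  exact h'.choose_spec.unique h 0 1

theorem hol_compare {X : Set Y} {X' : Set Y'} {c : Y → Y → H} {c' : Y' → Y' → H}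
    (hc : IsLoc X c) (hc' : IsLoc X' c') {f : I → Y} {f' : I → Y'} (hf : Continuous f)
    (hf' : Continuous f') (hX : ∀ t, f t ∈ X) (hX' : ∀ t, f' t ∈ X') {κ : I → H}
    (hκ : ∀ t, ∀ᶠ a in 𝓝 t, c (f t) (f a) * κ a = κ t * c' (f' t) (f' a)) :
    hol c f * κ 1 = κ 0 * hol c' f' := by
  obtain ⟨Λ, h⟩ := hc.exists_isLift hf hX
  obtain ⟨Λ', h'⟩ := hc'.exists_isLift hf' hX'
  have := h.compare h' hκ 0 1
  rw [h.hol_eq, h'.hol_eq]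
  have h2 : Λ 1 * κ 1 = (Λ 0 * κ 0 * (Λ' 0)⁻¹) * Λ' 1 := by rw [this]; group
  rw [mul_assoc, h2]; group

theorem hol_map {X : Set Y} {c : Y → Y → H} (hc : IsLoc X c) {f : I → Y} (hf : Continuous f)
    (hX : ∀ t, f t ∈ X) {H' : Type*} [Group H'] (φ : H →* H') :
    hol (fun p q => φ (c p q)) f = φ (hol c f) := by
  obtain ⟨Λ, h⟩ := hc.exists_isLift hf hX
  have h2 : IsLift (fun p q => φ (c p q)) f fun s => φ (Λ s) := fun s => by
    filter_upwards [h s] with a ha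
    rw [ha, map_mul]
  rw [h2.hol_eq, h.hol_eq, map_mul, map_inv]

theorem hol_potential {c : Y → Y → H} {f : I → Y} (Q : Y → H)
    (h : ∀ t, ∀ᶠ a in 𝓝 t, c (f t) (f a) = (Q (f t))⁻¹ * Q (f a)) :
    hol c f = (Q (f 0))⁻¹ * Q (f 1) := by
  have : IsLift c f fun s => Q (f s) := fun s => by
    filter_upwards [h s] with a ha
    rw [ha]; group
  exact this.hol_eq

theorem hol_close {X : Set Y} {c : Y → Y → H} (hc : IsLoc X c) {f f' : I → Y} (hf : Continuous f)
    (hf' : Continuous f') (hX : ∀ t, f t ∈ X) (hX' : ∀ t, f' t ∈ X)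
    (h : ∀ t, ∃ P : Y → H, ∃ U ∈ 𝓝 (f t), U ∈ 𝓝 (f' t) ∧ ∀ p ∈ U, ∀ q ∈ U,
      c p q = (P p)⁻¹ * P q) :
    hol c f * c (f 1) (f' 1) = c (f 0) (f' 0) * hol c f' := by
  refine hol_compare hc hc hf hf' hX hX' (κ := fun t => c (f t) (f' t)) fun t => ?_
  obtain ⟨P, U, hU, hU', hP⟩ := h t
  filter_upwards [hf.continuousAt.eventually hU, hf'.continuousAt.eventually hU'] with a h1 h2
  have h3 := mem_of_mem_nhds hU
  have h4 := mem_of_mem_nhds hU'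
  rw [hP _ h3 _ h1, hP _ h1 _ h2, hP _ h3 _ h4, hP _ h4 _ h2]
  group

theorem hol_square {X : Set Y} {c : Y → Y → H} (hc : IsLoc X c) {K : I × I → Y}
    (hK : Continuous K) (hX : ∀ t, K t ∈ X) :
    hol c (fun t => K (0, t)) * hol c (fun s => K (s, 1)) =
      hol c (fun s => K (s, 0)) * hol c (fun t => K (1, t)) := by
  have c0 : ∀ t : I, Continuous fun s : I => K (s, t) := fun t => by fun_prop
  have c1 : ∀ s : I, Continuous fun t : I => K (s, t) := fun t => by fun_prop
  obtain ⟨μ, hμ⟩ := hc.exists_isLift (c0 0) fun _ => hX _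
  obtain ⟨ν, hν⟩ := hc.exists_isLift (c0 1) fun _ => hX _
  have hM : IsLocallyConstant fun s => μ s * hol c (fun t => K (s, t)) * (ν s)⁻¹ := by
    rw [IsLocallyConstant.iff_eventually_eq]
    intro s
    have : ∀ᶠ x in 𝓝 s, ∀ t ∈ (Set.univ : Set I), ∃ P : Y → H, ∃ U ∈ 𝓝 (K (s, t)),
        U ∈ 𝓝 (K (x, t)) ∧ ∀ p ∈ U, ∀ q ∈ U, c p q = (P p)⁻¹ * P q := by
      refine isCompact_univ.eventually_forall_of_forall_eventually fun t _ => ?_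
      obtain ⟨P, U, hU, hP⟩ := hc _ (hX (s, t))
      have h1 : ∀ᶠ z : I × I in 𝓝 (s, t), U ∈ 𝓝 (K (z.1, z.2)) :=
        hK.continuousAt.eventually (eventually_mem_nhds_iff.2 hU)
      have h2 : ∀ᶠ z : I × I in 𝓝 (s, t), U ∈ 𝓝 (K (s, z.2)) := by
        have : Continuous fun z : I × I => K (s, z.2) := by fun_prop
        exact (this.continuousAt (x := (s, t))).eventually (eventually_mem_nhds_iff.2 hU)
      filter_upwards [h1, h2] with z hz hz'
      exact ⟨P, U, hz', hz, hP⟩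
    filter_upwards [this, hμ s, hν s] with x hx h1 h2
    have := hol_close hc (c1 s) (c1 x) (fun _ => hX _) (fun _ => hX _) fun t => hx t trivial
    have h3 : hol c (fun t => K (s, t)) =
      c (K (s, 0)) (K (x, 0)) * hol c (fun t => K (x, t)) * (c (K (s, 1)) (K (x, 1)))⁻¹ := by
      rw [← this]; group
    rw [h1, h2, h3]; group
  have := hM.apply_eq_of_preconnectedSpace 0 1
  rw [hμ.hol_eq, hν.hol_eq]
  beta_reduce at this
  have h2 : hol c (fun t => K (0, t)) =
    (μ 0)⁻¹ * (μ 1 * hol c (fun t => K (1, t)) * (ν 1)⁻¹) * ν 0 := by rw [← this]; group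
  rw [h2]; group

theorem hol_const {c : Y → Y → H} {X : Set Y} (hc : IsLoc X c) {z : Y} (hz : z ∈ X) :
    hol c (fun _ => z) = 1 := by
  have : IsLift c (fun _ : I => z) fun _ => 1 := fun s => by simp [hc.self hz]
  simpa using this.hol_eq

/-- Homotopy invariance of the holonomy. -/
theorem hol_homotopic {X : Set Y} {c : Y → Y → H} (hc : IsLoc X c) {K : I × I → Y}
    (hK : Continuous K) (hX : ∀ t, K t ∈ X) (h0 : ∀ s, K (s, 0) = K (0, 0))
    (h1 : ∀ s, K (s, 1) = K (0, 1)) :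
    hol c (fun t => K (0, t)) = hol c (fun t => K (1, t)) := by
  have := hol_square hc hK hX
  simp only [h0, h1] at this
  rwa [hol_const hc (hX _), hol_const hc (hX _), mul_one, one_mul] at this

theorem hol_symm {X : Set Y} {c : Y → Y → H} (hc : IsLoc X c) {a b : Y} (γ : Path a b)
    (hX : ∀ t, γ t ∈ X) : hol c γ.symm = (hol c γ)⁻¹ := by
  obtain ⟨Λ, h⟩ := hc.exists_isLift γ.continuous hX
  have h2 := h.comp (g := σ) continuous_symm
  have : (⇑γ ∘ σ) = γ.symm := rfl
  rw [this] at h2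
  rw [h2.hol_eq, h.hol_eq]
  simp

theorem hol_trans {X : Set Y} {c : Y → Y → H} (hc : IsLoc X c) {a b d : Y} (γ : Path a b)
    (γ' : Path b d) (hX : ∀ t, γ t ∈ X) (hX' : ∀ t, γ' t ∈ X) :
    hol c (γ.trans γ') = hol c γ * hol c γ' := by
  have hX2 : ∀ t, γ.trans γ' t ∈ X := fun t => by
    rw [Path.trans_apply]
    split_ifs
    · exact hX _
    · exact hX' _
  obtain ⟨Λ, h⟩ := hc.exists_isLift (γ.trans γ').continuous hX2
  have hl : ∀ t : I, (t : ℝ) / 2 ∈ I := fun t => ⟨by linarith [t.2.1], by linarith [t.2.2]⟩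
  have hr : ∀ t : I, ((t : ℝ) + 1) / 2 ∈ I := fun t =>
    ⟨by linarith [t.2.1], by linarith [t.2.2]⟩
  have h1 := h.comp (g := fun t : I => (⟨(t : ℝ) / 2, hl t⟩ : I)) (by fun_prop)
  have h2 := h.comp (g := fun t : I => (⟨((t : ℝ) + 1) / 2, hr t⟩ : I)) (by fun_prop)
  have e1 : (⇑(γ.trans γ') ∘ fun t : I => (⟨(t : ℝ) / 2, hl t⟩ : I)) = γ := by
    funext t
    have : (t : ℝ) / 2 ≤ 1 / 2 := by linarith [t.2.2]
    simp only [Function.comp, Path.trans_apply, this, dite_true]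
    congr 1
    ext
    simp only
    ring
  have e2 : (⇑(γ.trans γ') ∘ fun t : I => (⟨((t : ℝ) + 1) / 2, hr t⟩ : I)) = γ' := by
    funext t
    simp only [Function.comp, Path.trans_apply]
    split_ifs with h3
    · have : (t : ℝ) = 0 := by linarith [t.2.1]
      have ht : t = 0 := Subtype.ext this
      subst ht
      rw [γ'.source]
      convert γ.target
      norm_num
    · congr 1
      ext
      simp only
      ring
  rw [e1] at h1
  rw [e2] at h2
  rw [h.hol_eq, h1.hol_eq, h2.hol_eq]
  have z0 : (⟨((0 : I) : ℝ) / 2, hl 0⟩ : I) = 0 := by ext; simp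
  have z1 : (⟨((1 : I) : ℝ) / 2, hl 1⟩ : I) = ⟨(((0 : I) : ℝ) + 1) / 2, hr 0⟩ := by ext; simp
  have z2 : (⟨(((1 : I) : ℝ) + 1) / 2, hr 1⟩ : I) = 1 := by ext; simp
  simp only [Function.comp, z0, z1, z2]
  group

end LocalCocycles

section Words

open Filter Topology unitInterval

/-- Labels of the punctures. -/
abbrev Lab : Type := Bool × ℤ

/-- The puncture with a given label. -/
def pt (i : Lab) : Plane := ((i.2 : ℝ), if i.1 then 2 else 1)

/-- The plane punctured at the points with labels in `E`. -/
def XE (E : Set Lab) : Set Plane := {p | ∀ i ∈ E, p ≠ pt i}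

theorem pt_injective : Function.Injective pt := by
  rintro ⟨b, n⟩ ⟨b', n'⟩ h
  simp only [pt, Prod.mk.injEq, Int.cast_inj] at h
  obtain ⟨h1, h2⟩ := h
  cases b <;> cases b' <;> simp_all

theorem one_le_dist_pt {i j : Lab} (h : i ≠ j) : 1 ≤ dist (pt i) (pt j) := by
  obtain ⟨b, n⟩ := i
  obtain ⟨b', n'⟩ := j
  rw [Prod.dist_eq]
  by_cases hn : n = n'
  · subst hn
    have : b ≠ b' := fun hb => h (by rw [hb])
    refine le_max_of_le_right ?_
    cases b <;> cases b' <;> simp_all [pt, Real.dist_eq] <;> norm_num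
  · refine le_max_of_le_left ?_
    simp only [pt, Real.dist_eq]
    have : (1 : ℤ) ≤ |n - n'| := Int.one_le_abs (sub_ne_zero.2 hn)
    exact_mod_cast this

theorem isOpen_XE (E : Set Lab) : IsOpen (XE E) := by
  have : XE E = (pt '' E)ᶜ := by
    ext p
    simp only [XE, Set.mem_ofPred_eq, Set.mem_compl_iff, Set.mem_image, not_exists, not_and]
    exact forall₂_congr fun i _ => ⟨fun h h' => h h'.symm, fun h h' => h h'.symm⟩
  rw [this, isOpen_compl_iff]
  refine Metric.isClosed_of_pairwise_le_dist one_pos ?_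
  rintro _ ⟨i, _, rfl⟩ _ ⟨j, _, rfl⟩ h
  exact one_le_dist_pt fun hij => h (by rw [hij])

theorem XE_anti {E E' : Set Lab} (h : E ⊆ E') : XE E' ⊆ XE E := fun _ hp i hi => hp i (h hi)

variable {H : Type*} [Group H]

open Classical in
/-- The universal labels: punctures outside `E` are ignored. -/
noncomputable def un (E : Set Lab) (i : Lab) : FreeGroup Lab := if i ∈ E then .of i else 1

theorem un_mem {E : Set Lab} {i : Lab} (h : i ∈ E) : un E i = .of i := if_pos h

theorem un_notMem {E : Set Lab} {i : Lab} (h : i ∉ E) : un E i = 1 := if_neg h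

/-- The letter read when crossing the vertical line over `n` rightwards at height `y`. -/
noncomputable def ltr (φ : Lab → H) (n : ℤ) (y : ℝ) : H :=
  if y < 1 then φ (false, n) else if 2 < y then (φ (true, n))⁻¹ else 1

/-- The word read between two nearby points. -/
noncomputable def cc (φ : Lab → H) (p q : Plane) : H :=
  if ⌊q.1⌋ = ⌊p.1⌋ + 1 then ltr φ ⌊q.1⌋ p.2
  else if ⌊p.1⌋ = ⌊q.1⌋ + 1 then (ltr φ ⌊p.1⌋ p.2)⁻¹ else 1

theorem ltr_map {H' : Type*} [Group H'] (f : H →* H') (φ : Lab → H) (n : ℤ) (y : ℝ) :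
    ltr (fun i => f (φ i)) n y = f (ltr φ n y) := by
  simp only [ltr]
  split_ifs <;> simp

theorem cc_map {H' : Type*} [Group H'] (f : H →* H') (φ : Lab → H) (p q : Plane) :
    cc (fun i => f (φ i)) p q = f (cc φ p q) := by
  simp only [cc, ltr_map]
  split_ifs <;> simp

theorem mem_ball_plane {p z : Plane} {r : ℝ} :
    p ∈ Metric.ball z r ↔ |p.1 - z.1| < r ∧ |p.2 - z.2| < r := by
  rw [Metric.mem_ball, Prod.dist_eq, max_lt_iff, Real.dist_eq, Real.dist_eq]

theorem floor_ball {z : Plane} {r : ℝ} (hr : r ≤ 1 / 2) :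
    ∃ n : ℤ, ∀ p ∈ Metric.ball z r, (⌊p.1⌋ = n - 1 ∧ p.1 < n) ∨ (⌊p.1⌋ = n ∧ n ≤ p.1) := by
  refine ⟨⌈z.1 + r⌉ - 1, fun p hp => ?_⟩
  rw [mem_ball_plane, abs_lt, abs_lt] at hp
  have h1 := Int.le_ceil (z.1 + r)
  have h2 := Int.ceil_lt_add_one (z.1 + r)
  simp only [Int.floor_eq_iff]
  push_cast
  rcases lt_or_ge p.1 (⌈z.1 + r⌉ - 1) with h | h
  · left; refine ⟨⟨?_, ?_⟩, ?_⟩ <;> linarith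
  · right; refine ⟨⟨?_, ?_⟩, ?_⟩ <;> linarith

theorem ltr_const {φ : Lab → H} {E : Set Lab} (hφ : ∀ i ∉ E, φ i = 1) {z : Plane} {r : ℝ}
    (hr : r ≤ 1 / 2) (hb : Metric.ball z r ⊆ XE E) {n : ℤ} (hn : |n - z.1| < r) {p q : Plane}
    (hp : p ∈ Metric.ball z r) (hq : q ∈ Metric.ball z r) : ltr φ n p.2 = ltr φ n q.2 := by
  have h1 : |1 - z.2| < r → φ (false, n) = 1 := fun h => hφ _ fun hE =>
    hb (show pt (false, n) ∈ _ from mem_ball_plane.2 (by simpa [pt] using ⟨hn, h⟩)) _ hE rfl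
  have h2 : |2 - z.2| < r → φ (true, n) = 1 := fun h => hφ _ fun hE =>
    hb (show pt (true, n) ∈ _ from mem_ball_plane.2 (by simpa [pt] using ⟨hn, h⟩)) _ hE rfl
  rw [mem_ball_plane, abs_lt, abs_lt] at hp hq
  rw [abs_lt] at h1 h2
  have key1 : (p.2 < 1 ∧ 1 ≤ q.2) ∨ (q.2 < 1 ∧ 1 ≤ p.2) → φ (false, n) = 1 := by
    rintro (h | h) <;> exact h1 ⟨by linarith, by linarith⟩
  have key2 : (p.2 ≤ 2 ∧ 2 < q.2) ∨ (q.2 ≤ 2 ∧ 2 < p.2) → φ (true, n) = 1 := by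
    rintro (h | h) <;> exact h2 ⟨by linarith, by linarith⟩
  simp only [ltr]
  split_ifs with a1 a2 a3 a4 a5 a6 a7 a8
  · rfl
  · linarith
  · exact key1 (Or.inl ⟨a1, not_lt.1 a2⟩)
  · linarith
  · rfl
  · rw [key2 (Or.inr ⟨not_lt.1 a6, a4⟩), inv_one]
  · rw [key1 (Or.inr ⟨a7, not_lt.1 a1⟩)]
  · rw [key2 (Or.inl ⟨not_lt.1 a4, a8⟩), inv_one]
  · rfl

theorem cc_ball {φ : Lab → H} {E : Set Lab} (hφ : ∀ i ∉ E, φ i = 1) {z : Plane} {r : ℝ}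
    (hr : r ≤ 1 / 2) (hb : Metric.ball z r ⊆ XE E) :
    ∃ P : Plane → H, ∀ p ∈ Metric.ball z r, ∀ q ∈ Metric.ball z r,
      cc φ p q = (P p)⁻¹ * P q := by
  obtain ⟨n, hn⟩ := floor_ball (z := z) hr
  refine ⟨fun p => if p.1 < n then 1 else ltr φ n z.2, fun p hp q hq => ?_⟩
  have hcross : ∀ a ∈ Metric.ball z r, ∀ b ∈ Metric.ball z r, a.1 < n → (n : ℝ) ≤ b.1 →
      ∀ c ∈ Metric.ball z r, ltr φ n c.2 = ltr φ n z.2 := by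
    intro a ha b hb' h1 h2 c hc
    have hr0 : 0 < r := by
      by_contra h
      rw [Metric.ball_eq_empty.2 (not_lt.1 h)] at hc
      exact hc
    rw [mem_ball_plane, abs_lt] at ha hb'
    exact ltr_const hφ hr hb (abs_lt.2 ⟨by linarith [ha.1.1], by linarith [hb'.1.2]⟩) hc
      (Metric.mem_ball_self hr0)
  have e1 : n ≠ n - 1 + 1 + 1 := by omega
  have e2 : n - 1 ≠ n + 1 := by omega
  have e4 : n ≠ n + 1 := by omega
  rcases hn p hp with ⟨f1, h1⟩ | ⟨f1, h1⟩ <;> rcases hn q hq with ⟨f2, h2⟩ | ⟨f2, h2⟩ <;>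
    simp only [cc, f1, f2]
  · simp [h1, h2]
  · simp [h1, not_lt.2 h2, hcross p hp q hq h1 h2 p hp]
  · simp [h2, not_lt.2 h1, hcross q hq p hp h2 h1 p hp, e2]
  · simp [not_lt.2 h1, not_lt.2 h2]

theorem exists_ball_XE {E : Set Lab} {z : Plane} (hz : z ∈ XE E) :
    ∃ r > 0, r ≤ 1 / 2 ∧ Metric.ball z r ⊆ XE E := by
  obtain ⟨r, hr, h⟩ := Metric.isOpen_iff.1 (isOpen_XE E) z hz
  exact ⟨min r (1 / 2), by positivity, min_le_right _ _,
    (Metric.ball_subset_ball (min_le_left _ _)).trans h⟩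

theorem isLoc_cc {φ : Lab → H} {E : Set Lab} (hφ : ∀ i ∉ E, φ i = 1) : IsLoc (XE E) (cc φ) := by
  intro z hz
  obtain ⟨r, hr0, hr, hb⟩ := exists_ball_XE hz
  obtain ⟨P, hP⟩ := cc_ball hφ hr hb
  exact ⟨P, _, Metric.ball_mem_nhds z hr0, hP⟩

theorem cc_swap {φ : Lab → H} {E : Set Lab} (hφ : ∀ i ∉ E, φ i = 1) {z : Plane} {r : ℝ}
    (hr : r ≤ 1 / 2) (hb : Metric.ball z r ⊆ XE E) {p q : Plane} (hp : p ∈ Metric.ball z r)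
    (hq : q ∈ Metric.ball z r) : cc φ q p = (cc φ p q)⁻¹ := by
  obtain ⟨P, hP⟩ := cc_ball hφ hr hb
  rw [hP p hp q hq, hP q hq p hp]
  group

end Words

section Injectivity

open Filter Topology unitInterval CategoryTheory

section Groupoid

variable {Y : Type*} [TopologicalSpace Y]

/-- The class of a path in the fundamental groupoid. -/
def arr {a b : Y} (γ : Path a b) : FundamentalGroupoid.mk a ⟶ FundamentalGroupoid.mk b :=
  Path.Homotopic.Quotient.mk γ

theorem arr_trans {a b c : Y} (γ : Path a b) (γ' : Path b c) :
    arr (γ.trans γ') = arr γ ≫ arr γ' := rfl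

theorem arr_refl (a : Y) : arr (Path.refl a) = 𝟙 _ := rfl

theorem arr_symm {a b : Y} (γ : Path a b) : arr γ.symm = inv (arr γ) := by
  rw [← Groupoid.inv_eq_inv]; rfl

theorem arr_eq {a b : Y} {γ γ' : Path a b} : arr γ = arr γ' ↔ γ.Homotopic γ' :=
  Path.Homotopic.Quotient.eq

theorem arr_subpath {a b : Y} (γ : Path a b) (r s t : I) :
    arr (γ.subpath r s) ≫ arr (γ.subpath s t) = arr (γ.subpath r t) := by
  rw [← arr_trans, arr_eq]
  exact ⟨Path.Homotopy.subpathTransSubpath γ r s t⟩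

theorem arr_hol {G : Type*} [Group G] {x : Y} (τ : ∀ y : Y, FundamentalGroupoid.mk x ⟶ .mk y)
    {ψ : Y → Y → G} (hψ : IsLoc Set.univ ψ) (L : G →* (End (FundamentalGroupoid.mk x))ᵐᵒᵖ)
    (h : ∀ z : Y, ∃ U ∈ 𝓝 z, ∀ (p q : Y) (δ : Path p q), (∀ t, δ t ∈ U) →
      L (ψ p q) = .op (τ p ≫ arr δ ≫ inv (τ q))) {a b : Y} (γ : Path a b) :
    L (hol ψ γ) = .op (τ a ≫ arr γ ≫ inv (τ b)) := by
  have hl : IsLift (fun p q => L (ψ p q)) γ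
      fun t => .op (τ (γ 0) ≫ arr (γ.subpath 0 t) ≫ inv (τ (γ t))) := by
    intro t
    obtain ⟨U, hU, hh⟩ := h (γ t)
    have : ∀ᶠ s in 𝓝 t, Set.uIcc t s ⊆ γ ⁻¹' U :=
      (tendsto_const_nhds.uIcc tendsto_id).eventually
        (eventually_smallSets_subset.2 (γ.continuous.continuousAt hU))
    filter_upwards [this] with s hs
    rw [hh _ _ (γ.subpath t s), ← MulOpposite.op_mul, ← arr_subpath γ 0 t s]
    · congr 1
      change _ = (_ ≫ _ ≫ _) ≫ _
      simp
    · intro r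
      have : γ.subpath t s r ∈ Set.range (γ.subpath t s) := ⟨r, rfl⟩
      rw [Path.range_subpath] at this
      obtain ⟨y, hy, hyy⟩ := this
      rw [← hyy]
      exact hs hy
  rw [← hol_map hψ γ.continuous (fun _ => trivial), hl.hol_eq]
  have e0 : τ (γ 0) ≫ arr (γ.subpath 0 0) ≫ inv (τ (γ 0)) = 𝟙 _ := by
    rw [Path.subpath_self, arr_refl]; simp
  rw [e0, Path.subpath_zero_one]
  have e1 : (MulOpposite.op (𝟙 (FundamentalGroupoid.mk x)) :
    (End (FundamentalGroupoid.mk x))ᵐᵒᵖ) = 1 := rfl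
  rw [e1, inv_one, one_mul]
  have : ∀ a' b' (ha : a' = a) (hb : b' = b), τ a' ≫ arr (γ.cast ha hb) ≫ inv (τ b') =
    τ a ≫ arr γ ≫ inv (τ b) := by
    rintro _ _ rfl rfl; rfl
  rw [this]

end Groupoid

variable {E : Set Lab}

theorem homotopic_of_starConvex {S : Set Plane} {s₀ : Plane} (hS : StarConvex ℝ s₀ S)
    (hSE : S ⊆ XE E) {a b : XE E} {γ γ' : Path a b} (h : ∀ t, (γ t : Plane) ∈ S)
    (h' : ∀ t, (γ' t : Plane) ∈ S) : γ.Homotopic γ' := by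
  have : ContractibleSpace S := hS.contractibleSpace ⟨_, h 0⟩
  have ha : (a : Plane) ∈ S := by simpa using h 0
  have hb : (b : Plane) ∈ S := by simpa using h 1
  let δ : Path (⟨a, ha⟩ : S) ⟨b, hb⟩ :=
    ⟨⟨fun t => ⟨γ t, h t⟩, by fun_prop⟩, by simp, by simp⟩
  let δ' : Path (⟨a, ha⟩ : S) ⟨b, hb⟩ :=
    ⟨⟨fun t => ⟨γ' t, h' t⟩, by fun_prop⟩, by simp, by simp⟩
  exact (SimplyConnectedSpace.paths_homotopic δ δ').map ⟨fun p : S => (⟨p, hSE p.2⟩ : XE E),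
    by fun_prop⟩

/-- The straight path in the punctured plane, when there is one. -/
noncomputable def sp (p q : XE E) (h : segment ℝ (p : Plane) q ⊆ XE E) : Path p q :=
  ⟨⟨fun t => ⟨Path.segment (p : Plane) q t, h (by rw [← Path.range_segment]; exact ⟨t, rfl⟩)⟩,
    by fun_prop⟩, by simp, by simp⟩

theorem sp_mem {p q : XE E} {h : segment ℝ (p : Plane) q ⊆ XE E} {S : Set Plane}
    (hS : segment ℝ (p : Plane) q ⊆ S) (t : I) : (sp p q h t : Plane) ∈ S :=
  hS (by rw [← Path.range_segment]; exact ⟨t, rfl⟩)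

theorem cvx_lt {a b x y M : ℝ} (ha : 0 ≤ a) (hb : 0 ≤ b) (hab : a + b = 1) (hx : x < M)
    (hy : y < M) : a * x + b * y < M :=
  convex_Iio (𝕜 := ℝ) M hx hy ha hb hab

theorem cvx_gt {a b x y M : ℝ} (ha : 0 ≤ a) (hb : 0 ≤ b) (hab : a + b = 1) (hx : M < x)
    (hy : M < y) : M < a * x + b * y :=
  convex_Ioi (𝕜 := ℝ) M hx hy ha hb hab

theorem cvx_ge {a b x y M : ℝ} (ha : 0 ≤ a) (hb : 0 ≤ b) (hab : a + b = 1) (hx : M ≤ x)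
    (hy : M ≤ y) : M ≤ a * x + b * y :=
  convex_Ici (𝕜 := ℝ) M hx hy ha hb hab

theorem cvx_gt_of_pos {a b x y M : ℝ} (ha : 0 < a) (hb : 0 ≤ b) (hab : a + b = 1) (hx : M < x)
    (hy : M ≤ y) : M < a * x + b * y := by
  have : M = a * M + b * M := by rw [← add_mul, hab, one_mul]
  rw [this]
  exact add_lt_add_of_lt_of_le (mul_lt_mul_of_pos_left hx ha) (mul_le_mul_of_nonneg_left hy hb)

theorem pt_fst (i : Lab) : (pt i).1 = i.2 := rfl

/-- The middle of a unit cell. -/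
noncomputable def cen (E : Set Lab) (n : ℤ) : XE E :=
  ⟨((n : ℝ) + 1 / 2, 3 / 2), fun i _ h => by
    have h2 := congrArg Prod.snd h
    simp only [pt] at h2
    split_ifs at h2 <;> norm_num at h2⟩

theorem starConvex_cell (E : Set Lab) (n : ℤ) :
    StarConvex ℝ (cen E n : Plane) ({p | ⌊p.1⌋ = n} ∩ XE E) := by
  rintro ⟨y1, y2⟩ ⟨hy, hyE⟩ a b ha hb hab
  simp only [Set.mem_ofPred_eq, Int.floor_eq_iff] at hy
  have hf : ⌊(a • (cen E n : Plane) + b • ((y1, y2) : Plane)).1⌋ = n := by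
    simp only [cen, Prod.smul_mk, Prod.mk_add_mk, smul_eq_mul, Int.floor_eq_iff]
    exact ⟨cvx_ge ha hb hab (by linarith) hy.1, cvx_lt ha hb hab (by linarith) hy.2⟩
  refine ⟨hf, fun i hi h => ?_⟩
  rw [h, pt_fst, Int.floor_intCast] at hf
  have h1 : a * (n + 1 / 2) + b * y1 = (n : ℝ) := by
    have := congrArg Prod.fst h
    simpa [cen, pt_fst, hf] using this
  have ha0 : a = 0 := by
    by_contra h0
    have := cvx_gt_of_pos (lt_of_le_of_ne ha (Ne.symm h0)) hb hab
      (show (n : ℝ) < n + 1 / 2 by linarith) hy.1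
    linarith
  have hb1 : b = 1 := by linarith
  rw [ha0, hb1, zero_smul, one_smul, zero_add] at h
  exact hyE i hi h

/-- A double cell cut along part of its central line. -/
def cutCell (n : ℤ) (J : Set ℝ) : Set Plane :=
  {p | (n : ℝ) - 1 < p.1 ∧ p.1 < n + 1 ∧ (p.1 = n → p.2 ∈ J)}

theorem starConvex_cutCell (n : ℤ) {J : Set ℝ} (hJ : Convex ℝ J) {m : ℝ} (hm : m ∈ J) :
    StarConvex ℝ ((n : ℝ), m) (cutCell n J) := by
  rintro ⟨y1, y2⟩ ⟨h1, h2, h3⟩ a b ha hb hab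
  have e : a * n + b * y1 = n + b * (y1 - n) := by
    have : a = 1 - b := by linarith
    rw [this]; ring
  have hb1 : b ≤ 1 := by linarith
  simp only at h1 h2 h3
  refine ⟨?_, ?_, ?_⟩ <;> simp only [Prod.smul_mk, Prod.mk_add_mk, smul_eq_mul, e]
  · nlinarith
  · nlinarith
  · intro h
    have : b * (y1 - n) = 0 := by linarith
    rcases mul_eq_zero.1 this with hb0 | hy
    · have : a = 1 := by linarith
      simpa [hb0, this] using hm
    · exact hJ hm (h3 (by linarith)) ha hb hab

/-- The condition for a cut cell to avoid the punctures. -/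
def CutOK (E : Set Lab) (n : ℤ) (J : Set ℝ) : Prop :=
  ((false, n) ∈ E → (1 : ℝ) ∉ J) ∧ ((true, n) ∈ E → (2 : ℝ) ∉ J)

theorem CutOK.subset {n : ℤ} {J : Set ℝ} (h : CutOK E n J) : cutCell n J ⊆ XE E := by
  rintro p ⟨h1, h2, h3⟩ ⟨b, m⟩ hi rfl
  simp only [pt] at h1 h2 h3
  have : m = n := by
    have h1' : n - 1 < m := by exact_mod_cast h1
    have h2' : m < n + 1 := by exact_mod_cast h2
    omega
  subst this
  cases b
  · exact h.1 hi (by simpa using h3)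
  · exact h.2 hi (by simpa using h3)

theorem segment_strip (m n : ℤ) :
    segment ℝ (cen E m : Plane) (cen E n) ⊆ {p | 1 < p.2 ∧ p.2 < 2} := by
  have hc : Convex ℝ {p : Plane | 1 < p.2 ∧ p.2 < 2} :=
    (convex_Ioo (1 : ℝ) 2).linear_preimage (LinearMap.snd ℝ ℝ ℝ)
  refine hc.segment_subset ?_ ?_ <;> simp [cen] <;> norm_num

theorem strip_subset : {p : Plane | 1 < p.2 ∧ p.2 < 2} ⊆ XE E := by
  rintro p ⟨h1, h2⟩ i _ rfl
  simp only [pt] at h1 h2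
  split_ifs at h1 h2 <;> linarith

theorem segment_cell (p : XE E) :
    segment ℝ (cen E ⌊(p : Plane).1⌋ : Plane) p ⊆ {q | ⌊q.1⌋ = ⌊(p : Plane).1⌋} ∩ XE E :=
  starConvex_iff_segment_subset.1 (starConvex_cell E _) ⟨rfl, p.2⟩

/-- The path between the middles of two cells. -/
noncomputable def cenPath (E : Set Lab) (m n : ℤ) : Path (cen E m) (cen E n) :=
  sp _ _ ((segment_strip m n).trans strip_subset)

/-- The standard path to a point from the middle of its cell. -/
noncomputable def cellPath (p : XE E) : Path (cen E ⌊(p : Plane).1⌋) p :=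
  sp _ _ ((segment_cell p).trans Set.inter_subset_right)

/-- The standard arrow from the base point. -/
noncomputable def tau (p : XE E) : FundamentalGroupoid.mk (cen E 0) ⟶ .mk p :=
  arr (cenPath E 0 _) ≫ arr (cellPath p)

open Classical in
/-- The arrow crossing a cut cell. -/
noncomputable def crossArr (E : Set Lab) (n : ℤ) (J : Set ℝ) :
    FundamentalGroupoid.mk (cen E (n - 1)) ⟶ .mk (cen E n) :=
  if h : ∃ γ : Path (cen E (n - 1)) (cen E n), ∀ t, (γ t : Plane) ∈ cutCell n J then
    arr h.choose else arr (cenPath E _ _)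

theorem crossArr_eq {n : ℤ} {J : Set ℝ} (hJ : Convex ℝ J) {m : ℝ} (hm : m ∈ J)
    (hE : CutOK E n J) (γ : Path (cen E (n - 1)) (cen E n)) (h : ∀ t, (γ t : Plane) ∈ cutCell n J) :
    arr γ = crossArr E n J := by
  have h' : ∃ γ : Path (cen E (n - 1)) (cen E n), ∀ t, (γ t : Plane) ∈ cutCell n J := ⟨γ, h⟩
  rw [crossArr, dif_pos h', arr_eq]
  exact homotopic_of_starConvex (starConvex_cutCell n hJ hm) hE.subset h h'.choose_spec

/-- The loop crossing a cut cell. -/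
noncomputable def crossLoop (E : Set Lab) (n : ℤ) (J : Set ℝ) :
    End (FundamentalGroupoid.mk (cen E 0)) :=
  arr (cenPath E 0 (n - 1)) ≫ crossArr E n J ≫ inv (arr (cenPath E 0 n))

theorem cenPath_trans (k m n : ℤ) :
    arr (cenPath E k m) ≫ arr (cenPath E m n) = arr (cenPath E k n) := by
  have hc : Convex ℝ {p : Plane | 1 < p.2 ∧ p.2 < 2} :=
    (convex_Ioo (1 : ℝ) 2).linear_preimage (LinearMap.snd ℝ ℝ ℝ)
  rw [← arr_trans, arr_eq]
  have hs : ∀ a b t, (cenPath E a b t : Plane) ∈ {p : Plane | 1 < p.2 ∧ p.2 < 2} := fun a b t =>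
    sp_mem (segment_strip a b) t
  refine homotopic_of_starConvex (s₀ := cen E 0) (hc.starConvex ?_) strip_subset (fun t => ?_)
    (hs _ _)
  · simp only [cen, Set.mem_ofPred_eq]; norm_num
  · rw [Path.trans_apply]
    split_ifs <;> exact hs _ _ _

theorem cutCell_subset_of_le {n : ℤ} {J : Set ℝ} {p q : Plane} (h1 : (n : ℝ) - 1 < p.1)
    (h2 : q.1 < n + 1) (hpq : p.1 ≤ q.1) (h : ∀ c ∈ segment ℝ p q, c.1 = n → c.2 ∈ J) :
    segment ℝ p q ⊆ cutCell n J := by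
  intro c hc
  have hc2 := hc
  obtain ⟨a, b, ha, hb, hab, rfl⟩ := hc
  exact ⟨cvx_gt ha hb hab h1 (by linarith), cvx_lt ha hb hab (by linarith) h2, h _ hc2⟩

theorem cross_eq {n : ℤ} {J : Set ℝ} (hJ : Convex ℝ J) {m : ℝ} (hm : m ∈ J)
    (hE : CutOK E n J) {z : Plane} {r : ℝ} (hr : r ≤ 1 / 2) (hb : Metric.ball z r ⊆ XE E)
    (hz : ∀ c ∈ Metric.ball z r, c.1 = n → c.2 ∈ J) {p q : XE E} (hp : ⌊(p : Plane).1⌋ = n - 1)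
    (hq : ⌊(q : Plane).1⌋ = n) (δ : Path p q) (hδ : ∀ t, (δ t : Plane) ∈ Metric.ball z r) :
    tau p ≫ arr δ ≫ inv (tau q) = crossLoop E n J := by
  have hpb : (p : Plane) ∈ Metric.ball z r := by simpa using hδ 0
  have hqb : (q : Plane) ∈ Metric.ball z r := by simpa using hδ 1
  have hsb : segment ℝ (p : Plane) q ⊆ Metric.ball z r :=
    (convex_ball z r).segment_subset hpb hqb
  have e1 : arr δ = arr (sp p q (hsb.trans hb)) := by
    rw [arr_eq]
    exact homotopic_of_starConvex ((convex_ball z r).starConvex hpb) hb hδ (sp_mem hsb)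
  have hp' := Int.floor_eq_iff.1 hp
  have hq' := Int.floor_eq_iff.1 hq
  push_cast at hp' hq'
  have hp1 : (n : ℝ) - 1 < (p : Plane).1 := by
    rw [mem_ball_plane, abs_lt] at hpb hqb
    linarith [hpb.1.1, hqb.1.2]
  have hcen : ∀ k, (cen E k : Plane).1 = k + 1 / 2 := fun k => rfl
  have key : ∀ k l (hk : k = n - 1) (hl : l = n) (γ : Path (cen E k) p) (γ' : Path (cen E l) q),
      (∀ t, (γ t : Plane) ∈ cutCell n J) → (∀ t, (γ' t : Plane) ∈ cutCell n J) →
      (arr (cenPath E 0 k) ≫ arr γ) ≫ arr (sp p q (hsb.trans hb)) ≫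
        inv (arr (cenPath E 0 l) ≫ arr γ') = crossLoop E n J := by
    rintro k l rfl rfl γ γ' hγ hγ'
    rw [crossLoop, ← crossArr_eq hJ hm hE ((γ.trans (sp p q (hsb.trans hb))).trans γ'.symm)]
    · rw [arr_trans, arr_trans, arr_symm]
      simp
    · have hs : ∀ t, (sp p q (hsb.trans hb) t : Plane) ∈ cutCell l J :=
        sp_mem (cutCell_subset_of_le hp1 (by linarith) (by linarith) fun c hc => hz c (hsb hc))
      intro t
      rw [Path.trans_apply]
      split_ifs
      · rw [Path.trans_apply]
        split_ifs
        · exact hγ _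
        · exact hs _
      · exact hγ' _
  rw [e1]
  refine key _ _ hp hq (cellPath p) (cellPath q) (sp_mem ?_) (sp_mem ?_)
  · rintro c ⟨a, b, ha, hb, hab, rfl⟩
    have : (a • (cen E ⌊(p : Plane).1⌋ : Plane) + b • (p : Plane)).1 =
        a * (n - 1 + 1 / 2) + b * (p : Plane).1 := by
      simp [hcen, hp]
    refine ⟨?_, ?_, ?_⟩ <;> rw [this]
    · exact cvx_gt ha hb hab (by linarith) hp1
    · exact cvx_lt ha hb hab (by linarith) (by linarith)
    · intro h
      have : _ < (n : ℝ) := cvx_lt ha hb hab (show (n : ℝ) - 1 + 1 / 2 < n by linarith)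
        (show (p : Plane).1 < n by linarith)
      linarith
  · rintro c ⟨a, b, ha, hb, hab, rfl⟩
    have : (a • (cen E ⌊(q : Plane).1⌋ : Plane) + b • (q : Plane)).1 =
        a * (n + 1 / 2) + b * (q : Plane).1 := by
      simp [hcen, hq]
    refine ⟨?_, ?_, ?_⟩ <;> rw [this]
    · exact cvx_gt ha hb hab (by linarith) (by linarith)
    · exact cvx_lt ha hb hab (by linarith) hq'.2
    · intro h
      have ha0 : a = 0 := by
        by_contra h0
        have := cvx_gt_of_pos (lt_of_le_of_ne ha (Ne.symm h0)) hb hab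
          (show (n : ℝ) < n + 1 / 2 by linarith) hq'.1
        linarith
      have hb1 : b = 1 := by linarith
      rw [ha0, hb1] at h ⊢
      simp only [zero_smul, one_smul, zero_add]
      exact hz _ hqb (by linarith)

/-- Heights on the central line of a double cell not separated from the middle by a puncture. -/
def midHeights (E : Set Lab) (n : ℤ) : Set ℝ :=
  {y | ((false, n) ∈ E → 1 < y) ∧ ((true, n) ∈ E → y < 2)}

theorem convex_midHeights (n : ℤ) : Convex ℝ (midHeights E n) := by
  intro x hx y hy a b ha hb hab
  exact ⟨fun h => cvx_gt ha hb hab (hx.1 h) (hy.1 h), fun h => cvx_lt ha hb hab (hx.2 h) (hy.2 h)⟩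

theorem mid_mem_midHeights (n : ℤ) : (3 / 2 : ℝ) ∈ midHeights E n :=
  ⟨fun _ => by norm_num, fun _ => by norm_num⟩

theorem cutOK_midHeights (n : ℤ) : CutOK E n (midHeights E n) :=
  ⟨fun h h' => lt_irrefl _ (h'.1 h), fun h h' => lt_irrefl _ (h'.2 h)⟩

theorem crossLoop_mid (n : ℤ) : crossLoop E n (midHeights E n) = 𝟙 _ := by
  have h : ∀ t, (cenPath E (n - 1) n t : Plane) ∈ cutCell n (midHeights E n) := by
    refine sp_mem (cutCell_subset_of_le ?_ ?_ ?_ fun c hc _ => ?_)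
    · simp only [cen]; push_cast; linarith
    · simp only [cen]; linarith
    · simp only [cen]; push_cast; linarith
    · have := segment_strip (E := E) _ _ hc
      exact ⟨fun _ => this.1, fun _ => this.2⟩
  rw [crossLoop,
    ← crossArr_eq (convex_midHeights n) (mid_mem_midHeights n) (cutOK_midHeights n) _ h,
    ← Category.assoc, cenPath_trans]
  simp

/-- Words as loops. -/
noncomputable def wordLoop (E : Set Lab) :
    FreeGroup Lab →* (End (FundamentalGroupoid.mk (cen E 0)))ᵐᵒᵖ :=
  FreeGroup.lift fun i =>
    if i.1 then (.op (crossLoop E i.2 (Set.Ioi 2)))⁻¹ else .op (crossLoop E i.2 (Set.Iio 1))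

theorem wordLoop_ltr {z : Plane} {r : ℝ} (hr : r ≤ 1 / 2)
    (hb : Metric.ball z r ⊆ XE E) {n : ℤ} {p q : XE E}
    (hp : ⌊(p : Plane).1⌋ = n - 1) (hq : ⌊(q : Plane).1⌋ = n) (δ : Path p q)
    (hδ : ∀ t, (δ t : Plane) ∈ Metric.ball z r) :
    wordLoop E (ltr (un E) n (p : Plane).2) = .op (tau p ≫ arr δ ≫ inv (tau q)) := by
  have hpb : (p : Plane) ∈ Metric.ball z r := by simpa using hδ 0
  have hp1 := mem_ball_plane.1 hpb
  rw [abs_lt, abs_lt] at hp1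
  have key : ∀ (b : Bool) (c : Plane), (b, n) ∈ E → c ∈ Metric.ball z r → c.1 = n →
      ¬ |(if b then 2 else 1) - z.2| < r := fun b c hE hc hcn h =>
    hb (show pt (b, n) ∈ _ from mem_ball_plane.2
      ⟨by rw [pt_fst, ← hcn]; exact (mem_ball_plane.1 hc).1, h⟩) _ hE rfl
  have key1 : ∀ c : Plane, (false, n) ∈ E → c ∈ Metric.ball z r → c.1 = n →
      ((p : Plane).2 < 1 ↔ c.2 < 1) ∧ c.2 ≠ 1 := by
    intro c hE hc hcn
    have := key _ c hE hc hcn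
    rw [mem_ball_plane, abs_lt, abs_lt] at hc
    rw [abs_lt] at this
    simp only [Bool.false_eq_true, if_false, not_and_or, not_lt] at this
    refine ⟨⟨fun h => ?_, fun h => ?_⟩, fun h => ?_⟩ <;> rcases this with h' | h' <;> linarith
  have key2 : ∀ c : Plane, (true, n) ∈ E → c ∈ Metric.ball z r → c.1 = n →
      (2 < (p : Plane).2 ↔ 2 < c.2) ∧ c.2 ≠ 2 := by
    intro c hE hc hcn
    have := key _ c hE hc hcn
    rw [mem_ball_plane, abs_lt, abs_lt] at hc
    rw [abs_lt] at this
    simp only [if_true, not_and_or, not_lt] at this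
    refine ⟨⟨fun h => ?_, fun h => ?_⟩, fun h => ?_⟩ <;> rcases this with h' | h' <;> linarith
  have mid : ((false, n) ∈ E → 1 ≤ (p : Plane).2) → ((true, n) ∈ E → (p : Plane).2 ≤ 2) →
      tau p ≫ arr δ ≫ inv (tau q) = 𝟙 _ := by
    intro h1 h2
    rw [cross_eq (convex_midHeights n) (mid_mem_midHeights n) (cutOK_midHeights n) hr hb
      (fun c hc hcn => ⟨fun hE => ?_, fun hE => ?_⟩) hp hq δ hδ, crossLoop_mid]
    · obtain ⟨h3, h4⟩ := key1 c hE hc hcn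
      exact lt_of_le_of_ne (not_lt.1 fun h => absurd (h3.2 h) (not_lt.2 (h1 hE))) h4.symm
    · obtain ⟨h3, h4⟩ := key2 c hE hc hcn
      exact lt_of_le_of_ne (not_lt.1 fun h => absurd (h3.2 h) (not_lt.2 (h2 hE))) h4
  have op_id : MulOpposite.op (𝟙 (FundamentalGroupoid.mk (cen E 0))) =
    (1 : (End (FundamentalGroupoid.mk (cen E 0)))ᵐᵒᵖ) := rfl
  rw [ltr]
  split_ifs with h1 h2
  · by_cases hE : (false, n) ∈ E
    · rw [un_mem hE, wordLoop, FreeGroup.lift_apply_of,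
        cross_eq (convex_Iio 1) (show (0 : ℝ) ∈ Set.Iio 1 by simp) ⟨fun _ => by simp,
          fun _ => by simp⟩ hr hb (fun c hc hcn => (key1 c hE hc hcn).1.1 h1) hp hq δ hδ]
      simp
    · rw [un_notMem hE, map_one, mid (fun h => absurd h hE) (fun _ => by linarith), op_id]
  · by_cases hE : (true, n) ∈ E
    · rw [un_mem hE, wordLoop, map_inv, FreeGroup.lift_apply_of,
        cross_eq (convex_Ioi 2) (show (3 : ℝ) ∈ Set.Ioi 2 by simp; norm_num) ⟨fun _ => by simp,
          fun _ => by simp⟩ hr hb (fun c hc hcn => (key2 c hE hc hcn).1.1 h2) hp hq δ hδ]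
      simp
    · rw [un_notMem hE, inv_one, map_one, mid (fun _ => by linarith) (fun h => absurd h hE), op_id]
  · rw [map_one, mid (fun _ => by linarith) (fun _ => by linarith), op_id]

theorem wordLoop_hol {a b : XE E} (γ : Path a b) :
    wordLoop E (hol (cc (un E)) fun t => (γ t : Plane)) =
      .op (tau a ≫ arr γ ≫ inv (tau b)) := by
  have hun : ∀ i ∉ E, un E i = 1 := fun i => un_notMem
  have hψ : IsLoc Set.univ fun p q : XE E => cc (un E) (p : Plane) q := by
    intro z _
    obtain ⟨P, U, hU, h⟩ := isLoc_cc hun z z.2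
    exact ⟨fun p => P p, Subtype.val ⁻¹' U, continuous_subtype_val.continuousAt hU,
      fun p hp q hq => h p hp q hq⟩
  refine arr_hol tau hψ (wordLoop E) (fun z => ?_) γ
  obtain ⟨r, hr0, hr, hb⟩ := exists_ball_XE z.2
  refine ⟨Subtype.val ⁻¹' Metric.ball (z : Plane) r,
    continuous_subtype_val.continuousAt (Metric.ball_mem_nhds _ hr0), fun p q δ hδ => ?_⟩
  have hpb : (p : Plane) ∈ Metric.ball (z : Plane) r := by
    have h := hδ 0
    rw [δ.source] at h
    exact h
  have hqb : (q : Plane) ∈ Metric.ball (z : Plane) r := by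
    have h := hδ 1
    rw [δ.target] at h
    exact h
  obtain ⟨n, hn⟩ := floor_ball (z := (z : Plane)) hr
  have same : ⌊(p : Plane).1⌋ = ⌊(q : Plane).1⌋ →
      wordLoop E (cc (un E) (p : Plane) q) = .op (tau p ≫ arr δ ≫ inv (tau q)) := by
    intro h
    have h1 : cc (un E) (p : Plane) q = 1 := by simp [cc, h]
    have hsb : segment ℝ (p : Plane) q ⊆ Metric.ball (z : Plane) r :=
      (convex_ball _ r).segment_subset hpb hqb
    have hcx : Convex ℝ {c : Plane | ⌊c.1⌋ = ⌊(p : Plane).1⌋} := by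
      have : {c : Plane | ⌊c.1⌋ = ⌊(p : Plane).1⌋} = LinearMap.fst ℝ ℝ ℝ ⁻¹'
          Set.Ico (⌊(p : Plane).1⌋ : ℝ) (⌊(p : Plane).1⌋ + 1) := by
        ext c; simp [Int.floor_eq_iff]
      rw [this]
      exact (convex_Ico _ _).linear_preimage _
    have e1 : arr δ = arr (sp p q (hsb.trans hb)) := by
      rw [arr_eq]
      exact homotopic_of_starConvex ((convex_ball _ r).starConvex hpb) hb hδ (sp_mem hsb)
    have hcell : ∀ t, (sp p q (hsb.trans hb) t : Plane) ∈
        {c : Plane | ⌊c.1⌋ = ⌊(p : Plane).1⌋} ∩ XE E := fun t =>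
      ⟨sp_mem (hcx.segment_subset rfl h.symm) t, (sp p q (hsb.trans hb) t).2⟩
    have gen : ∀ k (hk : k = ⌊(p : Plane).1⌋) (γ' : Path (cen E k) q),
        (∀ t, (γ' t : Plane) ∈ {c : Plane | ⌊c.1⌋ = ⌊(p : Plane).1⌋} ∩ XE E) →
        tau p ≫ arr δ ≫ inv (arr (cenPath E 0 k) ≫ arr γ') = 𝟙 _ := by
      rintro k rfl γ' hγ'
      have : arr (cellPath p) ≫ arr δ = arr γ' := by
        rw [e1, ← arr_trans, arr_eq]
        refine homotopic_of_starConvex (starConvex_cell E _) Set.inter_subset_right (fun t => ?_)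
          hγ'
        rw [Path.trans_apply]
        split_ifs
        · exact sp_mem (segment_cell p) _
        · exact hcell _
      rw [tau, Category.assoc, ← Category.assoc (arr (cellPath p)), this]
      simp
    rw [h1, map_one, tau, tau] at *
    have h4 := gen _ h.symm (cellPath q) (by rw [h]; exact sp_mem (segment_cell q))
    exact (congrArg MulOpposite.op h4).symm
  rcases hn p hpb with ⟨f1, _⟩ | ⟨f1, _⟩ <;> rcases hn q hqb with ⟨f2, _⟩ | ⟨f2, _⟩
  · exact same (f1.trans f2.symm)
  · rw [← wordLoop_ltr hr hb f1 f2 δ hδ]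
    simp [cc, f1, f2]
  · have h := wordLoop_ltr hr hb f2 f1 δ.symm fun t => hδ _
    have h3 : cc (un E) (q : Plane) p = ltr (un E) n (q : Plane).2 := by simp [cc, f1, f2]
    rw [cc_swap hun hr hb hqb hpb, h3, map_inv, h, inv_eq_iff_mul_eq_one, ← MulOpposite.op_mul,
      arr_symm]
    refine congrArg MulOpposite.op (?_ : (_ ≫ _ ≫ _) ≫ _ ≫ _ ≫ _ = 𝟙 _)
    simp
  · exact same (f1.trans f2.symm)

/-- The holonomy classifies paths up to homotopy. -/
theorem homotopic_of_hol_eq {a b : XE E} {γ γ' : Path a b}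
    (h : hol (cc (un E)) (fun t => (γ t : Plane)) = hol (cc (un E)) fun t => (γ' t : Plane)) :
    γ.Homotopic γ' := by
  have h1 := wordLoop_hol γ
  rw [h, wordLoop_hol γ'] at h1
  have h2 := MulOpposite.op_injective h1
  rw [← arr_eq]
  have h3 : tau a ≫ arr γ ≫ inv (tau b) = tau a ≫ arr γ' ≫ inv (tau b) := h2.symm
  exact (cancel_mono _).1 ((cancel_epi _).1 h3)

end Injectivity

section Loops

open Filter Topology unitInterval

variable {H : Type*} [Group H] {E E' : Set Lab}

/-- The word read by a path, letters outside `E` being ignored. -/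
noncomputable def hl (E : Set Lab) (f : I → Plane) : FreeGroup Lab := hol (cc (un E)) f

/-- The endomorphism killing the letters outside `E`. -/
noncomputable def keep (E : Set Lab) : FreeGroup Lab →* FreeGroup Lab := FreeGroup.lift (un E)

theorem keep_of (E : Set Lab) (i : Lab) : keep E (.of i) = un E i := FreeGroup.lift_apply_of

theorem keep_un (h : E ⊆ E') (i : Lab) : keep E (un E' i) = un E i := by
  by_cases hi : i ∈ E'
  · rw [un_mem hi, keep_of]
  · rw [un_notMem hi, map_one, un_notMem fun h' => hi (h h')]

theorem un_keep (h : E ⊆ E') (i : Lab) : keep E' (un E i) = un E i := by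
  by_cases hi : i ∈ E
  · rw [un_mem hi, keep_of, un_mem (h hi)]
  · rw [un_notMem hi, map_one]

theorem keep_keep (h : E ⊆ E') (u : FreeGroup Lab) : keep E (keep E' u) = keep E u := by
  have : (keep E).comp (keep E') = keep E := by ext i; simp [keep_of, keep_un h]
  exact DFunLike.congr_fun this u

theorem keep_keep' (h : E ⊆ E') (u : FreeGroup Lab) : keep E' (keep E u) = keep E u := by
  have : (keep E').comp (keep E) = keep E := by ext i; simp [keep_of, un_keep h]
  exact DFunLike.congr_fun this u

theorem isLoc_un (E : Set Lab) : IsLoc (XE E) (cc (un E)) := isLoc_cc fun _ => un_notMem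

theorem hl_keep (h : E ⊆ E') {f : I → Plane} (hf : Continuous f) (hX : ∀ t, f t ∈ XE E') :
    hl E f = keep E (hl E' f) := by
  rw [hl, hl, ← hol_map (isLoc_un E') hf hX]
  congr 1
  funext p q
  rw [← cc_map]
  congr 1
  funext i
  rw [keep_un h]

theorem keep_hl {f : I → Plane} (hf : Continuous f) (hX : ∀ t, f t ∈ XE E) :
    keep E (hl E f) = hl E f := (hl_keep subset_rfl hf hX).symm

theorem cc_strip {φ : Lab → H} {p q : Plane} (h1 : 1 ≤ p.2) (h2 : p.2 ≤ 2) : cc φ p q = 1 := by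
  simp [cc, ltr, not_lt.2 h1, not_lt.2 h2]

theorem hol_strip {φ : Lab → H} {f : I → Plane} (h : ∀ t, 1 ≤ (f t).2 ∧ (f t).2 ≤ 2) :
    hol (cc φ) f = 1 := by
  have := hol_potential (c := cc φ) (f := f) (fun _ => 1) fun t => .of_forall fun a => by
    rw [cc_strip (h t).1 (h t).2]; simp
  simpa using this

theorem hl_strip {f : I → Plane} (h : ∀ t, 1 ≤ (f t).2 ∧ (f t).2 ≤ 2) : hl E f = 1 := hol_strip h

theorem hol_floor {φ : Lab → H} (Q : ℤ → H) {f : I → Plane} (hf : Continuous f)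
    (h : ∀ t, ∀ m : ℤ, (f t).1 = m → Q m = Q (m - 1) * ltr φ m (f t).2) :
    hol (cc φ) f = (Q ⌊(f 0).1⌋)⁻¹ * Q ⌊(f 1).1⌋ := by
  refine hol_potential (fun p : Plane => Q ⌊p.1⌋) fun t => ?_
  have hc : Continuous fun t => (f t).1 := by fun_prop
  by_cases hm : ∃ m : ℤ, (f t).1 = m
  · obtain ⟨m, hm⟩ := hm
    have hn : ∀ᶠ a in 𝓝 t, (f a).1 ∈ Set.Ioo ((m : ℝ) - 1) (m + 1) :=
      hc.continuousAt (Ioo_mem_nhds (by rw [hm]; linarith) (by rw [hm]; linarith))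
    filter_upwards [hn] with a ha
    have e1 : ⌊(f t).1⌋ = m := by rw [hm, Int.floor_intCast]
    rcases lt_or_ge (f a).1 m with h1 | h1
    · have e2 : ⌊(f a).1⌋ = m - 1 := by
        rw [Int.floor_eq_iff]; push_cast; exact ⟨ha.1.le, by linarith⟩
      rw [cc, e1, e2, h t m hm, if_neg (by omega), if_pos (by omega)]
      group
    · have e2 : ⌊(f a).1⌋ = m := by
        rw [Int.floor_eq_iff]; exact ⟨h1, ha.2⟩
      simp [cc, e1, e2]
  · have h1 : ((⌊(f t).1⌋ : ℤ) : ℝ) < (f t).1 :=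
      lt_of_le_of_ne (Int.floor_le _) fun h => hm ⟨_, h.symm⟩
    have hn : ∀ᶠ a in 𝓝 t, (f a).1 ∈ Set.Ioo (⌊(f t).1⌋ : ℝ) (⌊(f t).1⌋ + 1) :=
      hc.continuousAt (Ioo_mem_nhds h1 (Int.lt_floor_add_one _))
    filter_upwards [hn] with a ha
    have e2 : ⌊(f a).1⌋ = ⌊(f t).1⌋ := by
      rw [Int.floor_eq_iff]; exact ⟨ha.1.le, ha.2⟩
    simp [cc, e2]

theorem hl_trans {a b c : Plane} (γ : Path a b) (γ' : Path b c) (h : ∀ t, γ t ∈ XE E)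
    (h' : ∀ t, γ' t ∈ XE E) : hl E (γ.trans γ') = hl E γ * hl E γ' :=
  hol_trans (isLoc_un E) γ γ' h h'

theorem hl_symm {a b : Plane} (γ : Path a b) (h : ∀ t, γ t ∈ XE E) :
    hl E γ.symm = (hl E γ)⁻¹ := hol_symm (isLoc_un E) γ h

theorem trans_mem {X : Set Plane} {a b c : Plane} {γ : Path a b} {γ' : Path b c}
    (h : ∀ t, γ t ∈ X) (h' : ∀ t, γ' t ∈ X) (t : I) : γ.trans γ' t ∈ X := by
  rw [Path.trans_apply]
  split_ifs
  · exact h _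
  · exact h' _

theorem hl_comp_trans {a b c : Plane} (γ : Path a b) (γ' : Path b c) {Ψ : Plane → Plane}
    (hΨ : Continuous Ψ) (h : ∀ t, Ψ (γ t) ∈ XE E) (h' : ∀ t, Ψ (γ' t) ∈ XE E) :
    hl E (Ψ ∘ γ.trans γ') = hl E (Ψ ∘ γ) * hl E (Ψ ∘ γ') := by
  rw [← Path.map_coe γ hΨ, ← Path.map_coe γ' hΨ, ← hl_trans _ _ (fun t => by simpa using h t)
    (fun t => by simpa using h' t), ← Path.map_trans]
  rfl

theorem hl_comp_symm {a b : Plane} (γ : Path a b) {Ψ : Plane → Plane}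
    (hΨ : Continuous Ψ) (h : ∀ t, Ψ (γ t) ∈ XE E) :
    hl E (Ψ ∘ γ.symm) = (hl E (Ψ ∘ γ))⁻¹ := by
  rw [← Path.map_coe γ hΨ, ← hl_symm _ (fun t => by simpa using h t)]
  rfl

/-- Paths with the same word have images with the same word. -/
theorem hl_comp_eq {a b : Plane} {γ γ' : Path a b} (h : ∀ t, γ t ∈ XE E) (h' : ∀ t, γ' t ∈ XE E)
    (e : hl E γ = hl E γ') {Ψ : Plane → Plane} (hΨ : Continuous Ψ)
    (hm : Set.MapsTo Ψ (XE E) (XE E')) : hl E' (Ψ ∘ γ) = hl E' (Ψ ∘ γ') := by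
  have ha : a ∈ XE E := by simpa using h 0
  have hb : b ∈ XE E := by simpa using h 1
  let δ : Path (⟨a, ha⟩ : XE E) ⟨b, hb⟩ :=
    ⟨⟨fun t => ⟨γ t, h t⟩, by fun_prop⟩, by simp, by simp⟩
  let δ' : Path (⟨a, ha⟩ : XE E) ⟨b, hb⟩ :=
    ⟨⟨fun t => ⟨γ' t, h' t⟩, by fun_prop⟩, by simp, by simp⟩
  obtain ⟨K⟩ : δ.Homotopic δ' := homotopic_of_hol_eq e
  have := hol_homotopic (isLoc_un E') (K := fun s => Ψ (K s)) (by fun_prop)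
    (fun t => hm (K t).2) (fun s => by simp) (fun s => by simp)
  simp only [ContinuousMap.HomotopyWith.apply_zero, ContinuousMap.HomotopyWith.apply_one] at this
  exact this

end Loops

section StandardLoops

open Filter Topology unitInterval

variable {E E' : Set Lab}

theorem pt_snd (i : Lab) : (pt i).2 = 1 ∨ (pt i).2 = 2 := by
  rcases i with ⟨_ | _, n⟩ <;> simp [pt]

theorem mem_XE_of_mid {p : Plane} (h : 1 < p.2 ∧ p.2 < 2) : p ∈ XE E := by
  rintro i - rfl
  rcases pt_snd i with h' | h' <;> rw [h'] at h <;> linarith [h.1, h.2]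

theorem segment_mid {a b : Plane} (ha : 1 ≤ a.2 ∧ a.2 ≤ 2) (haE : a ∈ XE E)
    (hb : 1 < b.2 ∧ b.2 < 2) (t : I) : Path.segment a b t ∈
      {p : Plane | p ∈ XE E ∧ (1 ≤ p.2 ∧ p.2 ≤ 2) ∧ p.2 ≤ max a.2 b.2} := by
  have ht0 := t.2.1
  have ht1 := t.2.2
  have h2 : (Path.segment a b t).2 = (1 - t) * a.2 + t * b.2 := by
    simp [Path.segment, AffineMap.lineMap_apply]; ring
  rcases ht0.eq_or_lt with h0 | h0
  · have : t = 0 := Subtype.ext h0.symm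
    subst this
    simp [haE, ha]
  · have h3 : 1 < (Path.segment a b t).2 ∧ (Path.segment a b t).2 < 2 := by
      rw [h2]; constructor <;> nlinarith
    refine ⟨mem_XE_of_mid h3, ⟨h3.1.le, h3.2.le⟩, ?_⟩
    rw [h2]
    nlinarith [le_max_left a.2 b.2, le_max_right a.2 b.2]

/-- A path crossing the line over `n` rightwards, going from the height `l` to the height
`l + d` and back. -/
noncomputable def vee (n : ℤ) (l d : ℝ) : Path ((n - 1 / 2 : ℝ), l) ((n + 1 / 2 : ℝ), l) where
  toFun t := (n - 1 / 2 + t, l + d * (1 - |2 * (t : ℝ) - 1|))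
  continuous_toFun := by fun_prop
  source' := by simp
  target' := by ext <;> norm_num; ring

theorem vee_cut {n m : ℤ} {l d : ℝ} {t : I} (h : (vee n l d t).1 = m) :
    m = n ∧ (vee n l d t).2 = l + d := by
  have h : (n : ℝ) - 1 / 2 + t = m := h
  have ht0 := t.2.1
  have ht1 := t.2.2
  have e : m = n := by
    have h1 : (m : ℝ) < n + 1 := by linarith
    have h2 : (n : ℝ) < m + 1 := by linarith
    norm_cast at h1 h2
    omega
  subst e
  have : (t : ℝ) = 1 / 2 := by linarith
  refine ⟨rfl, ?_⟩
  change l + d * (1 - |2 * (t : ℝ) - 1|) = _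
  rw [this]; norm_num

theorem hl_vee (n : ℤ) (l d : ℝ) : hl E (vee n l d) = ltr (un E) n (l + d) := by
  rw [hl, hol_floor (fun m => if m < n then 1 else ltr (un E) n (l + d)) (vee n l d).continuous]
  · have h0 : ⌊(vee n l d 0).1⌋ = n - 1 := by
      rw [Path.source, Int.floor_eq_iff]; push_cast; constructor <;> linarith
    have h1 : ⌊(vee n l d 1).1⌋ = n := by
      rw [Path.target, Int.floor_eq_iff]; push_cast; constructor <;> linarith
    rw [h0, h1]
    simp
  · intro t m hm
    obtain ⟨rfl, h2⟩ := vee_cut hm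
    simp [h2]

theorem vee_mem {n : ℤ} {l d : ℝ} (h1 : l + d ≠ 1) (h2 : l + d ≠ 2) (t : I) :
    vee n l d t ∈ XE E := by
  rintro i - h
  have := (vee_cut (m := i.2) (by rw [h]; rfl)).2
  rw [h] at this
  rcases pt_snd i with h' | h' <;> rw [h'] at this
  · exact h1 this.symm
  · exact h2 this.symm

/-- The loop based at `a` around a puncture over `n`. -/
noncomputable def stdLoop (a : Plane) (n : ℤ) (l d : ℝ) : Path a a :=
  ((Path.segment a _).trans (vee n l d)).trans (Path.segment a _).symm

theorem stdLoop_mem {a : Plane} (ha : 1 ≤ a.2 ∧ a.2 ≤ 2) (haE : a ∈ XE E) {n : ℤ} {l d : ℝ}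
    (hl : 1 < l ∧ l < 2) (h1 : l + d ≠ 1) (h2 : l + d ≠ 2) (t : I) : stdLoop a n l d t ∈ XE E :=
  trans_mem (trans_mem (fun t => (segment_mid ha haE hl t).1) (vee_mem h1 h2))
    (fun _ => (segment_mid ha haE hl _).1) t

theorem hl_stdLoop {a : Plane} (ha : 1 ≤ a.2 ∧ a.2 ≤ 2) (haE : a ∈ XE E) {n : ℤ} {l d : ℝ}
    (hl' : 1 < l ∧ l < 2) (h1 : l + d ≠ 1) (h2 : l + d ≠ 2) :
    hl E (stdLoop a n l d) = ltr (un E) n (l + d) := by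
  have hs : ∀ x : ℝ, ∀ t, Path.segment a (x, l) t ∈ XE E := fun x t =>
    (segment_mid (b := (x, l)) ha haE hl' t).1
  have hs' : ∀ x : ℝ, hl E (Path.segment a (x, l)) = 1 := fun x =>
    hl_strip fun t => (segment_mid (b := (x, l)) ha haE hl' t).2.1
  rw [stdLoop, hl_trans _ _ (trans_mem (hs _) (vee_mem h1 h2)) (fun t => hs _ _),
    hl_trans _ _ (hs _) (vee_mem h1 h2), hl_symm _ (hs _), hs', hs', hl_vee]
  group

theorem vee_le {n : ℤ} {l d : ℝ} (hd : d ≤ 0) (t : I) : (vee n l d t).2 ≤ l := by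
  have h : (vee n l d t).2 = l + d * (1 - |2 * (t : ℝ) - 1|) := rfl
  have : |2 * (t : ℝ) - 1| ≤ 1 := by
    rw [abs_le]; constructor <;> linarith [t.2.1, t.2.2]
  rw [h]
  nlinarith

/-- The loop around a puncture of the lower line stays low. -/
theorem stdLoop_low {a : Plane} (ha : a.2 = 1) {n : ℤ} {l d : ℝ} (hl : 1 < l ∧ l < 2)
    (hd : d ≤ 0) (t : I) : (stdLoop a n l d t).2 ≤ l := by
  have hs : ∀ x : ℝ, ∀ t, Path.segment a (x, l) t ∈ {p : Plane | p.2 ≤ l} := by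
    intro x t
    have := (segment_mid (E := ∅) (b := (x, l)) (a := a) (by rw [ha]; norm_num)
      (by simp [XE]) hl t).2.2
    rw [ha, max_eq_right hl.1.le] at this
    exact this
  have h1 := trans_mem (X := {p : Plane | p.2 ≤ l}) (hs (n - 1 / 2))
    (fun t => vee_le (n := n) (l := l) hd t)
  have h2 : ∀ t, (Path.segment a (n + 1 / 2, l)).symm t ∈ {p : Plane | p.2 ≤ l} :=
    fun t => hs _ _
  exact trans_mem h1 h2 t

theorem exists_loop_of {a : Plane} (ha : 1 ≤ a.2 ∧ a.2 ≤ 2) (haE : a ∈ XE E) (i : Lab) :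
    ∃ γ : Path a a, (∀ t, γ t ∈ XE E) ∧ hl E γ = un E i := by
  rcases i with ⟨_ | _, n⟩
  · refine ⟨stdLoop a n (9 / 8) (-(9 / 8)), stdLoop_mem ha haE (by norm_num) (by norm_num)
      (by norm_num), ?_⟩
    rw [hl_stdLoop ha haE (by norm_num) (by norm_num) (by norm_num)]
    norm_num [ltr]
  · have hm := stdLoop_mem (E := E) (n := n) (l := 15 / 8) (d := 9 / 8) ha haE (by norm_num)
      (by norm_num) (by norm_num)
    refine ⟨(stdLoop a n (15 / 8) (9 / 8)).symm, fun t => hm _, ?_⟩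
    rw [hl_symm _ hm, hl_stdLoop ha haE (by norm_num) (by norm_num) (by norm_num)]
    norm_num [ltr]

theorem exists_loop {a : Plane} (ha : 1 ≤ a.2 ∧ a.2 ≤ 2) (haE : a ∈ XE E) (u : FreeGroup Lab) :
    ∃ γ : Path a a, (∀ t, γ t ∈ XE E) ∧ hl E γ = keep E u := by
  induction u using FreeGroup.induction_on with
  | C1 =>
    exact ⟨Path.refl a, fun t => haE, by
      rw [map_one]; exact hol_const (isLoc_un E) haE⟩
  | of i => simpa [keep_of] using exists_loop_of ha haE i
  | inv_of i h =>
    obtain ⟨γ, h1, h2⟩ := h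
    exact ⟨γ.symm, fun t => h1 _, by rw [hl_symm _ h1, h2, ← map_inv]⟩
  | mul u v h h' =>
    obtain ⟨γ, h1, h2⟩ := h
    obtain ⟨γ', h1', h2'⟩ := h'
    exact ⟨γ.trans γ', trans_mem h1 h1', by rw [hl_trans _ _ h1 h1', h2, h2', map_mul]⟩

/-- The action of a map on words. -/
theorem exists_act {a : Plane} (ha : 1 ≤ a.2 ∧ a.2 ≤ 2) (haE : a ∈ XE E) {Ψ : Plane → Plane}
    (hΨ : Continuous Ψ) (hm : Set.MapsTo Ψ (XE E) (XE E')) :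
    ∃ α : FreeGroup Lab →* FreeGroup Lab, (∀ u, α (keep E u) = α u) ∧
      ∀ γ : Path a a, (∀ t, γ t ∈ XE E) → hl E' (Ψ ∘ γ) = α (hl E γ) := by
  choose g hg h using exists_loop ha haE
  have key : ∀ γ : Path a a, (∀ t, γ t ∈ XE E) → ∀ u, hl E γ = keep E u →
      hl E' (Ψ ∘ γ) = hl E' (Ψ ∘ g u) := fun γ hγ u hu =>
    hl_comp_eq hγ (hg _) (by rw [h, hu]) hΨ hm
  refine ⟨MonoidHom.mk' (fun u => hl E' (Ψ ∘ g u)) fun u v => ?_, fun u => ?_, fun γ hγ => ?_⟩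
  · rw [← hl_comp_trans _ _ hΨ (fun t => hm (hg _ t)) (fun t => hm (hg _ t))]
    refine (key _ (trans_mem (hg _) (hg _)) _ ?_).symm
    rw [hl_trans _ _ (hg _) (hg _), h, h, map_mul]
  · exact key _ (hg _) _ (by rw [h, keep_keep subset_rfl])
  · exact key _ hγ _ (keep_hl γ.continuous hγ).symm

end StandardLoops

section FreeGroups

open FreeGroup

theorem mk_singleton_mem_zpowers {α : Type*} (i : α) (e : Bool) :
    FreeGroup.mk [(i, e)] ∈ Subgroup.zpowers (of i) := by
  cases e
  · exact Subgroup.mem_zpowers_iff.2 ⟨-1, by simp [of, inv_mk, invRev]⟩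
  · exact Subgroup.mem_zpowers (of i)

variable {α : Type*} [DecidableEq α]

theorem toWord_mul_of_chain {g h : FreeGroup α}
    (hc : ∀ x ∈ g.toWord.getLast?, ∀ y ∈ h.toWord.head?, x.1 = y.1 → x.2 = y.2) :
    (g * h).toWord = g.toWord ++ h.toWord := by
  rw [toWord_mul]
  exact IsReduced.reduce_eq (List.isChain_append.2 ⟨isReduced_toWord, isReduced_toWord, hc⟩)

theorem toWord_mk_of_sublist {l : List (α × Bool)} {g : FreeGroup α} (h : l <:+: g.toWord) :
    (FreeGroup.mk l).toWord = l := by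
  rw [toWord_mk]
  obtain ⟨s, t, e⟩ := h
  have hc := isReduced_toWord (x := g)
  rw [← e] at hc
  exact IsReduced.reduce_eq (List.isChain_append.1 (List.isChain_append.1 hc).1).2.1

/-- The centralizer of a generator is the cyclic group it generates. -/
theorem mem_zpowers_of_commute (i : α) (v : FreeGroup α) (h : Commute v (of i)) :
    v ∈ Subgroup.zpowers (of i) := by
  induction hn : v.toWord.length using Nat.strong_induction_on generalizing v with
  | _ n ih =>
    have hz : ∀ e, Commute v (FreeGroup.mk [(i, e)]) := fun e => by
      obtain ⟨k, hk⟩ := Subgroup.mem_zpowers_iff.1 (mk_singleton_mem_zpowers i e)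
      rw [← hk]
      exact h.zpow_right k
    rcases hw : v.toWord with _ | ⟨l, w⟩
    · rw [toWord_eq_nil_iff.1 hw]
      exact Subgroup.one_mem _
    · have hl : l.1 = i := by
        by_contra hne
        obtain ⟨m, hm⟩ : ∃ m, v.toWord.getLast? = some m := by
          rw [hw]; exact ⟨_, List.getLast?_eq_some_getLast (List.cons_ne_nil _ _)⟩
        have e0 : (FreeGroup.mk [(i, m.2)]).toWord = [(i, m.2)] := by
          rw [toWord_mk]; exact IsReduced.reduce_eq .singleton
        have e1 := toWord_mul_of_chain (g := v) (h := FreeGroup.mk [(i, m.2)]) (by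
          rw [hm, e0]
          simp)
        have e2 := toWord_mul_of_chain (g := FreeGroup.mk [(i, m.2)]) (h := v) (by
          rw [e0, hw]
          simpa using fun h => absurd h.symm hne)
        rw [hz m.2, e2, e0, hw] at e1
        simp only [List.cons_append, List.nil_append, List.cons.injEq] at e1
        exact hne (by rw [← e1.1])
      have hv : v = FreeGroup.mk [l] * FreeGroup.mk w := by
        rw [mul_mk, ← mk_toWord (x := v), hw]; rfl
      have h1 : FreeGroup.mk [l] ∈ Subgroup.zpowers (of i) := by
        rw [← hl]; exact mk_singleton_mem_zpowers l.1 l.2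
      have h2 : Commute (FreeGroup.mk w) (of i) := by
        obtain ⟨k, hk⟩ := Subgroup.mem_zpowers_iff.1 h1
        have : FreeGroup.mk w = (FreeGroup.mk [l])⁻¹ * v := by rw [hv]; group
        rw [this, ← hk]
        exact ((Commute.refl _).zpow_left k).inv_left.mul_left h
      have hw' : (FreeGroup.mk w).toWord = w :=
        toWord_mk_of_sublist (g := v) (by rw [hw]; exact (List.suffix_cons l w).isInfix)
      rw [hv]
      exact Subgroup.mul_mem _ h1 (ih w.length (by rw [← hn, hw]; simp) _ h2 (by rw [hw']))

theorem eq_one_of_commute {i j : α} (hij : i ≠ j) {v : FreeGroup α} (hi : Commute v (of i))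
    (hj : Commute v (of j)) : v = 1 := by
  obtain ⟨a, ha⟩ := Subgroup.mem_zpowers_iff.1 (mem_zpowers_of_commute i v hi)
  obtain ⟨b, hb⟩ := Subgroup.mem_zpowers_iff.1 (mem_zpowers_of_commute j v hj)
  let f : FreeGroup α →* FreeGroup α := FreeGroup.lift fun k => if k = i then 1 else of k
  have h1 : f v = 1 := by rw [← ha, map_zpow]; simp [f]
  have h2 : f v = v := by rw [← hb, map_zpow]; simp [f, hij.symm]
  rw [← h2, h1]

/-- The number of occurrences of the second generator. -/
def bCount (g : FreeGroup Bool) : ℕ := g.toWord.countP (·.1)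

/-- The reduced word starts with the second generator or its inverse. -/
def BHead (g : FreeGroup Bool) : Prop := ∃ x ∈ g.toWord.head?, x.1 = true

/-- The reduced word ends with the second generator or its inverse. -/
def BLast (g : FreeGroup Bool) : Prop := ∃ x ∈ g.toWord.getLast?, x.1 = true

theorem bCount_inv (g : FreeGroup Bool) : bCount g⁻¹ = bCount g := by
  rw [bCount, toWord_inv, invRev, List.countP_reverse, List.countP_map]
  rfl

theorem BLast.inv {g : FreeGroup Bool} (h : BLast g) : BHead g⁻¹ := by
  obtain ⟨x, hx, h⟩ := h
  refine ⟨(x.1, !x.2), ?_, h⟩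
  rw [toWord_inv, invRev, List.head?_reverse, List.getLast?_map, Option.mem_def.1 hx]
  rfl

theorem BHead.inv {g : FreeGroup Bool} (h : BHead g) : BLast g⁻¹ := by
  obtain ⟨x, hx, h⟩ := h
  refine ⟨(x.1, !x.2), ?_, h⟩
  rw [toWord_inv, invRev, List.getLast?_reverse, List.head?_map, Option.mem_def.1 hx]
  rfl

theorem bPow_succ {g : FreeGroup Bool} (h : BHead g) (h' : BLast g) (n : ℕ) :
    BHead (g ^ (n + 1)) ∧ BLast (g ^ (n + 1)) ∧ bCount g ≤ bCount (g ^ (n + 1)) := by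
  have e := reduceCyclically.reduce_flatten_replicate_succ (isReduced_toWord (x := g)) n
  rw [← toWord_pow] at e
  have e0 := reduceCyclically.conj_conjugator_reduceCyclically g.toWord
  set C := reduceCyclically.conjugator g.toWord
  set U := reduceCyclically g.toWord
  have hF : (List.replicate (n + 1) U).flatten = U ++ (List.replicate n U).flatten := by
    simp [List.replicate_succ]
  have hF' : (List.replicate (n + 1) U).flatten = (List.replicate n U).flatten ++ U := by
    simp [List.replicate_succ']
  obtain ⟨x, hx, hxb⟩ := h
  obtain ⟨y, hy, hyb⟩ := h'
  refine ⟨⟨x, ?_, hxb⟩, ⟨y, ?_, hyb⟩, ?_⟩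
  · rw [e, hF]
    rw [← e0] at hx
    by_cases hne : C ++ U = []
    · simp only [List.append_eq_nil_iff] at hne
      simp [hne.1, hne.2, invRev] at hx
    · rw [← List.append_assoc, List.append_assoc _ _ (invRev C),
        List.head?_append_of_ne_nil _ hne]
      rwa [List.head?_append_of_ne_nil _ hne] at hx
  · rw [e, hF']
    rw [← e0] at hy
    by_cases hne : U ++ invRev C = []
    · simp only [List.append_eq_nil_iff] at hne
      have hC : C = [] := by simpa [invRev] using hne.2
      simp [hC, hne.1, invRev] at hy
    · simp only [List.append_assoc] at hy ⊢
      rw [← List.append_assoc, List.getLast?_append_of_ne_nil _ hne]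
      rwa [List.getLast?_append_of_ne_nil _ hne] at hy
  · rw [bCount, bCount, e, hF]
    conv_lhs => rw [← e0]
    simp only [List.countP_append]
    omega

theorem bPow {g : FreeGroup Bool} (h : BHead g) (h' : BLast g) {m : ℤ} (hm : m ≠ 0) :
    BHead (g ^ m) ∧ BLast (g ^ m) ∧ bCount g ≤ bCount (g ^ m) := by
  obtain ⟨n, rfl | rfl⟩ : ∃ n : ℕ, m = (n + 1 : ℕ) ∨ m = -(n + 1 : ℕ) :=
    ⟨m.natAbs - 1, by omega⟩
  · rw [zpow_natCast]
    exact bPow_succ h h' n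
  · obtain ⟨h1, h2, h3⟩ := bPow_succ h h' n
    rw [zpow_neg, zpow_natCast, bCount_inv]
    exact ⟨h2.inv, h1.inv, h3⟩

theorem aPow_toWord (n : ℤ) : ∀ x ∈ (of false ^ n : FreeGroup Bool).toWord, x.1 = false := by
  obtain ⟨k, rfl | rfl⟩ : ∃ k : ℕ, n = k ∨ n = -k := ⟨n.natAbs, by omega⟩
  · rw [zpow_natCast, toWord_of_pow]
    intro x hx
    rw [List.eq_of_mem_replicate hx]
  · rw [zpow_neg, zpow_natCast, toWord_inv, toWord_of_pow, invRev]
    intro x hx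
    simp at hx
    rw [hx.2]

theorem toWord_aPow_mul (n : ℤ) {g : FreeGroup Bool} (h : g = 1 ∨ BHead g) :
    (of false ^ n * g).toWord = (of false ^ n : FreeGroup Bool).toWord ++ g.toWord := by
  refine toWord_mul_of_chain fun x hx y hy e => ?_
  rcases h with rfl | ⟨z, hz, hz'⟩
  · simp at hy
  · have h1 := aPow_toWord n x (List.mem_of_getLast? hx)
    rw [Option.mem_unique hy hz, hz', h1] at e
    simp at e

theorem bCount_aPow_mul (n : ℤ) {g : FreeGroup Bool} (h : g = 1 ∨ BHead g) :
    bCount (of false ^ n * g) = bCount g := by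
  have h0 : (of false ^ n : FreeGroup Bool).toWord.countP (·.1) = 0 := by
    rw [List.countP_eq_zero]
    intro x hx
    simp [aPow_toWord n x hx]
  rw [bCount, toWord_aPow_mul n h, List.countP_append, h0, zero_add, bCount]

theorem aPow_ne_one {n : ℤ} (hn : n ≠ 0) : (of false ^ n : FreeGroup Bool) ≠ 1 := by
  intro h
  have := congrArg (FreeGroup.lift fun _ : Bool => Multiplicative.ofAdd (1 : ℤ)) h
  rw [map_zpow, FreeGroup.lift_apply_of, MonoidHom.map_one, ← ofAdd_zsmul] at this
  simp at this
  exact hn this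

/-- Alternating products of powers. -/
inductive Alt (v : FreeGroup Bool) : FreeGroup Bool → Prop
  | one : Alt v 1
  | last (m : ℤ) : m ≠ 0 → Alt v (v ^ m)
  | step (m n : ℤ) (g : FreeGroup Bool) : m ≠ 0 → n ≠ 0 → Alt v g →
      Alt v (v ^ m * (of false ^ n * g))

theorem Alt.word {v : FreeGroup Bool} (h : BHead v) (h' : BLast v) {g : FreeGroup Bool}
    (hg : Alt v g) : g = 1 ∨ (BHead g ∧ bCount v ≤ bCount g) := by
  induction hg with
  | one => exact Or.inl rfl
  | last m hm => exact Or.inr ⟨(bPow h h' hm).1, (bPow h h' hm).2.2⟩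
  | step m n g hm hn _ ih =>
    right
    obtain ⟨⟨x, hx, hxb⟩, ⟨y, hy, hyb⟩, hc⟩ := bPow h h' hm
    have h1 := toWord_aPow_mul n (ih.imp_right And.left)
    have h2 := toWord_mul_of_chain (g := v ^ m) (h := of false ^ n * g) (by
      intro x' hx' z hz e
      have hne : (of false ^ n : FreeGroup Bool).toWord ≠ [] := by
        rw [Ne, toWord_eq_nil_iff]; exact aPow_ne_one hn
      rw [h1, List.head?_append_of_ne_nil _ hne] at hz
      rw [Option.mem_unique hx' hy, hyb, aPow_toWord n z (List.mem_of_mem_head? hz)] at e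
      simp at e)
    have hne : (v ^ m).toWord ≠ [] := fun h0 => by simp [h0] at hx
    refine ⟨⟨x, by rwa [h2, List.head?_append_of_ne_nil _ hne], hxb⟩, ?_⟩
    rw [bCount, bCount, h2, List.countP_append]
    exact hc.trans (Nat.le_add_right _ _)

theorem Alt.zpow_mul {v g : FreeGroup Bool} (hg : Alt v g) (n e : ℤ) :
    ∃ (n' : ℤ) (g' : FreeGroup Bool),
      Alt v g' ∧ v ^ e * (of false ^ n * g) = of false ^ n' * g' := by
  by_cases he : e = 0
  · exact ⟨n, g, hg, by simp [he]⟩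
  by_cases hn : n = 0
  · subst hn
    cases hg with
    | one => exact ⟨0, _, .last e he, by simp⟩
    | last m hm =>
      by_cases hem : e + m = 0
      · exact ⟨0, 1, .one, by simp [← zpow_add, hem]⟩
      · exact ⟨0, _, .last _ hem, by simp [← zpow_add]⟩
    | step m n g hm hn hg =>
      by_cases hem : e + m = 0
      · refine ⟨n, g, hg, ?_⟩
        rw [zpow_zero, one_mul, ← mul_assoc, ← zpow_add, hem, zpow_zero, one_mul]
      · refine ⟨0, _, .step _ n g hem hn hg, ?_⟩
        simp only [zpow_zero, one_mul, zpow_add, mul_assoc]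
  · exact ⟨0, _, .step e n g he hn hg, by simp⟩

theorem exists_strip (v : FreeGroup Bool) :
    ∃ (r s : ℤ) (v' : FreeGroup Bool), v = of false ^ r * v' * of false ^ s ∧
      (v' = 1 ∨ (BHead v' ∧ BLast v')) := by
  induction hn : v.toWord.length using Nat.strong_induction_on generalizing v with
  | _ n ih =>
    by_cases h1 : v = 1
    · exact ⟨0, 0, 1, by simp [h1], Or.inl rfl⟩
    have hne : v.toWord ≠ [] := fun h => h1 (toWord_eq_nil_iff.1 h)
    by_cases h2 : BHead v
    · by_cases h3 : BLast v
      · exact ⟨0, 0, v, by simp, Or.inr ⟨h2, h3⟩⟩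
      · obtain ⟨w, l, hw⟩ : ∃ w l, v.toWord = w ++ [l] :=
          ⟨_, _, (List.dropLast_append_getLast hne).symm⟩
        have hl : l.1 = false := by
          by_contra h
          exact h3 ⟨l, by simp [hw], by simpa using h⟩
        have hv : v = FreeGroup.mk w * FreeGroup.mk [l] := by
          rw [mul_mk, ← hw, mk_toWord]
        have hw' : (FreeGroup.mk w).toWord = w :=
          toWord_mk_of_sublist (g := v) (by rw [hw]; exact (List.prefix_append w [l]).isInfix)
        obtain ⟨k, hk⟩ := Subgroup.mem_zpowers_iff.1 (mk_singleton_mem_zpowers l.1 l.2)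
        obtain ⟨r, s, v', e, h⟩ := ih _ (by rw [← hn, hw, hw']; simp) (FreeGroup.mk w) rfl
        refine ⟨r, s + k, v', ?_, h⟩
        rw [hv, e, zpow_add, ← hl, hk, mul_assoc _ _ (FreeGroup.mk _)]
    · obtain ⟨l, w, hw⟩ := List.exists_cons_of_ne_nil hne
      have hl : l.1 = false := by
        by_contra h
        exact h2 ⟨l, by simp [hw], by simpa using h⟩
      have hv : v = FreeGroup.mk [l] * FreeGroup.mk w := by
        rw [mul_mk, ← mk_toWord (x := v), hw]; rfl
      have hw' : (FreeGroup.mk w).toWord = w :=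
        toWord_mk_of_sublist (g := v) (by rw [hw]; exact (List.suffix_cons l w).isInfix)
      obtain ⟨k, hk⟩ := Subgroup.mem_zpowers_iff.1 (mk_singleton_mem_zpowers l.1 l.2)
      obtain ⟨r, s, v', e, h⟩ := ih _ (by rw [← hn, hw, hw']; simp) (FreeGroup.mk w) rfl
      refine ⟨k + r, s, v', ?_, h⟩
      rw [hv, e, zpow_add, ← hl, hk]
      group

/-- The exponent of the second generator. -/
def bExp : FreeGroup Bool →* Multiplicative ℤ :=
  FreeGroup.lift fun i => if i then .ofAdd 1 else 1

/-- Two-generator bases containing the first generator. -/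
theorem nielsen (v : FreeGroup Bool) (hv : bExp v = .ofAdd 1)
    (h : of true ∈ Subgroup.closure {of false, v}) :
    ∃ r s : ℤ, v = of false ^ r * of true * of false ^ s := by
  obtain ⟨r, s, v', rfl, hv'⟩ := exists_strip v
  have ha : bExp (of false) = 1 := by simp [bExp]
  simp only [_root_.map_mul, map_zpow, ha, one_zpow, one_mul, mul_one] at hv
  rcases hv' with rfl | ⟨h1, h2⟩
  · have : (0 : ℤ) = 1 := Multiplicative.ofAdd.injective (by simpa using hv)
    omega
  have hmem : of true ∈ Subgroup.closure {of false, v'} := by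
    refine (Subgroup.closure_le _).2 ?_ h
    have hA : of false ∈ Subgroup.closure {of false, v'} := Subgroup.subset_closure (by simp)
    rintro x (rfl | rfl)
    · exact hA
    · exact mul_mem (mul_mem (zpow_mem hA _) (Subgroup.subset_closure (by simp))) (zpow_mem hA _)
  have key : ∀ x ∈ Subgroup.closure {of false, v'},
      ∃ (n : ℤ) (g : FreeGroup Bool), Alt v' g ∧ x = of false ^ n * g := by
    intro x hx
    induction hx using Subgroup.closure_induction_left with
    | one => exact ⟨0, 1, .one, by simp⟩
    | mul_left x hx y _ ih =>
      obtain ⟨n, g, hg, rfl⟩ := ih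
      rcases hx with rfl | rfl
      · exact ⟨1 + n, g, hg, by rw [zpow_add, zpow_one, mul_assoc]⟩
      · simpa using hg.zpow_mul n 1
    | inv_mul_cancel x hx y _ ih =>
      obtain ⟨n, g, hg, rfl⟩ := ih
      rcases hx with rfl | rfl
      · exact ⟨-1 + n, g, hg, by rw [zpow_add, zpow_neg_one, mul_assoc]⟩
      · simpa using hg.zpow_mul n (-1)
  obtain ⟨n, g, hg, e⟩ := key _ hmem
  have hw := hg.word h1 h2
  have hb := bCount_aPow_mul n (hw.imp_right And.left)
  rw [← e] at hb
  have hb1 : bCount (of true) = 1 := by simp [bCount]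
  have hc : bCount v' ≤ 1 := by
    rcases hw with rfl | ⟨_, hw⟩
    · simp [bCount] at hb
    · omega
  obtain ⟨x, hx, hxb⟩ := h1
  obtain ⟨y, hy, hyb⟩ := h2
  have hword : v'.toWord = [x] := by
    rcases hl : v'.toWord with _ | ⟨x', w⟩
    · simp [hl] at hx
    · rw [hl] at hx hy
      obtain rfl : x' = x := by simpa using hx
      rcases List.eq_nil_or_concat' w with rfl | ⟨w', y', rfl⟩
      · rfl
      · obtain rfl : y' = y := by
          rwa [← List.cons_append, List.getLast?_concat, Option.mem_some_iff] at hy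
        rw [bCount, hl] at hc
        simp [hxb, hyb] at hc
  refine ⟨r, s, ?_⟩
  have hv2 : v' = FreeGroup.mk [x] := by rw [← mk_toWord (x := v'), hword]
  rcases x with ⟨_, _ | _⟩
  · subst hxb
    exfalso
    have : v' = (of true)⁻¹ := by rw [hv2]; simp [of, inv_mk, invRev]
    rw [this] at hv
    simp [bExp] at hv
    rw [← ofAdd_neg] at hv
    exact absurd (Multiplicative.ofAdd.injective hv) (by norm_num)
  · subst hxb
    rw [hv2]; rfl

end FreeGroups

section ShiftAlgebra

open FreeGroup

/-- The labels of the lower line. -/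
def low : Set Lab := {i | i.1 = false}

/-- The permutation of labels induced by the Reeb map. -/
def sh : Equiv.Perm Lab where
  toFun i := (i.1, if i.1 then i.2 - 1 else i.2 + 1)
  invFun i := (i.1, if i.1 then i.2 + 1 else i.2 - 1)
  left_inv i := by rcases i with ⟨_ | _, n⟩ <;> simp
  right_inv i := by rcases i with ⟨_ | _, n⟩ <;> simp

/-- The automorphism induced by the Reeb map. -/
def sg : FreeGroup Lab ≃* FreeGroup Lab := freeGroupCongr sh

theorem sg_of (i : Lab) : sg (of i) = of (sh i) := by simp [sg]

theorem sg_of_low (n : ℤ) : sg (of (false, n)) = of (false, n + 1) := by simp [sg_of, sh]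

theorem sh_mem_low (i : Lab) : sh i ∈ low ↔ i ∈ low := Iff.rfl

theorem keep_low_sg (u : FreeGroup Lab) : keep low (sg u) = sg (keep low u) := by
  have : (keep low).comp sg.toMonoidHom = sg.toMonoidHom.comp (keep low) := by
    ext i
    by_cases hi : i ∈ low
    · simp [sg_of, keep_of, un_mem hi, un_mem ((sh_mem_low i).2 hi)]
    · simp [sg_of, keep_of, un_notMem hi, un_notMem (mt (sh_mem_low i).1 hi)]
  exact DFunLike.congr_fun this u

/-- Collapse of the lower letters to conjugates of one letter. -/
def coil : FreeGroup Lab →* FreeGroup Bool :=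
  FreeGroup.lift fun i => if i.1 then 1 else of true ^ i.2 * of false * (of true ^ i.2)⁻¹

theorem coil_low (n : ℤ) :
    coil (of (false, n)) = of true ^ n * of false * (of true ^ n)⁻¹ := by simp [coil]

theorem coil_sg (u : FreeGroup Lab) : coil (sg u) = of true * coil u * (of true)⁻¹ := by
  have : coil.comp sg.toMonoidHom = (MulAut.conj (of true)).toMonoidHom.comp coil := by
    ext i
    rcases i with ⟨_ | _, n⟩
    · simp [sg_of_low, coil_low, add_comm n, zpow_add, mul_assoc]
    · simp [sg_of, sh, coil]
  simpa using DFunLike.congr_fun this u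

theorem bExp_coil (u : FreeGroup Lab) : bExp (coil u) = 1 := by
  have : bExp.comp coil = 1 := by
    ext i
    rcases i with ⟨_ | _, n⟩ <;> simp [coil, bExp]
  exact DFunLike.congr_fun this u

theorem coil_injOn {u v : FreeGroup Lab} (hu : keep low u = u) (hv : keep low v = v)
    (h : coil u = coil v) : u = v := by
  let ρ : Multiplicative ℤ →* MulAut (FreeGroup Lab) := zpowersHom _ sg
  let f : FreeGroup Bool →* FreeGroup Lab ⋊[ρ] Multiplicative ℤ :=
    FreeGroup.lift fun b => if b then .inr (.ofAdd 1) else .inl (of (false, 0))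
  have hn : ∀ n : ℤ, (sg ^ n : MulAut (FreeGroup Lab)) (of (false, 0)) = of (false, n) := by
    intro n
    induction n using Int.induction_on with
    | zero => rfl
    | succ n ih =>
      rw [add_comm, zpow_add, zpow_one, MulAut.mul_apply, ih, sg_of_low, add_comm]
    | pred n ih =>
      rw [sub_eq_add_neg, add_comm, zpow_add, zpow_neg_one, MulAut.mul_apply, ih]
      change sg.symm _ = _
      rw [MulEquiv.symm_apply_eq, sg_of_low]
      congr 2; ring
  have key : f.comp coil = SemidirectProduct.inl.comp (keep low) := by
    ext1 i
    rcases i with ⟨_ | _, n⟩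
    · simp only [MonoidHom.comp_apply, coil_low, keep_of,
        un_mem (show (false, n) ∈ low from rfl)]
      simp only [_root_.map_mul, map_zpow, _root_.map_inv, f, lift_apply_of, if_true,
        Bool.false_eq_true, if_false]
      rw [← map_zpow, ← _root_.map_inv, ← SemidirectProduct.inl_aut, ← hn n]
      congr 1
      change (zpowersHom _ sg) _ _ = _
      rw [zpowersHom_apply]
      simp
    · simp [keep_of, un_notMem (show (true, n) ∉ low from fun h => by cases h), coil]
  have h1 := DFunLike.congr_fun key u
  have h2 := DFunLike.congr_fun key v
  simp only [MonoidHom.comp_apply, hu, hv, h] at h1 h2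
  exact SemidirectProduct.inl_injective (h1.symm.trans h2)

/-- A `2 × 2` representation detecting the power in `twist_eq_zero`. -/
def rep : FreeGroup Lab →* Matrix (Fin 2) (Fin 2) ℚ :=
  (Units.coeHom _).comp <| FreeGroup.lift fun i : Lab =>
    if i.2 = 0 then ⟨!![1, 0; 1, 1], !![1, 0; -1, 1], by ext i j; fin_cases i <;> fin_cases j <;>
      simp [Matrix.mul_apply], by ext i j; fin_cases i <;> fin_cases j <;> simp [Matrix.mul_apply]⟩
    else if i.2 = 1 then ⟨!![1, 1; 0, 1], !![1, -1; 0, 1], by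
      ext i j; fin_cases i <;> fin_cases j <;> simp [Matrix.mul_apply], by
      ext i j; fin_cases i <;> fin_cases j <;> simp [Matrix.mul_apply]⟩
    else ⟨!![2, 0; 0, 1 / 2], !![1 / 2, 0; 0, 2], by
      ext i j; fin_cases i <;> fin_cases j <;> simp [Matrix.mul_apply], by
      ext i j; fin_cases i <;> fin_cases j <;> simp [Matrix.mul_apply]⟩

theorem rep_zpow (n : ℤ) : rep (of (false, 1) ^ n) = !![1, (n : ℚ); 0, 1] := by
  have h1 : rep (of (false, 1)) = !![1, 1; 0, 1] := by simp [rep]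
  have h2 : rep (of (false, 1))⁻¹ = !![1, -1; 0, 1] := by simp [rep]
  induction n using Int.induction_on with
  | zero => simp [Matrix.one_fin_two]
  | succ n ih =>
    rw [zpow_add, _root_.map_mul, ih, zpow_one, h1]
    simp [add_comm]
  | pred n ih =>
    rw [sub_eq_add_neg, zpow_add, _root_.map_mul, ih, zpow_neg_one, h2]
    simp [add_comm]

theorem twist_eq_zero {m : ℤ} {k : FreeGroup Lab}
    (h : of (false, 0) * (of (false, 1) ^ m * of (false, 1) * of (false, 2) * of (false, 1) ^ (-m))
      = k * (of (false, 0) * of (false, 1) * of (false, 2)) * k⁻¹) : m = 0 := by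
  rw [← zpow_add_one] at h
  have h0 : rep (of (false, 0)) = !![1, 0; 1, 1] := by simp [rep]
  have h2 : rep (of (false, 2)) = !![2, 0; 0, 1 / 2] := by simp [rep]
  have h1 := rep_zpow 1
  rw [zpow_one] at h1
  have ht := congrArg (fun w => (rep w).trace) h
  simp only [_root_.map_mul] at ht
  rw [mul_assoc (rep k), Matrix.trace_mul_comm (rep k), mul_assoc _ _ (rep k),
    ← _root_.map_mul rep k⁻¹, inv_mul_cancel, _root_.map_one, mul_one, h0, h2, rep_zpow,
    rep_zpow, h1] at ht
  simp [Matrix.trace_fin_two] at ht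
  have : (m : ℚ) = 0 := by linarith
  exact_mod_cast this

/-- An endomorphism commuting with the shift up to inner automorphisms is inner, provided it is
planar on three consecutive letters. -/
theorem exists_conj_of_shift {φ : FreeGroup Lab →* FreeGroup Lab}
    (hs : ∀ u, ∃ v, φ v = keep low u)
    (hφ' : ∀ u, φ (keep low u) = φ u)
    {k : FreeGroup Lab} (hk : keep low k = k) (hc : ∀ u, φ (sg u) = k * sg (φ u) * k⁻¹)
    {e : FreeGroup Lab} (he : keep low e = e) (h0 : φ (of (false, 0)) = e * of (false, 0) * e⁻¹)
    (hp : ∃ g, keep {(false, 0), (false, 1), (false, 2)}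
      (φ (of (false, 0) * of (false, 1) * of (false, 2))) =
        g * (of (false, 0) * of (false, 1) * of (false, 2)) * g⁻¹) :
    ∃ h, keep low h = h ∧ ∀ n : ℤ, φ (of (false, n)) = h * of (false, n) * h⁻¹ := by
  have hcs : ∀ g : FreeGroup Lab, keep low g = g → keep low (sg g) = sg g := fun g h => by
    rw [keep_low_sg, h]
  let ψ : FreeGroup Lab →* FreeGroup Lab := (MulAut.conj e⁻¹).toMonoidHom.comp φ
  have hψ : ∀ u, ψ u = e⁻¹ * φ u * e := fun u => by simp [ψ]
  set w := e⁻¹ * k * sg e with hw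
  have hwk : keep low w = w := by simp [w, he, hk, hcs e he]
  have hψs : ∀ u, ψ (sg u) = w * sg (ψ u) * w⁻¹ := fun u => by
    simp only [hψ, hc, w, _root_.map_mul, _root_.map_inv]; group
  have hψ0 : ψ (of (false, 0)) = of (false, 0) := by rw [hψ, h0]; group
  set V := coil w * of true with hV
  have hcψ : ∀ u, coil (ψ (sg u)) = V * coil (ψ u) * V⁻¹ := fun u => by
    simp only [hψs, _root_.map_mul, _root_.map_inv, coil_sg, V]; group
  have hVn : ∀ n : ℤ, coil (ψ (of (false, n))) = V ^ n * of false * (V ^ n)⁻¹ := by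
    intro n
    induction n using Int.induction_on with
    | zero => rw [hψ0, coil_low]; simp
    | succ n ih => rw [← sg_of_low, hcψ, ih, add_comm, zpow_add]; group
    | pred n ih =>
      have : (-(n : ℤ)) = -n - 1 + 1 := by ring
      rw [this, ← sg_of_low, hcψ, zpow_add, zpow_one] at ih
      have e1 : coil (ψ (of (false, -(n : ℤ) - 1))) =
        V⁻¹ * (V * coil (ψ (of (false, -(n : ℤ) - 1))) * V⁻¹) * V := by group
      rw [e1, ih]; group
  have hcl : ∀ u, coil (ψ u) ∈ Subgroup.closure {of false, V} := by
    have hA : of false ∈ Subgroup.closure {of false, V} := Subgroup.subset_closure (by simp)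
    have hB : V ∈ Subgroup.closure {of false, V} := Subgroup.subset_closure (by simp)
    intro u
    have hof : ∀ i, coil (ψ (of i)) ∈ Subgroup.closure {of false, V} := by
      rintro ⟨_ | _, n⟩
      · rw [hVn]
        exact mul_mem (mul_mem (zpow_mem hB n) hA) (inv_mem (zpow_mem hB n))
      · rw [hψ, ← hφ', keep_of, un_notMem (show (true, n) ∉ low from fun h => by cases h)]
        simp
    induction u using FreeGroup.induction_on with
    | C1 => rw [_root_.map_one, _root_.map_one]; exact one_mem _
    | of i => exact hof i
    | inv_of i _ => rw [_root_.map_inv, _root_.map_inv]; exact inv_mem (hof i)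
    | mul x y hx hy => rw [_root_.map_mul, _root_.map_mul]; exact mul_mem hx hy
  have hbmem : of true ∈ Subgroup.closure {of false, V} := by
    obtain ⟨v, hv⟩ := hs (e * w * e⁻¹)
    have h1 : ψ v = w := by
      rw [hψ, hv]
      simp only [_root_.map_mul, _root_.map_inv, he, hwk]
      group
    have h2 := hcl v
    rw [h1] at h2
    have h3 : of true = (coil w)⁻¹ * V := by rw [hV]; group
    rw [h3]
    exact mul_mem (inv_mem h2) (Subgroup.subset_closure (by simp))
  obtain ⟨r, s, hrs⟩ := nielsen V (by rw [hV, _root_.map_mul, bExp_coil]; simp [bExp]) hbmem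
  have hlow : ∀ n : ℤ, keep low (of (false, n)) = of (false, n) := fun n => by
    rw [keep_of, un_mem (show (false, n) ∈ low from rfl)]
  have hwrs : w = of (false, 0) ^ r * of (false, 1) ^ s := by
    refine coil_injOn hwk (by simp only [_root_.map_mul, map_zpow, hlow]) ?_
    have h1 : coil w = V * (of true)⁻¹ := by rw [hV]; group
    rw [h1, hrs, _root_.map_mul, map_zpow, map_zpow, coil_low, coil_low, conj_zpow]
    simp
    group
  let χ : FreeGroup Lab →* FreeGroup Lab := (MulAut.conj (of (false, 0) ^ (-r))).toMonoidHom.comp ψ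
  have hχ : ∀ u, χ u = of (false, 0) ^ (-r) * ψ u * of (false, 0) ^ r := fun u => by
    simp only [χ, MonoidHom.comp_apply, MulEquiv.coe_toMonoidHom, MulAut.conj_apply, zpow_neg,
      inv_inv]
  have hχs : ∀ u, χ (sg u) = of (false, 1) ^ (r + s) * sg (χ u) * of (false, 1) ^ (-(r + s)) := by
    intro u
    simp only [hχ, hψs, hwrs, _root_.map_mul, map_zpow, sg_of_low, zero_add]
    group
  have hχ0 : χ (of (false, 0)) = of (false, 0) := by rw [hχ, hψ0]; group
  have hχ1 : χ (of (false, 1)) = of (false, 1) := by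
    rw [← zero_add (1 : ℤ), ← sg_of_low, hχs, hχ0, sg_of_low, zero_add]; group
  have hχ2 : χ (of (false, 2)) = of (false, 1) ^ (r + s) * of (false, 2) *
      of (false, 1) ^ (-(r + s)) := by
    rw [← one_add_one_eq_two, ← sg_of_low, hχs, hχ1, sg_of_low]
  obtain ⟨g, hg⟩ := hp
  have hφχ : ∀ u, φ u = (e * of (false, 0) ^ r) * χ u * (e * of (false, 0) ^ r)⁻¹ := fun u => by
    rw [hχ, hψ]; group
  have hm : r + s = 0 := by
    set K := keep {((false, 0) : Lab), (false, 1), (false, 2)} with hK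
    have k0 : K (of (false, 0)) = of (false, 0) := by rw [hK, keep_of, un_mem (by simp)]
    have k1 : K (of (false, 1)) = of (false, 1) := by rw [hK, keep_of, un_mem (by simp)]
    have k2 : K (of (false, 2)) = of (false, 2) := by rw [hK, keep_of, un_mem (by simp)]
    rw [hφχ, _root_.map_mul, _root_.map_mul, _root_.map_inv] at hg
    set A := K (e * of (false, 0) ^ r)
    refine twist_eq_zero (k := A⁻¹ * g) ?_
    have h1 : K (χ (of (false, 0) * of (false, 1) * of (false, 2))) =
        (A⁻¹ * g) * (of (false, 0) * of (false, 1) * of (false, 2)) * (A⁻¹ * g)⁻¹ := by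
      have : K (χ (of (false, 0) * of (false, 1) * of (false, 2))) =
        A⁻¹ * (A * K (χ (of (false, 0) * of (false, 1) * of (false, 2))) * A⁻¹) * A := by group
      rw [this, hg]; group
    rw [← h1]
    simp only [_root_.map_mul, hχ0, hχ1, hχ2, k0, k1, k2, map_zpow]
    group
  have hχs' : ∀ u, χ (sg u) = sg (χ u) := fun u => by rw [hχs, hm]; simp
  refine ⟨e * of (false, 0) ^ r, by simp only [_root_.map_mul, map_zpow, he, hlow], fun n => ?_⟩
  rw [hφχ]
  congr 2
  induction n using Int.induction_on with
  | zero => exact hχ0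
  | succ n ih => rw [← sg_of_low, hχs', ih]
  | pred n ih =>
    apply sg.injective
    rw [← hχs', sg_of_low, sub_add_cancel, ih]

end ShiftAlgebra

section ReebShift

open Filter Topology unitInterval

variable {H : Type*} [Group H] {E E' : Set Lab}

theorem hl_isotopy {K : I × Plane → Plane} (hK : Continuous K)
    (hm : ∀ u, Set.MapsTo (fun x => K (u, x)) (XE E) (XE E')) {g : I → Plane} (hg : Continuous g)
    (hX : ∀ t, g t ∈ XE E) (h0 : ∀ u, K (u, g 0) = K (0, g 0))
    (h1 : ∀ u, K (u, g 1) = K (0, g 1)) :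
    hl E' (fun t => K (0, g t)) = hl E' fun t => K (1, g t) :=
  hol_homotopic (isLoc_un E') (K := fun z : I × I => K (z.1, g z.2)) (by fun_prop)
    (fun z => hm z.1 (hX z.2)) h0 h1

theorem mapsTo_XE {f : Plane → Plane} (hf : Function.Injective f) {j : Lab → Lab}
    (h : ∀ i, f (pt i) = pt (j i)) : Set.MapsTo f (XE E) (XE (j '' E)) := by
  rintro x hx _ ⟨i, hi, rfl⟩ e
  exact hx i hi (hf (e.trans (h i).symm))

theorem mapsTo_XE_of_fix {f : Plane → Plane} (hf : Function.Injective f)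
    (h : ∀ i ∈ E, f (pt i) = pt i) : Set.MapsTo f (XE E) (XE E) :=
  fun _ hx i hi e => hx i hi (hf (e.trans (h i hi).symm))

/-- The displacement of the truncated Reeb map. -/
noncomputable def disp (y : ℝ) : ℝ := max (-1) (min 1 (3 - 2 * y))

theorem continuous_disp : Continuous disp := by unfold disp; fun_prop

/-- The truncated Reeb map: an integral translation outside the strip. -/
noncomputable def Rp : Plane ≃ₜ Plane := shear disp continuous_disp

theorem Rp_apply (p : Plane) : Rp p = (p.1 + disp p.2, p.2) := rfl

theorem disp_low {y : ℝ} (h : y ≤ 1) : disp y = 1 := by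
  rw [disp, min_eq_left (by linarith), max_eq_right (by norm_num)]

theorem disp_high {y : ℝ} (h : 2 ≤ y) : disp y = -1 := by
  rw [disp, max_eq_left]
  exact (min_le_right _ _).trans (by linarith)

theorem Rp_pt (i : Lab) : Rp (pt i) = pt (sh i) := by
  rcases i with ⟨_ | _, n⟩
  · simp [Rp_apply, pt, sh, disp_low]
  · simp [Rp_apply, pt, sh, disp_high, sub_eq_add_neg]

theorem cc_add (φ : Lab → H) (m : ℤ) (p q : Plane) :
    cc φ (p.1 + m, p.2) (q.1 + m, q.2) = cc (fun i => φ (i.1, i.2 + m)) p q := by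
  simp only [cc, Int.floor_add_intCast, ltr, add_right_comm _ m 1, add_left_inj]

theorem cc_congr_low {φ φ' : Lab → H} (h : ∀ n, φ (false, n) = φ' (false, n)) {p q : Plane}
    (hp : p.2 < 1) : cc φ p q = cc φ' p q := by
  simp only [cc, ltr, hp, if_true, h]

theorem cc_congr_high {φ φ' : Lab → H} (h : ∀ n, φ (true, n) = φ' (true, n)) {p q : Plane}
    (hp : 2 < p.2) : cc φ p q = cc φ' p q := by
  simp only [cc, ltr, not_lt.2 (show 1 ≤ p.2 by linarith), hp, if_true, if_false, h]

theorem un_sh (i : Lab) : un (sh '' E) (sh i) = sg (un E i) := by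
  by_cases hi : i ∈ E
  · rw [un_mem hi, un_mem (Set.mem_image_of_mem _ hi), sg_of]
  · rw [un_notMem hi, un_notMem, map_one]
    rwa [sh.injective.mem_set_image]

theorem hl_Rp {g : I → Plane} (hg : Continuous g) (hX : ∀ t, g t ∈ XE E) :
    hl (sh '' E) (Rp ∘ g) = sg (hl E g) := by
  have h1 := hol_map (isLoc_un E) hg hX sg.toMonoidHom
  have hR : Set.MapsTo Rp (XE E) (XE (sh '' E)) := mapsTo_XE Rp.injective Rp_pt
  have h2 := hol_compare (isLoc_un (sh '' E)) ((isLoc_un E).map sg.toMonoidHom)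
    (f := Rp ∘ g) (f' := g) (Rp.continuous.comp hg) hg (fun t => hR (hX t)) hX (κ := fun _ => 1)
    fun t => by
      simp only [mul_one, one_mul]
      have e : ∀ p q, sg.toMonoidHom (cc (un E) p q) = cc (fun i => sg (un E i)) p q := fun p q =>
        (cc_map sg.toMonoidHom (un E) p q).symm
      simp only [e, Function.comp]
      have hc : ContinuousAt (fun a => (g a).2) t := by fun_prop
      rcases lt_or_ge (g t).2 1 with h | h
      · filter_upwards [hc.eventually (gt_mem_nhds h)] with a ha
        rw [Rp_apply, Rp_apply, disp_low h.le, disp_low ha.le]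
        have := cc_add (un (sh '' E)) 1 (g t) (g a)
        push_cast at this
        rw [this]
        exact cc_congr_low (fun n => by rw [← un_sh]; rfl) h
      · rcases lt_or_ge 2 (g t).2 with h' | h'
        · filter_upwards [hc.eventually (lt_mem_nhds h')] with a ha
          rw [Rp_apply, Rp_apply, disp_high h'.le, disp_high ha.le]
          have := cc_add (un (sh '' E)) (-1) (g t) (g a)
          push_cast at this
          rw [this]
          exact cc_congr_high (fun n => by rw [← un_sh]; rfl) h'
        · exact .of_forall fun a => by
            rw [cc_strip (show 1 ≤ (Rp (g t)).2 from h) h', cc_strip h h']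
  rw [mul_one, one_mul] at h2
  exact h2.trans h1

/-- The properties of a homeomorphism used in the algebraic part of the argument. -/
structure Good (Ψ : Plane ≃ₜ Plane) : Prop where
  fix : ∀ i, Ψ (pt i) = pt i
  iso : ∃ F : I × Plane → Plane, Continuous F ∧ (∀ t, IsHomeoFun fun x => F (t, x)) ∧
    (∀ x, F (0, x) = x) ∧ ∀ x, F (1, x) = Ψ x
  comm : ∀ (E : Set Lab) (g : I → Plane), Continuous g → (∀ t, g t ∈ XE E) →
    (∃ i, g 0 = pt i) → (∃ i, g 1 = pt i) → hl (sh '' E) (Ψ ∘ Rp ∘ g) = sg (hl E (Ψ ∘ g))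

theorem Good.mapsTo {Ψ : Plane ≃ₜ Plane} (h : Good Ψ) (E : Set Lab) :
    Set.MapsTo Ψ (XE E) (XE E) := mapsTo_XE_of_fix Ψ.injective fun i _ => h.fix i

/-- Linear interpolation between the Reeb map and its truncation. -/
noncomputable def RpIso (z : I × Plane) : Plane :=
  (z.2.1 + ((1 - z.1) * (3 - 2 * z.2.2) + z.1 * disp z.2.2), z.2.2)

theorem hl_R₀ {Ψ : Plane → Plane} (hΨ : Continuous Ψ) (hm : Set.MapsTo Ψ (XE (sh '' E)) (XE E'))
    {g : I → Plane} (hg : Continuous g) (hX : ∀ t, g t ∈ XE E)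
    (h0 : ∃ i, g 0 = pt i) (h1 : ∃ i, g 1 = pt i) :
    hl E' (Ψ ∘ R₀ ∘ g) = hl E' (Ψ ∘ Rp ∘ g) := by
  have hd : ∀ (u : I) (y : ℝ), y = 1 ∨ y = 2 →
      (1 - (u : ℝ)) * (3 - 2 * y) + u * disp y = disp y := by
    rintro u y (rfl | rfl)
    · rw [disp_low le_rfl]; ring
    · rw [disp_high le_rfl]; ring
  have hp : ∀ u i, RpIso (u, pt i) = Rp (pt i) := fun u i => by
    rw [RpIso, Rp_apply, hd u _ (pt_snd i)]
  have hinj : ∀ u, Function.Injective fun x => RpIso (u, x) := by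
    rintro u ⟨x, y⟩ ⟨x', y'⟩ h
    simp only [RpIso, Prod.mk.injEq] at h
    obtain ⟨h, rfl⟩ := h
    simpa using h
  have hend : ∀ u x, (∃ i, x = pt i) → RpIso (u, x) = RpIso (0, x) := by
    rintro u _ ⟨i, rfl⟩
    rw [hp, hp]
  have hc : Continuous RpIso := by
    unfold RpIso
    have := continuous_disp
    fun_prop
  have := hl_isotopy (E := E) (E' := E') (K := Ψ ∘ RpIso) (hΨ.comp hc)
    (fun u x hx => hm (mapsTo_XE (hinj u) (fun i => (hp u i).trans (Rp_pt i)) hx)) hg hX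
    (fun u => congrArg Ψ (hend u _ h0)) (fun u => congrArg Ψ (hend u _ h1))
  convert this using 2
  · funext t
    simp [RpIso, R₀, shear]
  · funext t
    simp [RpIso, Rp_apply]

theorem R₀_pt (i : Lab) : R₀ (pt i) = pt (sh i) := by
  rw [← Rp_pt, Rp_apply]
  change (_, _) = _
  congr 2
  rcases pt_snd i with h | h <;> rw [h]
  · rw [disp_low le_rfl]; norm_num
  · rw [disp_high le_rfl]; norm_num

/-- Commutation up to isotopy relative to the punctures implies commutation on words. -/
theorem hl_comm {Ψ : Plane ≃ₜ Plane} (hfix : ∀ i, Ψ (pt i) = pt i) {G : I × Plane → Plane}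
    (hG : Continuous G) (hGi : ∀ u, Function.Injective fun x => G (u, x))
    (hG0 : ∀ x, G (0, x) = Ψ (R₀ (Ψ.symm x))) (hG1 : ∀ x, G (1, x) = R₀ x)
    (hGf : ∀ u i, G (u, pt i) = R₀ (pt i)) (E : Set Lab) {g : I → Plane} (hg : Continuous g)
    (hX : ∀ t, g t ∈ XE E) (h0 : ∃ i, g 0 = pt i) (h1 : ∃ i, g 1 = pt i) :
    hl (sh '' E) (Ψ ∘ Rp ∘ g) = sg (hl E (Ψ ∘ g)) := by
  have hm : ∀ E, Set.MapsTo Ψ (XE E) (XE E) := fun E =>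
    mapsTo_XE_of_fix Ψ.injective fun i _ => hfix i
  have hX' : ∀ t, Ψ (g t) ∈ XE E := fun t => hm E (hX t)
  have h0' : ∃ i, Ψ (g 0) = pt i := h0.imp fun i hi => by rw [hi, hfix]
  have h1' : ∃ i, Ψ (g 1) = pt i := h1.imp fun i hi => by rw [hi, hfix]
  rw [← hl_Rp (Ψ.continuous.comp hg) hX', ← hl_R₀ Ψ.continuous (hm _) hg hX h0 h1]
  have e1 := hl_R₀ (Ψ := id) continuous_id (Set.mapsTo_id _) (Ψ.continuous.comp hg) hX' h0' h1'
  refine Eq.trans ?_ e1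
  have hend : ∀ u x, (∃ i, x = pt i) → G (u, x) = G (0, x) := by
    rintro u _ ⟨i, rfl⟩
    rw [hGf, hGf]
  have := hl_isotopy hG (fun u => mapsTo_XE (E := E) (hGi u) fun i => (hGf u i).trans (R₀_pt i))
    (Ψ.continuous.comp hg) hX' (fun u => hend u _ h0') (fun u => hend u _ h1')
  convert this using 2
  · funext t
    simp [hG0]
  · funext t
    simp [hG1]

end ReebShift

section Peripheral

open Filter Topology unitInterval

variable {H : Type*} [Group H] {E E' : Set Lab}

/-- A wedge-shaped path of half-width `w` centred over `c`. -/
noncomputable def wedge (c w l d : ℝ) : Path (c - w, l) (c + w, l) where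
  toFun t := (c + w * (2 * t - 1), l + d * (1 - |2 * (t : ℝ) - 1|))
  continuous_toFun := by fun_prop
  source' := by ext <;> norm_num; ring
  target' := by ext <;> norm_num

theorem wedge_apply (c w l d : ℝ) (t : I) :
    wedge c w l d t = (c + w * (2 * t - 1), l + d * (1 - |2 * (t : ℝ) - 1|)) := rfl

theorem abs_two_mul_sub_one_le (t : I) : |2 * (t : ℝ) - 1| ≤ 1 := by
  rw [abs_le]
  constructor <;> linarith [t.2.1, t.2.2]

theorem wedge_cut {n m : ℤ} {w l d : ℝ} (hw : 0 < w) (hw' : w < 1) {t : I}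
    (h : (wedge n w l d t).1 = m) : m = n ∧ (wedge n w l d t).2 = l + d := by
  have h : (n : ℝ) + w * (2 * t - 1) = m := h
  have ht := abs_le.1 (abs_two_mul_sub_one_le t)
  have e : m = n := by
    have h1 : (m : ℝ) < n + 1 := by nlinarith
    have h2 : (n : ℝ) < m + 1 := by nlinarith
    have h1' : m < n + 1 := by exact_mod_cast h1
    have h2' : n < m + 1 := by exact_mod_cast h2
    omega
  subst e
  refine ⟨rfl, ?_⟩
  have h2 : 2 * (t : ℝ) - 1 = 0 := by
    have : w * (2 * t - 1) = 0 := by linarith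
    exact (mul_eq_zero.1 this).resolve_left hw.ne'
  rw [wedge_apply, h2]
  simp

theorem hl_wedge (n : ℤ) {w : ℝ} (l d : ℝ) (hw : 0 < w) (hw' : w < 1) :
    hl E (wedge n w l d) = ltr (un E) n (l + d) := by
  rw [hl, hol_floor (fun m => if m < n then 1 else ltr (un E) n (l + d))
    (wedge n w l d).continuous]
  · have h0 : ⌊(wedge n w l d 0).1⌋ = n - 1 := by
      rw [Path.source, Int.floor_eq_iff]; push_cast; constructor <;> linarith
    have h1 : ⌊(wedge n w l d 1).1⌋ = n := by
      rw [Path.target, Int.floor_eq_iff]; push_cast; constructor <;> linarith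
    rw [h0, h1]
    simp
  · intro t m h
    obtain ⟨rfl, h2⟩ := wedge_cut hw hw' h
    rw [h2]
    simp

theorem cc_near {φ φ' : Lab → H} {i : Lab} (h : φ i = φ' i) {p q : Plane}
    (hp : p ∈ Metric.ball (pt i) (1 / 2)) (hq : q ∈ Metric.ball (pt i) (1 / 2)) :
    cc φ p q = cc φ' p q := by
  rw [mem_ball_plane, abs_lt, abs_lt] at hp hq
  have hf : ∀ x : ℝ, -(1 / 2) < x - i.2 → x - i.2 < 1 / 2 → ⌊x⌋ = i.2 - 1 ∨ ⌊x⌋ = i.2 := by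
    intro x h1 h2
    rcases lt_or_ge x i.2 with h | h
    · left; rw [Int.floor_eq_iff]; push_cast; constructor <;> linarith
    · right; rw [Int.floor_eq_iff]; constructor <;> linarith
  have hl : ltr φ i.2 p.2 = ltr φ' i.2 p.2 := by
    rcases i with ⟨_ | _, n⟩
    · have h2 : ¬ 2 < p.2 := by have := hp.2.2; simp [pt] at this; linarith
      simp [ltr, h, h2]
    · have h2 : ¬ p.2 < 1 := by have := hp.2.1; simp [pt] at this; linarith
      simp [ltr, h, h2]
  have e1 : i.2 - 1 ≠ i.2 + 1 := by omega
  rcases hf p.1 hp.1.1 hp.1.2 with h1 | h1 <;> rcases hf q.1 hq.1.1 hq.1.2 with h2 | h2 <;>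
    simp [cc, h1, h2, hl, e1]

theorem hl_near {i : Lab} (h : i ∈ E ↔ i ∈ E') {f : I → Plane}
    (hf : ∀ t, f t ∈ Metric.ball (pt i) (1 / 2)) (hc : Continuous f) (hX : ∀ t, f t ∈ XE E)
    (hX' : ∀ t, f t ∈ XE E') : hl E f = hl E' f := by
  have hun : un E i = un E' i := by
    by_cases hi : i ∈ E
    · rw [un_mem hi, un_mem (h.1 hi)]
    · rw [un_notMem hi, un_notMem (mt h.2 hi)]
  have := hol_compare (isLoc_un E) (isLoc_un E') hc hc hX hX' (κ := fun _ => 1) fun t =>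
    .of_forall fun a => by rw [mul_one, one_mul, cc_near hun (hf t) (hf a)]
  rwa [mul_one, one_mul] at this

theorem ball_subset_XE {i : Lab} (h : i ∉ E) : Metric.ball (pt i) (1 / 2) ⊆ XE E := by
  rintro _ hx j hj rfl
  have := one_le_dist_pt (i := j) (j := i) fun e => h (e ▸ hj)
  rw [Metric.mem_ball] at hx
  linarith

theorem hl_near_eq_one {i : Lab} (h : i ∉ E) {f : I → Plane} (hc : Continuous f)
    (hf : ∀ t, f t ∈ Metric.ball (pt i) (1 / 2)) : hl E f = 1 := by
  rw [hl_near (E' := ∅) (by simp [h]) hf hc (fun t => ball_subset_XE h (hf t))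
    (fun t => by simp [XE])]
  have := keep_hl (E := ∅) hc fun t => by simp [XE]
  rw [← this]
  have h0 : keep ∅ = 1 := by ext i; simp [keep_of, un_notMem]
  rw [h0]; rfl

theorem keep_singleton_mem_zpowers (i : Lab) (u : FreeGroup Lab) :
    keep {i} u ∈ Subgroup.zpowers (FreeGroup.of i) := by
  have h : ∀ j, un {i} j ∈ Subgroup.zpowers (FreeGroup.of i) := fun j => by
    by_cases hj : j ∈ ({i} : Set Lab)
    · rw [un_mem hj, Set.mem_singleton_iff.1 hj]
      exact Subgroup.mem_zpowers _
    · rw [un_notMem hj]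
      exact one_mem _
  induction u using FreeGroup.induction_on with
  | C1 => rw [map_one]; exact one_mem _
  | of j => rw [keep_of]; exact h j
  | inv_of j _ => rw [map_inv, keep_of]; exact inv_mem (h j)
  | mul x y hx hy => rw [map_mul]; exact mul_mem hx hy

/-- The word of a small loop around a single fixed point is preserved. -/
theorem hl_single {F : I × Plane → Plane} (hF : Continuous F)
    (hFi : ∀ t, Function.Injective fun x => F (t, x)) (hF0 : ∀ x, F (0, x) = x) (i : Lab)
    (h1 : F (1, pt i) = pt i) {a : Plane} (c : Path a a) (hX : ∀ t, c t ∈ XE {i}) :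
    hl {i} (fun t => F (1, c t)) = hl {i} c := by
  have hm : ∀ u t, F (u, c t) - F (u, pt i) + pt i ∈ XE {i} := by
    rintro u t j hj e
    obtain rfl : j = i := hj
    rw [add_eq_right, sub_eq_zero] at e
    exact hX t j rfl (hFi u e)
  have hK : Continuous fun z : I × I => F (z.1, c z.2) - F (z.1, pt i) + pt i := by fun_prop
  have := hol_square (isLoc_un {i}) hK fun z => hm z.1 z.2
  simp only [hF0, h1, sub_add_cancel, c.source, c.target] at this
  have hcm : ∀ {f : I → Plane}, Continuous f → (∀ t, f t ∈ XE {i}) →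
      hol (cc (un {i})) f ∈ Subgroup.zpowers (FreeGroup.of i) := fun {f} hf hX => by
    have := keep_singleton_mem_zpowers i (hl {i} f)
    rwa [keep_hl hf hX] at this
  have hβ := hcm (f := fun s => F (s, a) - F (s, pt i) + pt i) (by fun_prop) fun s => by
    simpa using hm s 0
  obtain ⟨k, hk⟩ := Subgroup.mem_zpowers_iff.1 (hcm c.continuous hX)
  obtain ⟨k', hk'⟩ := Subgroup.mem_zpowers_iff.1 hβ
  rw [← hk', ← hk, ← zpow_add, add_comm, zpow_add, mul_right_inj] at this
  rw [hl, hl, ← hk, this]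

/-- The image of a loop freely homotopic to a small circle around a puncture. -/
theorem Good.peripheral {Ψ : Plane ≃ₜ Plane} (hΨ : Good Ψ) {i : Lab} (hi : i ∈ E) {a : Plane}
    (ha : 1 ≤ a.2 ∧ a.2 ≤ 2) (haE : a ∈ XE E) (η : Path a (pt i))
    (hη : ∀ t, η t ∈ XE (E \ {i})) (hη1 : hl (E \ {i}) η = 1) :
    ∃ e, keep E e = e ∧ keep (E \ {i}) e = hl (E \ {i}) (Ψ ∘ η) ∧
      ∀ g : Path a a, (∀ t, g t ∈ XE E) → hl E g = .of i →
        hl E (Ψ ∘ g) = e * .of i * e⁻¹ := by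
  obtain ⟨F, hF, hFh, hF0, hF1⟩ := hΨ.iso
  have hFi : ∀ t, Function.Injective fun x => F (t, x) := fun t => by
    obtain ⟨e, he⟩ := hFh t
    intro x y h
    apply e.injective
    rw [he, he]; exact h
  obtain ⟨ε, hε0, hε1, hε⟩ : ∃ ε > 0, ε < 1 / 2 ∧
      ∀ x ∈ Metric.closedBall (pt i) ε, Ψ x ∈ Metric.ball (pt i) (1 / 2) := by
    have := Metric.continuous_iff'.1 Ψ.continuous (pt i) (1 / 2) (by norm_num)
    obtain ⟨δ, hδ, h⟩ := Metric.eventually_nhds_iff_ball.1 this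
    refine ⟨min (δ / 2) (1 / 4), by positivity, ?_, fun x hx => ?_⟩
    · exact (min_le_right _ _).trans_lt (by norm_num)
    · have := h x (Metric.mem_ball.2 ((Metric.mem_closedBall.1 hx).trans_lt
        ((min_le_left _ _).trans_lt (by linarith))))
      rwa [hΨ.fix] at this
  set l := (pt i).2 with hl
  have hl12 : l = 1 ∨ l = 2 := pt_snd i
  have hl' : 1 ≤ l ∧ l ≤ 2 := by rcases hl12 with h | h <;> rw [h] <;> norm_num
  have hmi : Set.MapsTo Ψ (XE E) (XE E) := hΨ.mapsTo E
  have hn : (pt i).1 = i.2 := rfl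
  have hw : ∀ {d : ℝ}, d ≠ 0 → |d| ≤ ε → ∀ t, wedge i.2 ε l d t ∈ XE E ∧
      wedge i.2 ε l d t ∈ Metric.closedBall (pt i) ε := by
    intro d hd hd' t
    have hb : wedge i.2 ε l d t ∈ Metric.closedBall (pt i) ε := by
      have ht := abs_two_mul_sub_one_le t
      rw [Metric.mem_closedBall, Prod.dist_eq, Real.dist_eq, Real.dist_eq, max_le_iff, hn, ← hl,
        wedge_apply]
      simp only [add_sub_cancel_left, abs_mul, abs_of_pos hε0]
      refine ⟨by nlinarith, ?_⟩
      have : abs (1 - |2 * (t : ℝ) - 1|) ≤ 1 := by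
        rw [abs_le]; constructor <;> linarith [abs_nonneg (2 * (t : ℝ) - 1)]
      nlinarith [abs_nonneg d, abs_nonneg (1 - |2 * (t : ℝ) - 1|)]
    refine ⟨fun j hj e => ?_, hb⟩
    by_cases hji : j = i
    · rw [hji] at e
      have := (wedge_cut (m := i.2) hε0 (by linarith) (by rw [e]; rfl)).2
      rw [e, ← hl] at this
      exact hd (by linarith)
    · have := one_le_dist_pt hji
      rw [← e] at this
      rw [Metric.mem_closedBall] at hb
      linarith
  have hlo := hw (d := -ε) (by linarith) (by rw [abs_neg, abs_of_pos hε0])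
  have hup := hw (d := ε) hε0.ne' (by rw [abs_of_pos hε0])
  let c := (wedge i.2 ε l (-ε)).trans (wedge i.2 ε l ε).symm
  have hcE : ∀ t, c t ∈ XE E := trans_mem (fun t => (hlo t).1) fun _ => (hup _).1
  have hcb : ∀ t, c t ∈ Metric.closedBall (pt i) ε :=
    trans_mem (fun t => (hlo t).2) fun _ => (hup _).2
  have hcw : _root_.hl E c = .of i := by
    rw [hl_trans _ _ (fun t => (hlo t).1) fun _ => (hup _).1, hl_symm _ fun t => (hup t).1,
      hl_wedge _ _ _ hε0 (by linarith), hl_wedge _ _ _ hε0 (by linarith)]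
    rcases i with ⟨_ | _, n⟩
    · have hl1 : l = 1 := by rw [hl]; simp [pt]
      have h2 : ¬ (1 + ε < 1) := by linarith
      have h3 : ¬ (2 < 1 + ε) := by linarith
      simp [ltr, hl1, hε0, h2, h3, un_mem hi]
    · have hl2 : l = 2 := by rw [hl]; simp [pt]
      have h1 : ¬ (2 + -ε < 1) := by linarith
      have h2 : ¬ (2 + ε < 1) := by linarith
      have h3 : ¬ (2 < 2 + -ε) := by linarith
      simp [ltr, hl2, hε0, h1, h2, h3, un_mem hi]
  have hΨcb : ∀ t, Ψ (c t) ∈ Metric.ball (pt i) (1 / 2) := fun t => hε _ (hcb t)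
  have hsub : XE E ⊆ XE {i} := XE_anti (by simpa using hi)
  have hΨc : _root_.hl E (Ψ ∘ c) = .of i := by
    have hnear : ∀ {f : I → Plane}, Continuous f → (∀ t, f t ∈ Metric.ball (pt i) (1 / 2)) →
        (∀ t, f t ∈ XE E) → _root_.hl E f = _root_.hl {i} f := fun {f} hf hb hX =>
      hl_near (by simpa using hi) hb hf hX fun t => hsub (hX t)
    rw [hnear (Ψ.continuous.comp c.continuous) hΨcb fun t => hmi (hcE t)]
    have := hl_single hF hFi hF0 i (by rw [hF1, hΨ.fix]) c fun t => hsub (hcE t)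
    simp only [hF1] at this
    rw [← hcw, hnear c.continuous (fun t => ?_) hcE]
    · exact this
    · exact Metric.closedBall_subset_ball hε1 (hcb t)
  have hq : ((i.2 : ℝ) - ε, l) ∈ XE E := by simpa using (hup 0).1
  have hb : 1 < (((i.2 : ℝ), (3 : ℝ) / 2) : Plane).2 ∧ (((i.2 : ℝ), (3 : ℝ) / 2) : Plane).2 < 2 := by
    norm_num
  have s1 := segment_mid ha haE hb
  have s2 := segment_mid (a := ((i.2 : ℝ) - ε, l)) hl' hq hb
  let τ : Path a ((i.2 : ℝ) - ε, l) := (Path.segment a ((i.2 : ℝ), (3 : ℝ) / 2)).trans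
    (Path.segment ((i.2 : ℝ) - ε, l) ((i.2 : ℝ), (3 : ℝ) / 2)).symm
  have hτ : ∀ t, τ t ∈ XE E ∧ 1 ≤ (τ t).2 ∧ (τ t).2 ≤ 2 := by
    have : ∀ t, τ t ∈ {p : Plane | p ∈ XE E ∧ 1 ≤ p.2 ∧ p.2 ≤ 2} :=
      trans_mem (fun t => ⟨(s1 t).1, (s1 t).2.1⟩) fun _ => ⟨(s2 _).1, (s2 _).2.1⟩
    exact this
  have hτ1 : _root_.hl E τ = 1 := hl_strip fun t => (hτ t).2
  let δ : Path (((i.2 : ℝ) - ε, l) : Plane) (pt i) := Path.segment _ _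
  have hδ : ∀ t, δ t = ((i.2 : ℝ) - ε + t * ε, l) := fun t => by
    change AffineMap.lineMap (((i.2 : ℝ) - ε, l) : Plane) (pt i) (t : ℝ) = _
    rw [AffineMap.lineMap_apply]
    ext
    · change (t : ℝ) * ((i.2 : ℝ) - (i.2 - ε)) + (i.2 - ε) = i.2 - ε + t * ε
      ring
    · change (t : ℝ) * (l - l) + l = l
      ring
  have hδb : ∀ t, δ t ∈ Metric.closedBall (pt i) ε := fun t => by
    rw [Metric.mem_closedBall, hδ, Prod.dist_eq, Real.dist_eq, Real.dist_eq, max_le_iff, hn, ← hl,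
      sub_self, abs_zero]
    refine ⟨?_, hε0.le⟩
    rw [abs_le]
    constructor <;> nlinarith [t.2.1, t.2.2]
  have hni : i ∉ E \ {i} := by simp
  have hδX : ∀ t, δ t ∈ XE (E \ {i}) := fun t =>
    ball_subset_XE hni (Metric.closedBall_subset_ball hε1 (hδb t))
  have hE' : XE E ⊆ XE (E \ {i}) := XE_anti Set.sdiff_subset
  refine ⟨_root_.hl E (Ψ ∘ τ), keep_hl (Ψ.continuous.comp τ.continuous) fun t => hmi (hτ t).1,
    ?_, fun g hg hgw => ?_⟩
  · rw [← hl_keep Set.sdiff_subset (Ψ.continuous.comp τ.continuous) fun t => hmi (hτ t).1]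
    have h1 : ∀ t, (τ.trans δ) t ∈ XE (E \ {i}) := trans_mem (fun t => hE' (hτ t).1) hδX
    have h2 : _root_.hl (E \ {i}) (τ.trans δ) = 1 := by
      refine hl_strip fun t => ?_
      have : ∀ t, (τ.trans δ) t ∈ {p : Plane | 1 ≤ p.2 ∧ p.2 ≤ 2} :=
        trans_mem (fun t => (hτ t).2) fun t => by rw [hδ]; exact hl'
      exact this t
    rw [hl_comp_eq hη h1 (hη1.trans h2.symm) Ψ.continuous (hΨ.mapsTo _),
      hl_comp_trans τ δ Ψ.continuous (fun t => hE' (hmi (hτ t).1))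
        (fun t => hΨ.mapsTo _ (hδX t)),
      hl_near_eq_one hni (Ψ.continuous.comp δ.continuous) (fun t => hε _ (hδb t)), mul_one]
  · have h1 : ∀ t, ((τ.trans c).trans τ.symm) t ∈ XE E :=
      trans_mem (trans_mem (fun t => (hτ t).1) hcE) fun _ => (hτ _).1
    have h2 : _root_.hl E ((τ.trans c).trans τ.symm) = .of i := by
      rw [hl_trans _ _ (trans_mem (fun t => (hτ t).1) hcE) fun _ => (hτ _).1,
        hl_trans _ _ (fun t => (hτ t).1) hcE, hl_symm _ fun t => (hτ t).1, hτ1, hcw]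
      simp
    have h3 : ∀ t, Ψ ((τ.trans c) t) ∈ XE E := fun t =>
      hmi (trans_mem (X := XE E) (fun t => (hτ t).1) hcE t)
    rw [hl_comp_eq hg h1 (hgw.trans h2.symm) Ψ.continuous hmi,
      hl_comp_trans _ _ Ψ.continuous h3 (fun _ => hmi (hτ _).1),
      hl_comp_trans _ _ Ψ.continuous (fun t => hmi (hτ t).1) (fun t => hmi (hcE t)),
      hl_comp_symm _ Ψ.continuous (fun t => hmi (hτ t).1), hΨc]

end Peripheral

section Planarity

open Filter Topology unitInterval

variable {E E' : Set Lab}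

/-- Preimages of balls under the maps of an isotopy are uniformly bounded. -/
theorem isotopy_bounded {F : I × Plane → Plane} (hF : Continuous F)
    (hFh : ∀ t, IsHomeoFun fun x => F (t, x)) (z : Plane) (R : ℝ) :
    ∃ R', ∀ t x, dist (F (t, x)) z ≤ R → dist x z < R' := by
  wlog hR : 0 < R generalizing R
  · obtain ⟨R', h⟩ := this 1 one_pos
    exact ⟨R', fun t x hx => h t x (hx.trans (by linarith))⟩
  have loc : ∀ t₀ : I, ∃ R', ∀ᶠ t in 𝓝 t₀, ∀ x, dist (F (t, x)) z ≤ R → dist x z < R' := by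
    intro t₀
    obtain ⟨e, he⟩ := hFh t₀
    beta_reduce at he
    have hcpt : IsCompact (e.symm '' Metric.closedBall z R) :=
      (isCompact_closedBall z _).image e.symm.continuous
    obtain ⟨R', hR'⟩ := hcpt.isBounded.subset_ball z
    have h1 : ∀ᶠ t in 𝓝 t₀, ∀ x ∈ Metric.sphere z R', R < dist (F (t, x)) z := by
      refine (isCompact_sphere z R').eventually_forall_of_forall_eventually fun x hx => ?_
      have : R < dist (F (t₀, x)) z := by
        by_contra! h
        have h2 : x ∈ e.symm '' Metric.closedBall z R :=
          ⟨e x, by rw [Metric.mem_closedBall, he]; linarith, e.symm_apply_apply x⟩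
        have := hR' h2
        rw [Metric.mem_ball] at this
        rw [Metric.mem_sphere] at hx
        linarith
      have hc : ContinuousAt (fun q : I × Plane => dist (F q) z) (t₀, x) := by fun_prop
      exact hc.eventually (lt_mem_nhds this)
    have hp : F (t₀, e.symm z) = z := by rw [← he, e.apply_symm_apply]
    have h2 : ∀ᶠ t in 𝓝 t₀, dist (F (t, e.symm z)) z < R := by
      have hc : ContinuousAt (fun t : I => dist (F (t, e.symm z)) z) t₀ := by fun_prop
      refine hc.eventually (gt_mem_nhds ?_)
      beta_reduce
      rwa [hp, dist_self]
    refine ⟨R', ?_⟩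
    filter_upwards [h1, h2] with t ht1 ht2 x hx
    obtain ⟨f, hf⟩ := hFh t
    beta_reduce at hf
    by_contra! hx'
    have hA : IsPreconnected (f.symm '' Metric.closedBall z R) :=
      (convex_closedBall z R).isPreconnected.image _ f.symm.continuous.continuousOn
    have hm : ∀ y, dist (F (t, y)) z ≤ R → y ∈ f.symm '' Metric.closedBall z R := fun y hy =>
      ⟨f y, by rwa [Metric.mem_closedBall, hf], f.symm_apply_apply y⟩
    have hp' : dist (e.symm z) z ≤ R' :=
      (Metric.mem_ball.1 (hR' ⟨z, Metric.mem_closedBall_self hR.le, rfl⟩)).le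
    obtain ⟨y, ⟨w, hw, rfl⟩, hy⟩ := hA.intermediate_value (hm _ ht2.le) (hm x hx)
      (f := fun y => dist y z) (by fun_prop) ⟨hp', hx'⟩
    have := ht1 _ hy
    rw [← hf, f.apply_symm_apply] at this
    exact absurd hw (not_le.2 this)
  have := isCompact_univ.induction_on (X := I)
    (p := fun S => ∃ R', ∀ t ∈ S, ∀ x, dist (F (t, x)) z ≤ R → dist x z < R')
    ⟨0, by simp⟩ (fun S T hST ⟨R', h⟩ => ⟨R', fun t ht => h t (hST ht)⟩)
    (fun S T ⟨r, h⟩ ⟨r', h'⟩ => ⟨max r r', fun t ht x hx => by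
      rcases ht with ht | ht
      · exact lt_max_of_lt_left (h t ht x hx)
      · exact lt_max_of_lt_right (h' t ht x hx)⟩)
    fun t _ => by
      obtain ⟨R', h⟩ := loc t
      exact ⟨_, mem_nhdsWithin_of_mem_nhds h, R', fun s hs => hs⟩
  obtain ⟨R', h⟩ := this
  exact ⟨R', fun t => h t (Set.mem_univ t)⟩

/-- Freely homotopic loops have conjugate words. -/
theorem isConj_hl {K : I × I → Plane} (hK : Continuous K) (hX : ∀ z, K z ∈ XE E)
    (h : ∀ s, K (s, 0) = K (s, 1)) :
    IsConj (hl E fun t => K (0, t)) (hl E fun t => K (1, t)) := by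
  have := hol_square (isLoc_un E) hK hX
  rw [isConj_iff]
  refine ⟨(hl E fun s => K (s, 0))⁻¹, ?_⟩
  simp only [← h] at this
  unfold hl
  rw [mul_assoc, inv_inv, this]
  group

/-- A large loop around the first three punctures of the lower line. -/
noncomputable def bigLoop : Path ((1 - 3 / 2, 1) : Plane) (1 - 3 / 2, 1) :=
  (wedge 1 (3 / 2) 1 (-1)).trans (wedge 1 (3 / 2) 1 1).symm

/-- The first three labels of the lower line. -/
def three : Set Lab := {(false, 0), (false, 1), (false, 2)}

theorem hl_of_one_le (hE : E ⊆ low) {f : I → Plane} (hf : Continuous f) (h : ∀ t, 1 ≤ (f t).2) :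
    hl E f = 1 := by
  rw [hl, hol_floor (fun _ => 1) hf, inv_one, one_mul]
  intro t m _
  have h1 := not_lt.2 (h t)
  have h2 : un E (true, m) = 1 := un_notMem fun h => by simpa [low] using hE h
  simp [ltr, h1, h2]

theorem wedge_mem_diamond (d : ℝ) (hd : d = 1 ∨ d = -1) (t : I) :
    |(wedge 1 (3 / 2) 1 d t).1 - 1| * (2 / 3) + |(wedge 1 (3 / 2) 1 d t).2 - 1| = 1 := by
  have h1 := abs_two_mul_sub_one_le t
  have h2 : |d| = 1 := by rcases hd with h | h <;> simp [h]
  simp only [wedge_apply, add_sub_cancel_left, abs_mul, h2,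
    abs_of_nonneg (sub_nonneg.2 h1)]
  norm_num
  ring

theorem bigLoop_mem (t : I) : |(bigLoop t).1 - 1| * (2 / 3) + |(bigLoop t).2 - 1| = 1 :=
  trans_mem (X := {p : Plane | |p.1 - 1| * (2 / 3) + |p.2 - 1| = 1})
    (wedge_mem_diamond (-1) (.inr rfl)) (fun _ => wedge_mem_diamond 1 (.inl rfl) _) t

theorem mem_XE_three {p : Plane} {r : ℝ} (hr : 1 ≤ r)
    (h : |p.1 - 1| * (2 / 3) + |p.2 - 1| = r) : p ∈ XE three := by
  rintro i (rfl | rfl | rfl) rfl <;> norm_num [pt] at h <;> linarith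

theorem hl_bigLoop : hl three bigLoop = .of (false, 0) * .of (false, 1) * .of (false, 2) := by
  have hw : ∀ d : ℝ, d = 1 ∨ d = -1 → ∀ t, wedge 1 (3 / 2) 1 d t ∈ XE three := fun d hd t =>
    mem_XE_three le_rfl (wedge_mem_diamond d hd t)
  have hup : ∀ t, 1 ≤ (wedge 1 (3 / 2) 1 1 t).2 := fun t => by
    rw [wedge_apply]
    linarith [abs_two_mul_sub_one_le t]
  have h3 : three ⊆ low := by rintro i (rfl | rfl | rfl) <;> rfl
  rw [bigLoop, hl_trans _ _ (hw _ (.inr rfl)) (fun _ => hw 1 (.inl rfl) _),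
    hl_symm _ (hw 1 (.inl rfl)), hl_of_one_le h3 (wedge 1 (3 / 2) 1 1).continuous hup, inv_one,
    mul_one]
  let Q : ℤ → FreeGroup Lab := fun m => (if 0 ≤ m then .of (false, 0) else 1) *
    (if 1 ≤ m then .of (false, 1) else 1) * (if 2 ≤ m then .of (false, 2) else 1)
  rw [hl, hol_floor Q (wedge 1 (3 / 2) 1 (-1)).continuous]
  · have h0 : ⌊(wedge 1 (3 / 2) 1 (-1) 0).1⌋ = -1 := by
      rw [Path.source, Int.floor_eq_iff]; norm_num
    have h1 : ⌊(wedge 1 (3 / 2) 1 (-1) 1).1⌋ = 2 := by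
      rw [Path.target, Int.floor_eq_iff]; norm_num
    rw [h0, h1]
    simp [Q]
  · intro t m hm
    rw [wedge_apply] at hm ⊢
    have ht := abs_le.1 (abs_two_mul_sub_one_le t)
    have hm1 : -1 < m := by
      have : (-1 : ℝ) < m := by linarith
      exact_mod_cast this
    have hm2 : m < 3 := by
      have : (m : ℝ) < 3 := by linarith
      exact_mod_cast this
    have hy : 1 + -1 * (1 - |2 * (t : ℝ) - 1|) < 1 := by
      have : |2 * (t : ℝ) - 1| < 1 := by
        have e : 2 * (t : ℝ) - 1 = (m - 1) * (2 / 3) := by linarith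
        have a1 : (-1 : ℝ) < m := by exact_mod_cast hm1
        have a2 : (m : ℝ) ≤ 2 := by exact_mod_cast Int.lt_add_one_iff.1 hm2
        have a3 : (0 : ℝ) ≤ m := by exact_mod_cast (by omega : 0 ≤ m)
        rw [e, abs_lt]
        constructor <;> linarith
      linarith
    interval_cases m <;> simp [Q, ltr, hy, un, three, -neg_mul, mul_assoc]

theorem Good.planar {Ψ : Plane ≃ₜ Plane} (hΨ : Good Ψ) {a : Plane} (ha : 1 ≤ a.2 ∧ a.2 ≤ 2)
    (haE : a ∈ XE three) {g : Path a a} (hg : ∀ t, g t ∈ XE three)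
    (h : hl three g = .of (false, 0) * .of (false, 1) * .of (false, 2)) :
    IsConj (hl three g) (hl three (Ψ ∘ g)) := by
  obtain ⟨F, hF, hFh, hF0, hF1⟩ := hΨ.iso
  have hm := hΨ.mapsTo three
  let x₁ : Plane := (1, 1)
  let C : ℝ → I → Plane := fun r t => x₁ + r • (bigLoop t - x₁)
  have hC : Continuous fun z : ℝ × I => C z.1 z.2 := by fun_prop
  have hC1 : C 1 = bigLoop := by funext t; simp [C]
  have hCr : ∀ r, 1 ≤ r → ∀ t, |(C r t).1 - 1| * (2 / 3) + |(C r t).2 - 1| = r := by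
    intro r hr t
    have e1 : (C r t).1 - 1 = r * ((bigLoop t).1 - 1) := by simp [C, x₁]
    have e2 : (C r t).2 - 1 = r * ((bigLoop t).2 - 1) := by simp [C, x₁]
    rw [e1, e2, abs_mul, abs_mul, abs_of_nonneg (by linarith : 0 ≤ r)]
    linear_combination r * bigLoop_mem t
  have hC01 : ∀ r, C r 0 = C r 1 := fun r => by simp [C]
  obtain ⟨R, hR⟩ := isotopy_bounded hF hFh x₁ 1
  let r := max 1 (2 * R)
  have hr1 : 1 ≤ r := le_max_left _ _
  have hbase : (1 - 3 / 2, 1) ∈ XE three := by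
    have := mem_XE_three le_rfl (bigLoop_mem 0)
    rwa [bigLoop.source] at this
  have hs : ∀ s : I, 1 ≤ 1 + (s : ℝ) * (r - 1) := fun s => by
    nlinarith [s.2.1]
  have k1 := isConj_hl (E := three) (K := fun z => C (1 + (z.1 : ℝ) * (r - 1)) z.2) (by fun_prop)
    (fun z => mem_XE_three (hs _) (hCr _ (hs _) _)) fun _ => hC01 _
  have k2 := isConj_hl (E := three) (K := fun z => Ψ (C (1 + (z.1 : ℝ) * (r - 1)) z.2))
    (by have := Ψ.continuous; fun_prop) (fun z => hm (mem_XE_three (hs _) (hCr _ (hs _) _)))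
    fun _ => congrArg Ψ (hC01 _)
  have k3 := isConj_hl (E := three) (K := fun z => F (z.1, C r z.2)) (by fun_prop) (fun z => by
      rintro i hi e
      have h1 := hR z.1 (C r z.2) (by
        rw [e, Prod.dist_eq, max_le_iff]
        obtain rfl | rfl | rfl := hi <;> norm_num [pt, x₁, Real.dist_eq])
      have h2 := hCr r hr1 z.2
      rw [Prod.dist_eq, max_lt_iff, Real.dist_eq, Real.dist_eq] at h1
      have h3 : 2 * R ≤ r := le_max_right _ _
      have := abs_nonneg ((C r z.2).1 - 1)
      change |(C r z.2).1 - 1| < R ∧ |(C r z.2).2 - 1| < R at h1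
      linarith)
    fun _ => by rw [hC01]
  simp only [Set.Icc.coe_zero, Set.Icc.coe_one, zero_mul, add_zero, one_mul, add_sub_cancel, hC1,
    hF0, hF1] at k1 k2 k3
  have hconj : IsConj (hl three bigLoop) (hl three (Ψ ∘ bigLoop)) := k1.trans (k3.trans k2.symm)
  have hb : 1 < ((1, 3 / 2) : Plane).2 ∧ ((1, 3 / 2) : Plane).2 < 2 := by norm_num
  have s1 := segment_mid ha haE hb
  have s2 := segment_mid (a := (1 - 3 / 2, 1)) (by norm_num) hbase hb
  let τ : Path a ((1 - 3 / 2, 1) : Plane) := (Path.segment a (1, 3 / 2)).trans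
    (Path.segment ((1 - 3 / 2, 1) : Plane) (1, 3 / 2)).symm
  have hτ : ∀ t, τ t ∈ XE three ∧ 1 ≤ (τ t).2 ∧ (τ t).2 ≤ 2 := by
    have : ∀ t, τ t ∈ {p : Plane | p ∈ XE three ∧ 1 ≤ p.2 ∧ p.2 ≤ 2} :=
      trans_mem (fun t => ⟨(s1 t).1, (s1 t).2.1⟩) fun _ => ⟨(s2 _).1, (s2 _).2.1⟩
    exact this
  have hτ1 : hl three τ = 1 := hl_strip fun t => (hτ t).2
  have hbig : ∀ t, bigLoop t ∈ XE three := fun t => mem_XE_three le_rfl (bigLoop_mem t)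
  have h1 : ∀ t, ((τ.trans bigLoop).trans τ.symm) t ∈ XE three :=
    trans_mem (trans_mem (fun t => (hτ t).1) hbig) fun _ => (hτ _).1
  have h2 : hl three ((τ.trans bigLoop).trans τ.symm) = hl three bigLoop := by
    rw [hl_trans _ _ (trans_mem (fun t => (hτ t).1) hbig) fun _ => (hτ _).1,
      hl_trans _ _ (fun t => (hτ t).1) hbig, hl_symm _ fun t => (hτ t).1, hτ1]
    simp
  have h3 : ∀ t, Ψ ((τ.trans bigLoop) t) ∈ XE three := fun t =>
    hm (trans_mem (X := XE three) (fun t => (hτ t).1) hbig t)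
  rw [hl_comp_eq hg h1 ((h.trans hl_bigLoop.symm).trans h2.symm) Ψ.continuous hm,
    hl_comp_trans _ _ Ψ.continuous h3 (fun _ => hm (hτ _).1),
    hl_comp_trans _ _ Ψ.continuous (fun t => hm (hτ t).1) (fun t => hm (hbig t)),
    hl_comp_symm _ Ψ.continuous (fun t => hm (hτ t).1), h.trans hl_bigLoop.symm]
  exact hconj.trans (isConj_iff.2 ⟨_, rfl⟩)

end Planarity

section LowerLine

open Filter Topology unitInterval

variable {E E' : Set Lab} {Ψ : Plane ≃ₜ Plane}

/-- A path in the strip between two points of the strip. -/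
noncomputable def link (a b : Plane) : Path a b :=
  (Path.segment a ((0, 3 / 2) : Plane)).trans (Path.segment b ((0, 3 / 2) : Plane)).symm

theorem link_mem {a b : Plane} (ha : 1 ≤ a.2 ∧ a.2 ≤ 2) (haE : a ∈ XE E)
    (hb : 1 ≤ b.2 ∧ b.2 ≤ 2) (hbE : b ∈ XE E) (t : I) :
    link a b t ∈ XE E ∧ 1 ≤ (link a b t).2 ∧ (link a b t).2 ≤ 2 := by
  have hm : 1 < ((0, 3 / 2) : Plane).2 ∧ ((0, 3 / 2) : Plane).2 < 2 := by norm_num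
  have s1 := segment_mid ha haE hm
  have s2 := segment_mid hb hbE hm
  exact trans_mem (X := {p : Plane | p ∈ XE E ∧ 1 ≤ p.2 ∧ p.2 ≤ 2})
    (fun t => ⟨(s1 t).1, (s1 t).2.1⟩) (fun t => ⟨(s2 _).1, (s2 _).2.1⟩) t

theorem hl_link {a b : Plane} (ha : 1 ≤ a.2 ∧ a.2 ≤ 2) (hb : 1 ≤ b.2 ∧ b.2 ≤ 2) :
    hl E (link a b) = 1 :=
  hl_strip fun t => (link_mem (E := ∅) ha (by simp [XE]) hb (by simp [XE]) t).2

theorem pt_strip (i : Lab) : 1 ≤ (pt i).2 ∧ (pt i).2 ≤ 2 := by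
  rcases pt_snd i with h | h <;> rw [h] <;> norm_num

theorem pt_mem_XE {i : Lab} (h : i ∉ E) : pt i ∈ XE E := fun _ hj e => h (pt_injective e ▸ hj)

theorem Good.exists_act (hΨ : Good Ψ) {p : Lab} (hp : p ∉ E) :
    ∃ α : FreeGroup Lab →* FreeGroup Lab, (∀ u, α (keep E u) = α u) ∧
      (∀ u, keep E (α u) = α u) ∧ (∀ u, ∃ v, α v = keep E u) ∧
      ∀ γ : Path (pt p) (pt p), (∀ t, γ t ∈ XE E) → hl E (Ψ ∘ γ) = α (hl E γ) := by
  obtain ⟨α, h1, h2⟩ := _root_.exists_act (pt_strip p) (pt_mem_XE hp) Ψ.continuous (hΨ.mapsTo E)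
  have hsm : Set.MapsTo Ψ.symm (XE E) (XE E) :=
    mapsTo_XE_of_fix Ψ.symm.injective fun i _ => by rw [Ψ.symm_apply_eq, hΨ.fix]
  refine ⟨α, h1, fun u => ?_, fun u => ?_, h2⟩
  · obtain ⟨g, hg, hgu⟩ := exists_loop (pt_strip p) (pt_mem_XE hp) u
    rw [← h1 u, ← hgu, ← h2 g hg]
    exact keep_hl (Ψ.continuous.comp g.continuous) fun t => hΨ.mapsTo E (hg t)
  · obtain ⟨g, hg, hgu⟩ := exists_loop (pt_strip p) (pt_mem_XE hp) u
    have hf : Ψ.symm (pt p) = pt p := by rw [Ψ.symm_apply_eq, hΨ.fix]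
    let g' : Path (pt p) (pt p) := (g.map Ψ.symm.continuous).cast hf.symm hf.symm
    refine ⟨hl E g', ?_⟩
    rw [← h2 g' fun t => hsm (hg t), ← hgu]
    congr 1
    funext t
    exact Ψ.apply_symm_apply _

/-- The word of the image of a loop conjugated by a strip path. -/
theorem hl_conj {a b : Plane} {f : Plane → Plane} (hf : Continuous f)
    (hm : Set.MapsTo f (XE E) (XE E')) {s : Path a b} {g : Path b b} (hs : ∀ t, s t ∈ XE E)
    (hg : ∀ t, g t ∈ XE E) :
    hl E' (f ∘ ((s.trans g).trans s.symm)) =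
      hl E' (f ∘ s) * hl E' (f ∘ g) * (hl E' (f ∘ s))⁻¹ := by
  rw [hl_comp_trans _ _ hf (fun t => hm (trans_mem (X := XE E) hs hg t)) (fun _ => hm (hs _)),
    hl_comp_trans _ _ hf (fun t => hm (hs t)) (fun t => hm (hg t)),
    hl_comp_symm _ hf (fun t => hm (hs t))]

theorem mem_low (n : ℤ) : (false, n) ∈ low := rfl

theorem sh_low : sh '' low = low := by
  ext i
  rw [Equiv.image_eq_preimage_symm, Set.mem_preimage, ← sh_mem_low, Equiv.apply_symm_apply]

/-- Seen from the upper line, the action on the lower punctures is inner. -/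
theorem Good.exists_conj (hΨ : Good Ψ) :
    ∃ h, keep low h = h ∧ ∀ g : Path (pt (true, 0)) (pt (true, 0)), (∀ t, g t ∈ XE low) →
      hl low (Ψ ∘ g) = h * hl low g * h⁻¹ := by
  have hbase : ∀ n, (true, n) ∉ low := fun n => by simp [low]
  have ha := pt_strip (true, 0)
  have haE : pt (true, 0) ∈ XE low := pt_mem_XE (hbase 0)
  have haE' : pt (true, -1) ∈ XE low := pt_mem_XE (hbase (-1))
  have hm := hΨ.mapsTo low
  have h3 : three ⊆ low := by rintro i (rfl | rfl | rfl) <;> rfl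
  obtain ⟨φ, hφ1, hφ2, hφs, hφ⟩ := hΨ.exists_act (hbase 0)
  let s := link (pt (true, 0)) (pt (true, -1))
  have hs : ∀ t, s t ∈ XE low := fun t => (link_mem ha haE (pt_strip _) haE' t).1
  have hs1 : hl low s = 1 := hl_link ha (pt_strip _)
  have hsh : ∀ u, φ (sg u) = hl low (Ψ ∘ s) * sg (φ u) * (hl low (Ψ ∘ s))⁻¹ := fun u => by
    obtain ⟨g, hg, hgu⟩ := exists_loop ha haE u
    have hb : Rp (pt (true, 0)) = pt (true, -1) := Rp_pt _
    let g' : Path (pt (true, -1)) (pt (true, -1)) := (g.map Rp.continuous).cast hb.symm hb.symm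
    have hR : Set.MapsTo Rp (XE low) (XE low) := by
      have := mapsTo_XE (E := low) Rp.injective Rp_pt
      rwa [sh_low] at this
    have hg' : ∀ t, g' t ∈ XE low := fun t => hR (hg t)
    have e1 : hl low (Ψ ∘ g') = sg (φ u) := by
      have := hΨ.comm low g g.continuous hg ⟨_, g.source⟩ ⟨_, g.target⟩
      rw [sh_low, hφ g hg, hgu, hφ1] at this
      exact this
    have e2 : hl low g' = keep low (sg u) := by
      have := hl_Rp g.continuous hg
      rw [sh_low, hgu, ← keep_low_sg] at this
      exact this
    have e3 := hl_conj continuous_id (Set.mapsTo_id _) hs hg'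
    simp only [Function.id_comp] at e3
    rw [hs1, one_mul, inv_one, mul_one, e2] at e3
    rw [← e1, ← hl_conj Ψ.continuous hm hs hg', hφ _ (trans_mem (trans_mem hs hg') fun _ => hs _),
      e3, hφ1]
  have h0 : (false, 0) ∈ low := rfl
  have hx0 : pt (false, 0) ∈ XE (low \ {(false, 0)}) := pt_mem_XE (by simp)
  obtain ⟨e, he, -, hep⟩ := hΨ.peripheral h0 ha haE (link (pt (true, 0)) (pt (false, 0)))
    (fun t => (link_mem ha (XE_anti Set.sdiff_subset haE) (pt_strip _) hx0 t).1)
    (hl_link ha (pt_strip _))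
  have hword : ∀ u, ∃ g : Path (pt (true, 0)) (pt (true, 0)), (∀ t, g t ∈ XE low) ∧
      hl low g = keep low u := exists_loop ha haE
  have hk : ∀ n, keep low (.of (false, n)) = .of (false, n) := fun n => by
    rw [keep_of, un_mem (mem_low n)]
  obtain ⟨h, hkh, hh⟩ := exists_conj_of_shift hφs hφ1
    (keep_hl (Ψ.continuous.comp s.continuous) fun t => hm (hs t)) hsh he (by
      obtain ⟨g, hg, hgu⟩ := hword (.of (false, 0))
      rw [hk] at hgu
      rw [← hgu, ← hφ g hg, hep g hg hgu, hgu]) (by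
      obtain ⟨g, hg, hgu⟩ := hword (.of (false, 0) * .of (false, 1) * .of (false, 2))
      have hg3 : ∀ t, g t ∈ XE three := fun t => XE_anti h3 (hg t)
      have e3 : hl three g = .of (false, 0) * .of (false, 1) * .of (false, 2) := by
        rw [hl_keep h3 g.continuous hg, hgu, keep_keep h3]
        simp [keep_of, un, three]
      obtain ⟨c, hc⟩ := isConj_iff.1 (hΨ.planar ha (XE_anti h3 haE) hg3 e3)
      refine ⟨c, ?_⟩
      rw [e3] at hc
      rw [hc, ← hφ1, ← hgu, ← hφ g hg]
      exact (hl_keep h3 (Ψ.continuous.comp g.continuous) fun t => hm (hg t)).symm)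
  refine ⟨h, hkh, fun g hg => ?_⟩
  have hconj : φ = (MulAut.conj h).toMonoidHom.comp (keep low) := by
    ext ⟨_ | _, n⟩
    · simp [hk, hh]
    · rw [← hφ1, keep_of, un_notMem (hbase n)]
      simp [keep_of, un_notMem (hbase n)]
  rw [hφ g hg, hconj]
  simp [keep_hl g.continuous hg]

/-- Loops based at a lower puncture keep their words in the lower punctures. -/
theorem Good.hl_low (hΨ : Good Ψ) (n : ℤ) {g : Path (pt (false, n)) (pt (false, n))}
    (hg : ∀ t, g t ∈ XE (low \ {(false, n)})) :
    hl (low \ {(false, n)}) (Ψ ∘ g) = hl (low \ {(false, n)}) g := by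
  obtain ⟨h, hkh, hh⟩ := hΨ.exists_conj
  set E := low \ {(false, n)} with hE
  have hEl : E ⊆ low := Set.sdiff_subset
  have ha := pt_strip (true, 0)
  have haE : pt (true, 0) ∈ XE low := pt_mem_XE (by simp [low])
  have hx : pt (false, n) ∈ XE E := pt_mem_XE (by simp [hE])
  let η := link (pt (true, 0)) (pt (false, n))
  have hη : ∀ t, η t ∈ XE E := fun t => (link_mem ha (XE_anti hEl haE) (pt_strip _) hx t).1
  have hη1 : hl E η = 1 := hl_link ha (pt_strip _)
  obtain ⟨e, he, hee, hep⟩ := hΨ.peripheral (mem_low n) ha haE η hη hη1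
  have hk : keep low (.of (false, n)) = .of (false, n) := by rw [keep_of, un_mem (mem_low n)]
  have hkE : keep E h = hl E (Ψ ∘ η) := by
    obtain ⟨γ, hγ, hγu⟩ := exists_loop ha haE (.of (false, n))
    rw [hk] at hγu
    have h1 := hep γ hγ hγu
    rw [hh γ hγ, hγu] at h1
    have h2 : Commute (h⁻¹ * e) (.of (false, n)) := by
      rw [Commute, SemiconjBy]
      have := congrArg (fun z => h⁻¹ * z * e) h1
      simp only [mul_assoc, inv_mul_cancel_left, inv_mul_cancel, mul_one] at this
      rw [mul_assoc, this]
    obtain ⟨m, hm⟩ := Subgroup.mem_zpowers_iff.1 (mem_zpowers_of_commute _ _ h2)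
    have h3 : keep E (h⁻¹ * e) = 1 := by
      rw [← hm, map_zpow, keep_of, un_notMem (by simp [hE]), one_zpow]
    rw [map_mul, map_inv, inv_mul_eq_one] at h3
    rw [h3, hE, hee]
  have hw : keep low (hl E g) = hl E g := by
    rw [← keep_hl g.continuous hg, keep_keep' hEl]
  obtain ⟨γ, hγ, hγu⟩ := exists_loop ha haE (hl E g)
  rw [hw] at hγu
  have hγE : ∀ t, γ t ∈ XE E := fun t => XE_anti hEl (hγ t)
  have hm := hΨ.mapsTo E
  have e1 : hl E (Ψ ∘ γ) = keep E h * hl E g * (keep E h)⁻¹ := by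
    rw [hl_keep hEl (Ψ.continuous.comp γ.continuous) fun t => hΨ.mapsTo low (hγ t), hh γ hγ, hγu,
      map_mul, map_mul, map_inv, keep_hl g.continuous hg]
  have e2 : hl E ((η.trans g).trans η.symm) = hl E γ := by
    have := hl_conj continuous_id (Set.mapsTo_id _) hη hg
    simp only [Function.id_comp] at this
    rw [this, hη1, one_mul, inv_one, mul_one, hl_keep hEl γ.continuous hγ, hγu,
      keep_hl g.continuous hg]
  have e3 := hl_comp_eq (trans_mem (trans_mem hη hg) fun _ => hη _) hγE e2 Ψ.continuous hm
  rw [e1, hl_conj Ψ.continuous hm hη hg, hkE] at e3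
  exact mul_left_cancel (mul_right_cancel e3)

end LowerLine

section Mixing

open Filter Topology unitInterval

variable {E E' : Set Lab} {Ψ : Plane ≃ₜ Plane}

/-- Comparison of the words of a path for two labellings related by a gauge transformation. -/
theorem hol_gauge {H : Type*} [Group H] {φ φ' : Lab → H} (hφ : ∀ i ∉ E, φ i = 1)
    (hφ' : ∀ i ∉ E, φ' i = 1) (κ : ℤ → H) {f : I → Plane} (hf : Continuous f)
    (hX : ∀ t, f t ∈ XE E)
    (h : ∀ t, ∀ m : ℤ, (f t).1 = m →
      ltr φ m (f t).2 * κ m = κ (m - 1) * ltr φ' m (f t).2) :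
    hol (cc φ) f * κ ⌊(f 1).1⌋ = κ ⌊(f 0).1⌋ * hol (cc φ') f := by
  refine hol_compare (isLoc_cc hφ) (isLoc_cc hφ') hf hf hX hX (κ := fun t => κ ⌊(f t).1⌋)
    fun t => ?_
  have hc : Continuous fun t => (f t).1 := by fun_prop
  by_cases hm : ∃ m : ℤ, (f t).1 = m
  · obtain ⟨m, hm⟩ := hm
    have hn : ∀ᶠ a in 𝓝 t, (f a).1 ∈ Set.Ioo ((m : ℝ) - 1) (m + 1) :=
      hc.continuousAt (Ioo_mem_nhds (by rw [hm]; linarith) (by rw [hm]; linarith))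
    filter_upwards [hn] with a ha
    have e1 : ⌊(f t).1⌋ = m := by rw [hm, Int.floor_intCast]
    rcases lt_or_ge (f a).1 m with h1 | h1
    · have e2 : ⌊(f a).1⌋ = m - 1 := by
        rw [Int.floor_eq_iff]; push_cast; exact ⟨ha.1.le, by linarith⟩
      rw [cc, cc, e1, e2, if_neg (by omega), if_pos (by omega), if_neg (by omega),
        if_pos (by omega), inv_mul_eq_iff_eq_mul, ← mul_assoc, h t m hm, mul_inv_cancel_right]
    · have e2 : ⌊(f a).1⌋ = m := by
        rw [Int.floor_eq_iff]; exact ⟨h1, ha.2⟩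
      simp [cc, e1, e2]
  · have h1 : ((⌊(f t).1⌋ : ℤ) : ℝ) < (f t).1 :=
      lt_of_le_of_ne (Int.floor_le _) fun h => hm ⟨_, h.symm⟩
    have hn : ∀ᶠ a in 𝓝 t, (f a).1 ∈ Set.Ioo (⌊(f t).1⌋ : ℝ) (⌊(f t).1⌋ + 1) :=
      hc.continuousAt (Ioo_mem_nhds h1 (Int.lt_floor_add_one _))
    filter_upwards [hn] with a ha
    have e2 : ⌊(f a).1⌋ = ⌊(f t).1⌋ := by
      rw [Int.floor_eq_iff]; exact ⟨ha.1.le, ha.2⟩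
    simp [cc, e2]

/-- The `k`-th power of the shift of labels. -/
def shz (k : ℤ) : Equiv.Perm Lab where
  toFun i := (i.1, if i.1 then i.2 - k else i.2 + k)
  invFun i := (i.1, if i.1 then i.2 + k else i.2 - k)
  left_inv i := by rcases i with ⟨_ | _, n⟩ <;> simp
  right_inv i := by rcases i with ⟨_ | _, n⟩ <;> simp

theorem shz_zero : shz 0 = 1 := by
  ext ⟨_ | _, n⟩ <;> simp [shz]

theorem shz_add_one (k : ℤ) (i : Lab) : shz (k + 1) i = sh (shz k i) := by
  rcases i with ⟨_ | _, n⟩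
  · simp [shz, sh, add_assoc]
  · simp [shz, sh, sub_sub]

theorem shz_neg_cancel (k : ℤ) (i : Lab) : shz k (shz (-k) i) = i := by
  rcases i with ⟨_ | _, n⟩ <;> simp [shz]

theorem shz_false (k n : ℤ) : shz k (false, n) = (false, n + k) := rfl

theorem shz_true (k n : ℤ) : shz k (true, n) = (true, n - k) := rfl

/-- The `k`-th power of the shift of words. -/
def sgz (k : ℤ) : FreeGroup Lab ≃* FreeGroup Lab := FreeGroup.freeGroupCongr (shz k)

theorem sgz_of (k : ℤ) (i : Lab) : sgz k (.of i) = .of (shz k i) := by simp [sgz]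

theorem sgz_add_one (k : ℤ) (u : FreeGroup Lab) : sgz (k + 1) u = sg (sgz k u) := by
  have : (sgz (k + 1)).toMonoidHom = sg.toMonoidHom.comp (sgz k).toMonoidHom := by
    ext i
    simp [sgz_of, sg_of, shz_add_one]
  exact DFunLike.congr_fun this u

theorem sgz_neg_cancel (k : ℤ) (u : FreeGroup Lab) : sgz k (sgz (-k) u) = u := by
  have : (sgz k).toMonoidHom.comp (sgz (-k)).toMonoidHom = MonoidHom.id _ := by
    ext i
    simp [sgz_of, shz_neg_cancel]
  exact DFunLike.congr_fun this u

theorem keep_low_sgz (k : ℤ) (u : FreeGroup Lab) : keep low (sgz k u) = sgz k (keep low u) := by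
  have hl : ∀ i, shz k i ∈ low ↔ i ∈ low := fun i => Iff.rfl
  have : (keep low).comp (sgz k).toMonoidHom = (sgz k).toMonoidHom.comp (keep low) := by
    ext i
    by_cases hi : i ∈ low
    · simp [sgz_of, keep_of, un_mem hi, un_mem ((hl i).2 hi)]
    · simp [sgz_of, keep_of, un_notMem hi, un_notMem (mt (hl i).1 hi)]
  exact DFunLike.congr_fun this u

/-- The `k`-th power of the truncated Reeb map. -/
noncomputable def Rpz (k : ℤ) : Plane ≃ₜ Plane :=
  shear (fun y => k * disp y) (continuous_const.mul continuous_disp)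

theorem Rpz_apply (k : ℤ) (p : Plane) : Rpz k p = (p.1 + k * disp p.2, p.2) := rfl

theorem Rpz_pt (k : ℤ) (i : Lab) : Rpz k (pt i) = pt (shz k i) := by
  rcases i with ⟨_ | _, n⟩
  · simp [Rpz_apply, pt, shz, disp_low]
  · simp [Rpz_apply, pt, shz, disp_high, sub_eq_add_neg]

theorem Rpz_neg_cancel (k : ℤ) (p : Plane) : Rpz k (Rpz (-k) p) = p := by
  simp [Rpz_apply]

theorem Good.comm_nat (hΨ : Good Ψ) {g : I → Plane} (hg : Continuous g)
    (hX : ∀ t, g t ∈ XE E) (h0 : ∃ i, g 0 = pt i) (h1 : ∃ i, g 1 = pt i) (k : ℕ) :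
    hl (shz k '' E) (Ψ ∘ Rpz k ∘ g) = sgz k (hl E (Ψ ∘ g)) := by
  induction k with
  | zero =>
    have e1 : shz (0 : ℕ) '' E = E := by
      rw [Nat.cast_zero, shz_zero]; simp
    have e2 : Rpz (0 : ℕ) ∘ g = g := by funext t; simp [Rpz_apply]
    have e3 : ∀ u, sgz (0 : ℕ) u = u := fun u => by simp [sgz, shz_zero]
    rw [e1, e2, e3]
  | succ k ih =>
    have e1 : shz (k + 1 : ℕ) '' E = sh '' (shz k '' E) := by
      rw [Set.image_image]; push_cast; simp only [shz_add_one]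
    have e2 : Rpz (k + 1 : ℕ) ∘ g = Rp ∘ (Rpz k ∘ g) := by
      funext t; ext <;> simp [Rpz_apply, Rp_apply]; ring
    have hend : ∀ t, (∃ i, g t = pt i) → ∃ i, (Rpz k ∘ g) t = pt i := fun t ⟨i, hi⟩ =>
      ⟨_, (congrArg (Rpz k) hi).trans (Rpz_pt k i)⟩
    rw [e1, e2, hΨ.comm _ _ ((Rpz k).continuous.comp hg)
      (fun t => mapsTo_XE (Rpz k).injective (Rpz_pt k) (hX t)) (hend 0 h0) (hend 1 h1), ih]
    push_cast
    rw [sgz_add_one]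

/-- The lower labels on the left together with the upper labels on the right. -/
def apart : Set Lab := {i | if i.1 then 0 < i.2 else i.2 < 0}

theorem exists_sgz_apart (u : FreeGroup Lab) :
    ∃ K : ℕ, ∀ k : ℕ, K ≤ k → keep apart (sgz (-k) u) = sgz (-k) u := by
  induction u using FreeGroup.induction_on with
  | C1 => exact ⟨0, fun k _ => by simp⟩
  | of i =>
    refine ⟨i.2.natAbs + 1, fun k hk => ?_⟩
    rw [sgz_of, keep_of, un_mem]
    rcases i with ⟨_ | _, n⟩ <;> simp only [shz_false, shz_true, apart, Set.mem_ofPred_eq] <;>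
      simp at hk ⊢ <;> omega
  | inv_of i h =>
    obtain ⟨K, h⟩ := h
    exact ⟨K, fun k hk => by rw [map_inv, map_inv, h k hk]⟩
  | mul u v h h' =>
    obtain ⟨K, h⟩ := h
    obtain ⟨K', h'⟩ := h'
    exact ⟨max K K', fun k hk => by
      rw [map_mul, map_mul, h k (le_of_max_le_left hk), h' k (le_of_max_le_right hk)]⟩

/-- Two copies of the words. -/
abbrev Two : Type := FreeGroup Lab ⊕ FreeGroup Lab

/-- Left translation of the first copy. -/
def trL : FreeGroup Lab →* Equiv.Perm Two :=
  (Equiv.Perm.sumCongrHom _ _).comp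
    ((MonoidHom.inl _ _).comp (MulAction.toPermHom (FreeGroup Lab) (FreeGroup Lab)))

/-- The exchange of the two copies. -/
def swapTwo : Equiv.Perm Two := Equiv.sumComm _ _

theorem swapTwo_mul_self : swapTwo * swapTwo = 1 := by
  ext (x | x) <;> rfl

theorem trL_inl (u v : FreeGroup Lab) : trL u (.inl v) = .inl (u * v) := rfl

theorem trL_inr (u v : FreeGroup Lab) : trL u (.inr v) = .inr v := rfl

/-- The first labelling by permutations. -/
def labA (i : Lab) : Equiv.Perm Two :=
  if i.2 = 0 then (if i.1 then 1 else swapTwo) else trL (.of i)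

/-- The second labelling by permutations. -/
def labB (i : Lab) : Equiv.Perm Two :=
  if i.2 = 0 then (if i.1 then swapTwo else 1)
  else if i.2 < 0 then trL (.of i) else swapTwo * trL (.of i) * swapTwo

theorem labA_keep {u : FreeGroup Lab} (hu : keep apart u = u) :
    FreeGroup.lift labA u = trL u := by
  have : (FreeGroup.lift labA).comp (keep apart) = trL.comp (keep apart) := by
    ext1 i
    by_cases hi : i ∈ apart
    · have : i.2 ≠ 0 := by
        rcases i with ⟨_ | _, n⟩ <;> simp [apart] at hi ⊢ <;> omega
      simp [keep_of, un_mem hi, labA, this]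
    · simp [keep_of, un_notMem hi]
  rw [← hu]
  exact DFunLike.congr_fun this u

theorem labB_keep {u : FreeGroup Lab} (hu : keep apart u = u) :
    FreeGroup.lift labB u (.inl 1) = .inl (keep low u) := by
  have : ∀ v w, FreeGroup.lift labB (keep apart v) (.inl w) =
      .inl (keep low (keep apart v) * w) := fun v => by
    induction v using FreeGroup.induction_on with
    | C1 => intro w; simp
    | of i =>
      intro w
      by_cases hi : i ∈ apart
      · rcases i with ⟨_ | _, n⟩
        · have : n < 0 := by simpa [apart] using hi
          simp [keep_of, un_mem hi, labB, this, this.ne, un_mem (mem_low n), trL_inl]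
        · have : 0 < n := by simpa [apart] using hi
          have h2 : un low (true, n) = 1 := un_notMem (by simp [low])
          rw [keep_of, un_mem hi, FreeGroup.lift_apply_of, keep_of, h2, one_mul]
          simp only [labB, this.ne', this.not_gt, if_false]
          rfl
      · simp [keep_of, un_notMem hi]
    | inv_of i h =>
      intro w
      rw [map_inv, map_inv, map_inv, Equiv.Perm.inv_eq_iff_eq, h, mul_inv_cancel_left]
    | mul x y hx hy =>
      intro w
      rw [map_mul, map_mul, map_mul, Equiv.Perm.mul_apply, hy, hx, mul_assoc]
  have h := this u 1
  rwa [hu, mul_one] at h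

end Mixing

section Mixing

open Filter Topology unitInterval

variable {E E' : Set Lab} {Ψ : Plane ≃ₜ Plane}

theorem hol_lift {H : Type*} [Group H] (L : Lab → H) {f : I → Plane} (hf : Continuous f)
    (hX : ∀ t, f t ∈ XE E) :
    hol (cc fun i => FreeGroup.lift L (un E i)) f = FreeGroup.lift L (hl E f) := by
  rw [hl, ← hol_map (isLoc_un E) hf hX]
  congr 1
  funext p q
  exact cc_map _ _ _ _

/-- A path that avoids a gate in the strip, with both ends on the left, has no upper letters
provided its lower letters are on the left and its upper letters on the right. -/
theorem keep_low_hl_of_avoid (hE : ∀ b, (b, 0) ∈ E) {f : I → Plane} (hf : Continuous f)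
    (hX : ∀ t, f t ∈ XE E) (h0 : (f 0).1 < 0) (h1 : (f 1).1 < 0)
    (hav : ∀ t, (f t).1 = 0 → (f t).2 < 1 ∨ 2 < (f t).2) (hu : keep apart (hl E f) = hl E f) :
    keep low (hl E f) = hl E f := by
  let κ : ℤ → Equiv.Perm Two := fun n => if n < 0 then 1 else swapTwo
  have hone : ∀ (L : Lab → Equiv.Perm Two), ∀ i ∉ E, FreeGroup.lift L (un E i) = 1 :=
    fun L i hi => by rw [un_notMem hi, map_one]
  have hsw : (swapTwo)⁻¹ = swapTwo := inv_eq_of_mul_eq_one_left swapTwo_mul_self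
  have key : ∀ i : Lab, i.2 ≠ 0 → FreeGroup.lift labA (un E i) * κ i.2 =
      κ i.2 * FreeGroup.lift labB (un E i) := by
    intro i hi
    by_cases hiE : i ∈ E
    · rw [un_mem hiE, FreeGroup.lift_apply_of, FreeGroup.lift_apply_of]
      rcases lt_or_gt_of_ne hi with h | h
      · simp [κ, labA, labB, h, hi]
      · simp only [κ, labA, labB, h.not_gt, hi, if_false]
        rw [← mul_assoc, ← mul_assoc, swapTwo_mul_self, one_mul]
    · simp [un_notMem hiE]
  have hg := hol_gauge (hone labA) (hone labB) κ hf hX fun t m hm => by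
    rcases eq_or_ne m 0 with rfl | hm0
    · have e1 : ∀ b, un E (b, 0) = .of (b, 0) := fun b => un_mem (hE b)
      rcases hav t (by simpa using hm) with h | h
      · simp [ltr, h, e1, κ, labA, labB, swapTwo_mul_self]
      · have h' : ¬ (f t).2 < 1 := by linarith
        simp [ltr, h, h', e1, κ, labA, labB, hsw]
    · have e : κ (m - 1) = κ m := by
        have : m - 1 < 0 ↔ m < 0 := by omega
        simp only [κ, this]
      rw [e]
      have kf := key (false, m) hm0
      have kt := key (true, m) hm0
      simp only [ltr]
      split_ifs
      · exact kf
      · rw [inv_mul_eq_iff_eq_mul, ← mul_assoc, kt, mul_inv_cancel_right]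
      · rw [one_mul, mul_one]
  have hκ : ∀ x : ℝ, x < 0 → κ ⌊x⌋ = 1 := fun x hx => if_pos (Int.floor_lt.2 (by simpa using hx))
  rw [hκ _ h0, hκ _ h1, mul_one, one_mul, hol_lift _ hf hX, hol_lift _ hf hX, labA_keep hu] at hg
  have := labB_keep hu
  rw [← hg, trL_inl, mul_one] at this
  exact (Sum.inl_injective this).symm

/-- The image of a low loop based on the lower line has no upper letters. -/
theorem Good.keep_low_hl (hΨ : Good Ψ) (m : ℤ) {g : Path (pt (false, m)) (pt (false, m))}
    (hg : ∀ t, g t ∈ XE {(false, m)}ᶜ) (hlow : ∀ t, (g t).2 ≤ 9 / 8) :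
    keep low (hl {(false, m)}ᶜ (Ψ ∘ g)) = hl {(false, m)}ᶜ (Ψ ∘ g) := by
  set u := hl {(false, m)}ᶜ (Ψ ∘ g) with hu
  obtain ⟨K, hK⟩ := exists_sgz_apart u
  have hgate : IsCompact (Ψ.symm '' (({0} : Set ℝ) ×ˢ Set.Icc 1 2)) :=
    (isCompact_singleton.prod isCompact_Icc).image Ψ.symm.continuous
  obtain ⟨M, hM⟩ := hgate.isBounded.subset_ball 0
  have hgc : IsCompact (Set.range g) := isCompact_range g.continuous
  obtain ⟨N, hN⟩ := hgc.isBounded.subset_ball 0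
  obtain ⟨k, hk⟩ := exists_nat_gt (max (max (K : ℝ) (m.natAbs : ℝ)) ((M + N) * (4 / 3)))
  have hkK : K ≤ k := by
    have : (K : ℝ) < k := ((le_max_left _ _).trans (le_max_left _ _)).trans_lt hk
    exact_mod_cast this.le
  have hkm : m < k := by
    have : ((m.natAbs : ℕ) : ℝ) < k := ((le_max_right _ _).trans (le_max_left _ _)).trans_lt hk
    have : m.natAbs < k := by exact_mod_cast this
    omega
  have hkMN : (M + N) * (4 / 3) < k := (le_max_right _ _).trans_lt hk
  set E₁ := shz (-k) '' {(false, m)}ᶜ with hE₁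
  let f : I → Plane := Rpz (-k) ∘ g
  have hf : Continuous f := (Rpz (-k)).continuous.comp g.continuous
  have hfX : ∀ t, f t ∈ XE E₁ := fun t => mapsTo_XE (Rpz (-k)).injective (Rpz_pt (-k)) (hg t)
  have hf0 : f 0 = pt (false, m - k) := by
    simp only [f, Function.comp, g.source, Rpz_pt, shz_false, sub_eq_add_neg]
  have hf1 : f 1 = pt (false, m - k) := by
    simp only [f, Function.comp, g.target, Rpz_pt, shz_false, sub_eq_add_neg]
  have hE : shz k '' E₁ = {(false, m)}ᶜ := by
    rw [hE₁, Set.image_image]; simp [shz_neg_cancel]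
  have hgf : Rpz (k : ℤ) ∘ f = g := by funext t; exact Rpz_neg_cancel k (g t)
  have hcm := hΨ.comm_nat hf hfX ⟨_, hf0⟩ ⟨_, hf1⟩ k
  rw [hgf, hE, ← hu] at hcm
  have hw : hl E₁ (Ψ ∘ f) = sgz (-k) u := by
    apply (sgz k).injective
    rw [← hcm, sgz_neg_cancel]
  have hneg : ((m : ℝ) - k) < 0 := by
    have : (m : ℝ) < (k : ℤ) := by exact_mod_cast hkm
    push_cast at this
    linarith
  have hfix : ∀ t, f t = pt (false, m - k) → ((Ψ ∘ f) t).1 < 0 := fun t ht => by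
    rw [Function.comp, ht, hΨ.fix]
    simpa [pt] using hneg
  have main := keep_low_hl_of_avoid (E := E₁) (fun b => ?_) (Ψ.continuous.comp hf)
    (fun t => hΨ.mapsTo _ (hfX t)) (hfix 0 hf0) (hfix 1 hf1) (fun t ht => ?_)
    (by rw [hw]; exact hK k hkK)
  · rw [hw, keep_low_sgz] at main
    exact (sgz _).injective main
  · refine ⟨shz k (b, 0), ?_, ?_⟩
    · cases b
      · simp [shz_false]; omega
      · simp [shz_true]
    · have := shz_neg_cancel (-k) (b, 0)
      rwa [neg_neg] at this
  · by_contra! hcon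
    have h1 : f t ∈ Metric.ball (0 : Plane) M :=
      hM ⟨Ψ (f t), ⟨ht, hcon.1, hcon.2⟩, Ψ.symm_apply_apply _⟩
    have h2 : g t ∈ Metric.ball (0 : Plane) N := hN ⟨t, rfl⟩
    rw [mem_ball_plane, abs_lt, abs_lt] at h1 h2
    have h3 : (f t).1 = (g t).1 + ((-k : ℤ) : ℝ) * disp (g t).2 := rfl
    have h4 : 3 / 4 ≤ disp (g t).2 := by
      rw [disp, le_max_iff]
      right
      rw [le_min_iff]
      constructor
      · norm_num
      · linarith [hlow t]
    have hk0 : (0 : ℝ) ≤ k := k.cast_nonneg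
    push_cast at h3
    have h5 : (k : ℝ) * (3 / 4) ≤ k * disp (g t).2 := by gcongr
    have := h1.1.1
    have := h2.1.2
    simp only [Prod.fst_zero, sub_zero] at *
    linarith

/-- Low loops based on the lower line around a single puncture keep their words. -/
theorem Good.hl_stdLoop_low (hΨ : Good Ψ) {m j : ℤ} (hj : j ≠ m)
    {g : Path (pt (false, m)) (pt (false, m))} (hg : ∀ t, g t ∈ XE {(false, m)}ᶜ)
    (hgj : hl {(false, m)}ᶜ g = .of (false, j)) :
    hl {(false, m)}ᶜ (Ψ ∘ g) = .of (false, j) := by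
  have hjE : (false, j) ∈ ({(false, m)}ᶜ : Set Lab) := by simpa using hj
  have ha := pt_strip (false, m)
  have haE : pt (false, m) ∈ XE {(false, m)}ᶜ := pt_mem_XE (by simp)
  let γ := stdLoop (pt (false, m)) j (9 / 8) (-(9 / 8))
  have hγ : ∀ t, γ t ∈ XE {(false, m)}ᶜ :=
    stdLoop_mem ha haE (by norm_num) (by norm_num) (by norm_num)
  have hγj : hl {(false, m)}ᶜ γ = .of (false, j) := by
    rw [hl_stdLoop ha haE (by norm_num) (by norm_num) (by norm_num)]
    norm_num [ltr, un_mem hjE]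
  rw [hl_comp_eq hg hγ (hgj.trans hγj.symm) Ψ.continuous (hΨ.mapsTo _)]
  have h1 := hΨ.keep_low_hl m hγ (stdLoop_low (by simp [pt]) (by norm_num) (by norm_num))
  have hsub : low \ {(false, m)} ⊆ ({(false, m)}ᶜ : Set Lab) := fun i hi => hi.2
  have hjl : (false, j) ∈ low \ {(false, m)} := ⟨mem_low j, hjE⟩
  have h2 := hΨ.hl_low m (g := γ) fun t => XE_anti hsub (hγ t)
  have hc : Continuous (Ψ ∘ γ) := Ψ.continuous.comp γ.continuous
  have hX : ∀ t, (Ψ ∘ γ) t ∈ XE {(false, m)}ᶜ := fun t => hΨ.mapsTo _ (hγ t)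
  rw [hl_keep hsub hc hX, hl_keep hsub γ.continuous hγ, hγj, keep_of,
    un_mem hjl] at h2
  have h3 : ∀ v, keep (low \ {(false, m)}) v = keep low (keep {(false, m)}ᶜ v) := fun v => by
    have : (keep (low \ {(false, m)})) = (keep low).comp (keep {(false, m)}ᶜ) := by
      ext i
      by_cases h : i = (false, m)
      · simp [keep_of, un, h]
      · by_cases h' : i ∈ low
        · simp [keep_of, un, h, h']
        · simp [keep_of, un, h, h']
    rw [this]; rfl
  rwa [h3, keep_hl hc hX, h1] at h2

end Mixing

section Symmetry

open Filter Topology unitInterval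

variable {H : Type*} [Group H] {E E' : Set Lab} {Ψ : Plane ≃ₜ Plane}

/-- The rotation by a half turn about the center of the strip. -/
noncomputable def rot : Plane ≃ₜ Plane where
  toFun p := (-p.1, 3 - p.2)
  invFun p := (-p.1, 3 - p.2)
  left_inv p := by simp
  right_inv p := by simp
  continuous_toFun := by fun_prop
  continuous_invFun := by fun_prop

theorem rot_apply (p : Plane) : rot p = (-p.1, 3 - p.2) := rfl

theorem rot_rot (p : Plane) : rot (rot p) = p := by simp [rot_apply]

/-- The permutation of labels induced by the half turn. -/
def fl : Equiv.Perm Lab where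
  toFun i := (!i.1, -i.2)
  invFun i := (!i.1, -i.2)
  left_inv i := by simp
  right_inv i := by simp

theorem fl_apply (i : Lab) : fl i = (!i.1, -i.2) := rfl

theorem fl_fl (i : Lab) : fl (fl i) = i := by simp [fl_apply]

theorem fl_image_image (E : Set Lab) : fl '' (fl '' E) = E := by
  rw [Set.image_image]
  simp [fl_fl]

theorem fl_sh (i : Lab) : fl (sh i) = sh (fl i) := by
  rcases i with ⟨_ | _, n⟩ <;> simp [fl_apply, sh] <;> ring

theorem fl_sh_image (E : Set Lab) : fl '' (sh '' E) = sh '' (fl '' E) := by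
  simp [Set.image_image, fl_sh]

theorem rot_pt (i : Lab) : rot (pt i) = pt (fl i) := by
  rcases i with ⟨_ | _, n⟩ <;> norm_num [rot_apply, pt, fl_apply]

theorem rot_Rp (p : Plane) : rot (Rp p) = Rp (rot p) := by
  simp only [rot_apply, Rp_apply, disp, Prod.mk.injEq, and_true]
  rcases le_total (-1) (3 - 2 * p.2) with h | h <;> rcases le_total 1 (3 - 2 * p.2) with h' | h'
  · rw [min_eq_left h', min_eq_right (by linarith), max_eq_right (by norm_num),
      max_eq_left (by linarith)]
    ring
  · rw [min_eq_right h', min_eq_right (by linarith), max_eq_right h, max_eq_right (by linarith)]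
    ring
  · linarith
  · rw [min_eq_right h', max_eq_left h, min_eq_left (by linarith), max_eq_right (by norm_num)]
    ring

/-- The symmetry of words induced by the half turn. -/
def fg : FreeGroup Lab ≃* FreeGroup Lab := FreeGroup.freeGroupCongr fl

theorem fg_of (i : Lab) : fg (.of i) = .of (fl i) := by simp [fg]

theorem fg_sg (u : FreeGroup Lab) : fg (sg u) = sg (fg u) := by
  have : fg.toMonoidHom.comp sg.toMonoidHom = sg.toMonoidHom.comp fg.toMonoidHom := by
    ext i
    simp [fg_of, sg_of, fl_sh]
  exact DFunLike.congr_fun this u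

theorem fg_fg (u : FreeGroup Lab) : fg (fg u) = u := by
  have : fg.toMonoidHom.comp fg.toMonoidHom = MonoidHom.id _ := by
    ext i
    simp [fg_of, fl_fl]
  exact DFunLike.congr_fun this u

theorem un_fl (i : Lab) : un (fl '' E) (fl i) = fg (un E i) := by
  by_cases hi : i ∈ E
  · rw [un_mem hi, un_mem (Set.mem_image_of_mem _ hi), fg_of]
  · rw [un_notMem hi, un_notMem, map_one]
    rwa [fl.injective.mem_set_image]

theorem rot_mapsTo : Set.MapsTo rot (XE E) (XE (fl '' E)) := mapsTo_XE rot.injective rot_pt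

theorem ltr_rot {φ φ' : Lab → H} (h : ∀ i, φ' (fl i) = φ i) (m : ℤ) (y : ℝ) :
    ltr φ' (-m) (3 - y) = (ltr φ m y)⁻¹ := by
  have h1 : φ' (true, -m) = φ (false, m) := h (false, m)
  have h2 : φ' (false, -m) = φ (true, m) := h (true, m)
  simp only [ltr, h1, h2]
  split_ifs <;> first | (exfalso; linarith) | simp

theorem hol_rot {φ φ' : Lab → H} (hφ : ∀ i ∉ E, φ i = 1) (h : ∀ i, φ' (fl i) = φ i)
    {f : I → Plane} (hf : Continuous f) (hX : ∀ t, f t ∈ XE E)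
    (h0 : 1 ≤ (f 0).2 ∧ (f 0).2 ≤ 2) (h1 : 1 ≤ (f 1).2 ∧ (f 1).2 ≤ 2) :
    hol (cc φ) f = hol (cc φ') (rot ∘ f) := by
  have hφ' : ∀ i ∉ fl '' E, φ' i = 1 := fun i hi => by
    rw [← fl_fl i, h, hφ]
    intro hi'
    exact hi ⟨_, hi', fl_fl i⟩
  let κ : Plane → H := fun p => if p.1 = ⌊p.1⌋ then (ltr φ ⌊p.1⌋ p.2)⁻¹ else 1
  have hκ : ∀ p : Plane, 1 ≤ p.2 ∧ p.2 ≤ 2 → κ p = 1 := fun p hp => by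
    simp [κ, ltr, not_lt.2 hp.1, not_lt.2 hp.2]
  have key := hol_compare (isLoc_cc hφ) (isLoc_cc hφ') hf (rot.continuous.comp hf) hX
    (fun t => rot_mapsTo (hX t)) (κ := fun t => κ (f t)) fun t => ?_
  · simpa [hκ _ h0, hκ _ h1] using key
  have hc : Continuous fun t => (f t).1 := by fun_prop
  by_cases hm : ∃ m : ℤ, (f t).1 = m
  · obtain ⟨m, hm⟩ := hm
    have hn : ∀ᶠ a in 𝓝 t, (f a).1 ∈ Set.Ioo ((m : ℝ) - 1) (m + 1) :=
      hc.continuousAt (Ioo_mem_nhds (by rw [hm]; linarith) (by rw [hm]; linarith))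
    obtain ⟨r, hr0, hr, hb⟩ := exists_ball_XE (hX t)
    filter_upwards [hn, hf.continuousAt (Metric.ball_mem_nhds _ hr0)] with a ha hba
    have hL : ltr φ m (f a).2 = ltr φ m (f t).2 :=
      ltr_const hφ hr hb (by rw [hm]; simpa using hr0) hba (Metric.mem_ball_self hr0)
    have e1 : ⌊(f t).1⌋ = m := by rw [hm, Int.floor_intCast]
    have e1' : ⌊-(f t).1⌋ = -m := by rw [hm, ← Int.cast_neg, Int.floor_intCast]
    have k1 : κ (f t) = (ltr φ m (f t).2)⁻¹ := by simp only [κ, hm, Int.floor_intCast, if_true]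
    have kne : ∀ n : ℤ, (n : ℝ) < (f a).1 → (f a).1 < n + 1 → ⌊(f a).1⌋ = n ∧ κ (f a) = 1 :=
      fun n h1 h2 => by
        have e2 : ⌊(f a).1⌋ = n := Int.floor_eq_iff.2 ⟨h1.le, h2⟩
        refine ⟨e2, ?_⟩
        simp only [κ, e2]
        exact if_neg h1.ne'
    rw [k1]
    simp only [cc, Function.comp, rot_apply, e1, e1', ltr_rot h]
    rcases lt_trichotomy (f a).1 m with h1 | h1 | h1
    · obtain ⟨e2, k2⟩ := kne (m - 1) (by push_cast; exact ha.1) (by push_cast; linarith)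
      have e3 : ⌊-(f a).1⌋ = -m := by
        rw [Int.floor_eq_iff]; push_cast; constructor <;> linarith [ha.1]
      rw [k2, e2, e3]
      simp [show m - 1 ≠ m + 1 by omega]
    · have e2 : ⌊(f a).1⌋ = m := by rw [h1, Int.floor_intCast]
      have e3 : ⌊-(f a).1⌋ = -m := by rw [h1, ← Int.cast_neg, Int.floor_intCast]
      have k2 : κ (f a) = (ltr φ m (f a).2)⁻¹ := by simp only [κ, h1, Int.floor_intCast, if_true]
      rw [k2, e2, e3, hL]
      simp
    · obtain ⟨e2, k2⟩ := kne m h1 ha.2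
      have e3 : ⌊-(f a).1⌋ = -m - 1 := by
        rw [Int.floor_eq_iff]; push_cast; constructor <;> linarith [ha.2]
      rw [k2, e2, e3]
      simp [show -m - 1 ≠ -m + 1 by omega]
  · have h1 : ((⌊(f t).1⌋ : ℤ) : ℝ) < (f t).1 :=
      lt_of_le_of_ne (Int.floor_le _) fun h => hm ⟨_, h.symm⟩
    have hn : ∀ᶠ a in 𝓝 t, (f a).1 ∈ Set.Ioo (⌊(f t).1⌋ : ℝ) (⌊(f t).1⌋ + 1) :=
      hc.continuousAt (Ioo_mem_nhds h1 (Int.lt_floor_add_one _))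
    filter_upwards [hn] with a ha
    have e2 : ⌊(f a).1⌋ = ⌊(f t).1⌋ := Int.floor_eq_iff.2 ⟨ha.1.le, ha.2⟩
    have e3 : ∀ x ∈ Set.Ioo (⌊(f t).1⌋ : ℝ) (⌊(f t).1⌋ + 1), ⌊-x⌋ = -⌊(f t).1⌋ - 1 :=
      fun x hx => by rw [Int.floor_eq_iff]; push_cast; constructor <;> linarith [hx.1, hx.2]
    have k1 : κ (f t) = 1 := if_neg h1.ne'
    have k2 : κ (f a) = 1 := if_neg (by rw [e2]; exact ha.1.ne')
    rw [k1, k2]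
    simp [cc, rot_apply, e2, e3 _ ha, e3 _ ⟨h1, Int.lt_floor_add_one _⟩]

theorem hl_rot {f : I → Plane} (hf : Continuous f) (hX : ∀ t, f t ∈ XE E)
    (h0 : ∃ i, f 0 = pt i) (h1 : ∃ i, f 1 = pt i) : hl (fl '' E) (rot ∘ f) = fg (hl E f) := by
  obtain ⟨i, hi⟩ := h0
  obtain ⟨j, hj⟩ := h1
  rw [hl, hl]
  have := hol_map (isLoc_un E) hf hX fg.toMonoidHom
  refine Eq.trans ?_ this
  rw [← hol_rot (φ := fun i => fg (un E i)) (E := E) (fun i hi => by rw [un_notMem hi, map_one])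
    un_fl hf hX (hi ▸ pt_strip i) (hj ▸ pt_strip j)]
  congr 1
  funext p q
  exact cc_map fg.toMonoidHom _ _ _

/-- The conjugate by the half turn. -/
noncomputable def rotConj (Ψ : Plane ≃ₜ Plane) : Plane ≃ₜ Plane := rot.trans (Ψ.trans rot)

theorem rotConj_apply (p : Plane) : rotConj Ψ p = rot (Ψ (rot p)) := rfl

theorem hl_rotConj (hm : ∀ i, Ψ (pt i) = pt i) {g : I → Plane}
    (hg : Continuous g) (hX : ∀ t, g t ∈ XE E) (h0 : ∃ i, g 0 = pt i) (h1 : ∃ i, g 1 = pt i) :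
    hl E (rotConj Ψ ∘ g) = fg (hl (fl '' E) (Ψ ∘ (rot ∘ g))) := by
  obtain ⟨i, hi⟩ := h0
  obtain ⟨j, hj⟩ := h1
  have := hl_rot (E := fl '' E) (f := Ψ ∘ (rot ∘ g))
    (Ψ.continuous.comp (rot.continuous.comp hg))
    (fun t => mapsTo_XE_of_fix Ψ.injective (fun i _ => hm i) (rot_mapsTo (hX t)))
    ⟨fl i, by simp [hi, rot_pt, hm]⟩ ⟨fl j, by simp [hj, rot_pt, hm]⟩
  rwa [fl_image_image] at this

theorem Good.rotConj (hΨ : Good Ψ) : Good (rotConj Ψ) where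
  fix i := by rw [rotConj_apply, rot_pt, hΨ.fix, rot_pt, fl_fl]
  iso := by
    obtain ⟨F, hF, hFh, hF0, hF1⟩ := hΨ.iso
    refine ⟨fun z => rot (F (z.1, rot z.2)), ?_, fun t => ?_, fun x => ?_, fun x => ?_⟩
    · exact rot.continuous.comp (hF.comp (continuous_fst.prodMk
        (rot.continuous.comp continuous_snd)))
    · obtain ⟨e, he⟩ := hFh t
      exact ⟨rot.trans (e.trans rot), fun x => by simp [he]⟩
    · simp [hF0, rot_rot]
    · simp [hF1, rotConj_apply]
  comm E g hg hX := by
    rintro ⟨i, hi⟩ ⟨j, hj⟩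
    rw [hl_rotConj hΨ.fix (Rp.continuous.comp hg) (fun t => mapsTo_XE Rp.injective Rp_pt (hX t))
      ⟨_, by rw [Function.comp, hi, Rp_pt]⟩ ⟨_, by rw [Function.comp, hj, Rp_pt]⟩,
      hl_rotConj hΨ.fix hg hX ⟨i, hi⟩ ⟨j, hj⟩, fl_sh_image, ← fg_sg,
      ← hΨ.comm _ _ (rot.continuous.comp hg) (fun t => rot_mapsTo (hX t))
      ⟨fl i, by simp [hi, rot_pt]⟩ ⟨fl j, by simp [hj, rot_pt]⟩]
    congr 2
    funext t
    simp [rot_Rp]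

/-- Loops around a single puncture on the line of their base point keep their words. -/
theorem Good.hl_same (hΨ : Good Ψ) {p q : Lab} (hpq : q ≠ p) (hs : q.1 = p.1)
    {g : Path (pt p) (pt p)} (hg : ∀ t, g t ∈ XE {p}ᶜ) (hgq : hl {p}ᶜ g = .of q) :
    hl {p}ᶜ (Ψ ∘ g) = .of q := by
  obtain ⟨b, m⟩ := p
  obtain ⟨b', j⟩ := q
  obtain rfl : b' = b := hs
  cases b'
  · exact hΨ.hl_stdLoop_low (fun h => hpq (by rw [h])) hg hgq
  · have him : fl '' ({(true, m)}ᶜ) = {(false, -m)}ᶜ := by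
      rw [Set.image_compl_eq fl.bijective, Set.image_singleton]; rfl
    have e1 : rot (pt (true, m)) = pt (false, -m) := rot_pt _
    let g' : Path (pt (false, -m)) (pt (false, -m)) := (g.map rot.continuous).cast e1.symm e1.symm
    have hg' : ∀ t, g' t ∈ XE {(false, -m)}ᶜ := fun t => by
      rw [← him]; exact rot_mapsTo (hg t)
    have h1 := hΨ.rotConj.hl_stdLoop_low (m := -m) (j := -j)
      (fun h => hpq (by rw [neg_inj.1 h])) hg' (by
        have := hl_rot g.continuous hg ⟨_, g.source⟩ ⟨_, g.target⟩
        rw [him, hgq, fg_of] at this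
        exact this)
    rw [hl_rotConj hΨ.fix g'.continuous hg' ⟨_, g'.source⟩ ⟨_, g'.target⟩, ← him,
      fl_image_image] at h1
    have h2 : Ψ ∘ (rot ∘ g') = Ψ ∘ g := by
      funext t
      exact congrArg Ψ (rot_rot (g t))
    rw [h2] at h1
    have h3 := congrArg fg h1
    rw [fg_fg, fg_of] at h3
    simpa [fl_apply] using h3

end Symmetry

section Triviality

open Filter Topology unitInterval

variable {E E' Q : Set Lab} {Ψ : Plane ≃ₜ Plane}

theorem keep_inter (A B : Set Lab) (u : FreeGroup Lab) : keep A (keep B u) = keep (A ∩ B) u := by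
  have : (keep A).comp (keep B) = keep (A ∩ B) := by
    ext i
    by_cases hA : i ∈ A <;> by_cases hB : i ∈ B <;> simp [keep_of, un, hA, hB]
  exact DFunLike.congr_fun this u

theorem keep_eq_of_subset {A B : Set Lab} (h : A ⊆ B) {u : FreeGroup Lab} (hu : keep A u = u) :
    keep B u = u := by rw [← hu, keep_keep' h]

theorem keep_empty (u : FreeGroup Lab) : keep ∅ u = 1 := by
  have : keep ∅ = 1 := by ext i; simp [keep_of, un]
  exact DFunLike.congr_fun this u

theorem sgz_keep (k : ℤ) (A : Set Lab) (u : FreeGroup Lab) :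
    sgz k (keep A u) = keep (shz k '' A) (sgz k u) := by
  have : (sgz k).toMonoidHom.comp (keep A) = (keep (shz k '' A)).comp (sgz k).toMonoidHom := by
    ext i
    have h : shz k i ∈ shz k '' A ↔ i ∈ A := (shz k).injective.mem_set_image
    by_cases hi : i ∈ A
    · simp [keep_of, sgz_of, un_mem hi, un_mem (h.2 hi)]
    · simp [keep_of, sgz_of, un_notMem hi, un_notMem (mt h.1 hi)]
  exact DFunLike.congr_fun this u

/-- The labels with bounded abscissa. -/
def bdd (N : ℕ) : Set Lab := {i | i.2.natAbs ≤ N}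

theorem mem_bdd {N : ℕ} {i : Lab} : i ∈ bdd N ↔ i.2.natAbs ≤ N := Iff.rfl

theorem bdd_mono {M N : ℕ} (h : M ≤ N) : bdd M ⊆ bdd N := fun _ hi => le_trans hi h

theorem exists_bdd (u : FreeGroup Lab) : ∃ N, keep (bdd N) u = u := by
  induction u using FreeGroup.induction_on with
  | C1 => exact ⟨0, map_one _⟩
  | of i => exact ⟨i.2.natAbs, by rw [keep_of, un_mem (mem_bdd.2 le_rfl)]⟩
  | inv_of i h =>
    obtain ⟨N, h⟩ := h
    exact ⟨N, by rw [map_inv, h]⟩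
  | mul x y hx hy =>
    obtain ⟨M, hM⟩ := hx
    obtain ⟨N, hN⟩ := hy
    exact ⟨max M N, by rw [map_mul, keep_eq_of_subset (bdd_mono (le_max_left _ _)) hM,
      keep_eq_of_subset (bdd_mono (le_max_right _ _)) hN]⟩

theorem link_mem_of {p q : Lab} (hp : p ∉ E) (hq : q ∉ E) (t : I) : link (pt p) (pt q) t ∈ XE E :=
  (link_mem (pt_strip p) (pt_mem_XE hp) (pt_strip q) (pt_mem_XE hq) t).1

theorem hl_link_pt (p q : Lab) : hl E (link (pt p) (pt q)) = 1 := hl_link (pt_strip p) (pt_strip q)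

theorem Good.hl_of (hΨ : Good Ψ) {p q : Lab} (hp : p ∉ Q) (hq : q ∈ Q)
    (h : ∀ g : Path (pt p) (pt p), (∀ t, g t ∈ XE {p}ᶜ) → hl {p}ᶜ g = .of q →
      hl {p}ᶜ (Ψ ∘ g) = .of q)
    {g : Path (pt p) (pt p)} (hg : ∀ t, g t ∈ XE Q) (hgq : hl Q g = .of q) :
    hl Q (Ψ ∘ g) = .of q := by
  have hsub : Q ⊆ {p}ᶜ := fun i hi e => hp (e ▸ hi)
  obtain ⟨γ, hγ, e⟩ := exists_loop (pt_strip p) (pt_mem_XE (E := {p}ᶜ) (by simp)) (.of q)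
  rw [keep_of, un_mem (hsub hq)] at e
  have hγ' : ∀ t, γ t ∈ XE Q := fun t => XE_anti hsub (hγ t)
  have e' : hl Q γ = .of q := by
    rw [hl_keep hsub γ.continuous hγ, e, keep_of, un_mem hq]
  rw [hl_comp_eq hg hγ' (hgq.trans e'.symm) Ψ.continuous (hΨ.mapsTo Q),
    hl_keep hsub (Ψ.continuous.comp γ.continuous) fun t => hΨ.mapsTo _ (hγ t), h γ hγ e, keep_of,
    un_mem hq]

/-- Comparison of the images of loops at two base points. -/
theorem Good.hl_conj_link (hΨ : Good Ψ) {p p' q : Lab} (hp : p ∉ Q) (hp' : p' ∉ Q) (hq : q ∈ Q)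
    (hs : q.1 = p'.1) {g : Path (pt p) (pt p)} (hg : ∀ t, g t ∈ XE Q) (hgq : hl Q g = .of q) :
    hl Q (Ψ ∘ g) = hl Q (Ψ ∘ link (pt p) (pt p')) * .of q *
      (hl Q (Ψ ∘ link (pt p) (pt p')))⁻¹ := by
  obtain ⟨γ, hγ, e⟩ := exists_loop (pt_strip p') (pt_mem_XE hp') (.of q)
  rw [keep_of, un_mem hq] at e
  have hs1 := link_mem_of hp hp'
  have h1 := hl_conj continuous_id (Set.mapsTo_id (XE Q)) hs1 hγ
  rw [Function.id_comp, Function.id_comp, Function.id_comp, hl_link_pt, e, one_mul, inv_one,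
    mul_one] at h1
  have hmem := trans_mem (X := XE Q) (γ' := (link (pt p) (pt p')).symm)
    (trans_mem (X := XE Q) hs1 hγ) fun t => hs1 _
  rw [hl_comp_eq hg hmem (hgq.trans h1.symm) Ψ.continuous (hΨ.mapsTo Q),
    hl_conj Ψ.continuous (hΨ.mapsTo Q) hs1 hγ,
    hΨ.hl_of hp' hq (fun g hg h => hΨ.hl_same (fun e : q = p' => hp' (e ▸ hq)) hs hg h) hγ e]

theorem Good.hl_link_same (hΨ : Good Ψ) {p p' : Lab} (hs : p.1 = p'.1) :
    hl {p, p'}ᶜ (Ψ ∘ link (pt p) (pt p')) = 1 := by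
  have key : ∀ q : Lab, q.1 = p.1 → q ≠ p → q ≠ p' →
      Commute (hl {p, p'}ᶜ (Ψ ∘ link (pt p) (pt p'))) (.of q) := by
    intro q hq h h'
    have hqQ : q ∈ ({p, p'}ᶜ : Set Lab) := by simp [h, h']
    have hpQ : p ∉ ({p, p'}ᶜ : Set Lab) := by simp
    obtain ⟨g, hg, e⟩ := exists_loop (pt_strip p) (pt_mem_XE hpQ) (.of q)
    rw [keep_of, un_mem hqQ] at e
    have h1 := hΨ.hl_conj_link hpQ (p' := p') (by simp) hqQ (hq.trans hs) hg e
    rw [hΨ.hl_of hpQ hqQ (fun g hg e => hΨ.hl_same h hq hg e) hg e] at h1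
    exact (eq_mul_inv_iff_mul_eq.1 h1).symm
  have far : ∀ n : ℤ, 0 < n → Commute (hl {p, p'}ᶜ (Ψ ∘ link (pt p) (pt p')))
      (.of (p.1, p.2.natAbs + p'.2.natAbs + n)) := by
    refine fun n hn => key _ rfl ?_ ?_ <;>
    · rw [Ne, Prod.ext_iff]
      simp only [not_and]
      intro _
      omega
  refine eq_one_of_commute ?_ (far 1 (by norm_num)) (far 2 (by norm_num))
  simp

theorem Good.hl_link_trans (hΨ : Good Ψ) {p p' r r' : Lab} (hp : p ∉ Q) (hp' : p' ∉ Q)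
    (hr : r ∉ Q) (hr' : r' ∉ Q) (h : p.1 = r.1) (h' : p'.1 = r'.1) :
    hl Q (Ψ ∘ link (pt r) (pt r')) = hl Q (Ψ ∘ link (pt p) (pt p')) := by
  have triv : ∀ {a b : Lab}, a ∉ Q → b ∉ Q → a.1 = b.1 → hl Q (Ψ ∘ link (pt a) (pt b)) = 1 := by
    intro a b ha hb hab
    have hQ : Q ⊆ ({a, b}ᶜ : Set Lab) := by
      intro i hi
      rintro (rfl | rfl)
      · exact ha hi
      · exact hb hi
    rw [hl_keep hQ (Ψ.continuous.comp (link _ _).continuous) fun t =>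
      hΨ.mapsTo _ (link_mem_of (by simp) (by simp) t), hΨ.hl_link_same hab, map_one]
  have m1 := link_mem_of hr hp
  have m2 := link_mem_of hp hp'
  have m3 := link_mem_of hp' hr'
  have m12 := trans_mem (X := XE Q) m1 m2
  have m := trans_mem (X := XE Q) m12 m3
  have M := hΨ.mapsTo Q
  rw [hl_comp_eq (link_mem_of hr hr') m ?_ Ψ.continuous M,
    hl_comp_trans _ _ Ψ.continuous (fun t => M (m12 t)) fun t => M (m3 t),
    hl_comp_trans _ _ Ψ.continuous (fun t => M (m1 t)) fun t => M (m2 t),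
    triv hr hp h.symm, triv hp' hr' h', one_mul, mul_one]
  rw [hl_trans _ _ m12 m3, hl_trans _ _ m1 m2]
  simp [hl_link_pt]

theorem Good.hl_link_eq_one (hΨ : Good Ψ) {p p' : Lab} :
    hl {p, p'}ᶜ (Ψ ∘ link (pt p) (pt p')) = 1 := by
  set Q : Set Lab := {p, p'}ᶜ with hQ
  set u := hl Q (Ψ ∘ link (pt p) (pt p')) with hu
  have hlm := link_mem_of (E := Q) (p := p) (q := p') (by simp [hQ]) (by simp [hQ])
  have huc : Continuous (Ψ ∘ link (pt p) (pt p')) := Ψ.continuous.comp (link _ _).continuous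
  have huX : ∀ t, (Ψ ∘ link (pt p) (pt p')) t ∈ XE Q := fun t => hΨ.mapsTo _ (hlm t)
  have huQ : keep Q u = u := keep_hl huc huX
  obtain ⟨M, hM⟩ := exists_bdd u
  obtain ⟨N, hN, hpN, hpN'⟩ : ∃ N, keep (bdd N) u = u ∧ p ∈ bdd N ∧ p' ∈ bdd N :=
    ⟨M + p.2.natAbs + p'.2.natAbs, keep_eq_of_subset (bdd_mono (by omega)) hM,
      mem_bdd.2 (by omega), mem_bdd.2 (by omega)⟩
  let k : ℕ := 2 * N + 1
  have hout : ∀ i ∈ bdd N, shz k i ∉ bdd N := by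
    rintro ⟨_ | _, n⟩ h1 h2
    · rw [shz_false] at h2
      simp only [bdd, Set.mem_ofPred_eq, k] at h1 h2
      omega
    · rw [shz_true] at h2
      simp only [bdd, Set.mem_ofPred_eq, k] at h1 h2
      omega
  let Q' : Set Lab := shz k '' Q
  have hQ' : Q' = {shz k p, shz k p'}ᶜ := by
    rw [← Set.image_pair (shz k), ← Set.image_compl_eq (shz k).bijective]
  let Q'' : Set Lab := Q ∩ Q'
  have e1 : hl Q' (Ψ ∘ link (pt (shz k p)) (pt (shz k p'))) = sgz k u := by
    rw [hu, ← hΨ.comm_nat (link (pt p) (pt p')).continuous hlm ⟨p, Path.source _⟩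
      ⟨p', Path.target _⟩ k]
    have hR : ∀ t, Rpz k (link (pt p) (pt p') t) ∈ XE Q' := fun t =>
      mapsTo_XE (Rpz k).injective (Rpz_pt k) (hlm t)
    let γ : Path (pt (shz k p)) (pt (shz k p')) :=
      ((link (pt p) (pt p')).map (Rpz k).continuous).cast (Rpz_pt k p).symm (Rpz_pt k p').symm
    have hγ : hl Q' γ = 1 := hl_strip fun t =>
      (link_mem (E := ∅) (pt_strip p) (pt_mem_XE (by simp)) (pt_strip p')
        (pt_mem_XE (by simp)) t).2
    exact hl_comp_eq (γ' := γ)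
      (link_mem_of (by simp [hQ']) (by simp [hQ'])) hR ((hl_link_pt _ _).trans hγ.symm)
      Ψ.continuous (hΨ.mapsTo Q')
  have e2 : keep Q'' (sgz k u) = keep Q'' u := by
    have n1 : shz k p ∉ Q' := by simp [hQ']
    have n2 : shz k p' ∉ Q' := by simp [hQ']
    have n3 : p ∉ Q := by simp [hQ]
    have n4 : p' ∉ Q := by simp [hQ]
    rw [← e1, ← hl_keep (E := Q'') (E' := Q') Set.inter_subset_right
      (Ψ.continuous.comp (link _ _).continuous) fun t => hΨ.mapsTo _ (link_mem_of n1 n2 t),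
      ← hl_keep (E := Q'') (E' := Q) Set.inter_subset_left huc huX]
    exact hΨ.hl_link_trans (fun h => n3 h.1) (fun h => n4 h.1) (fun h => n1 h.2)
      (fun h => n2 h.2) rfl rfl
  have e3 : keep (Q ∩ bdd N) u = u := by rw [← keep_inter, hN, huQ]
  have e4 : keep Q'' u = u := by
    have hsub : Q ∩ bdd N ⊆ Q'' := by
      rintro i ⟨h1, h2⟩
      refine ⟨h1, ?_⟩
      rw [hQ']
      rintro (rfl | rfl)
      · exact hout _ hpN h2
      · exact hout _ hpN' h2
    exact keep_eq_of_subset hsub e3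
  have e5 : keep (shz k '' (Q ∩ bdd N)) (sgz k u) = sgz k u := by rw [← sgz_keep, e3]
  have e6 : keep Q'' (sgz k u) = sgz k u := by
    refine keep_eq_of_subset ?_ e5
    rintro _ ⟨i, hi, rfl⟩
    refine ⟨?_, _, hi.1, rfl⟩
    rintro (h | h)
    · exact hout _ hi.2 (h ▸ hpN)
    · exact hout _ hi.2 (h ▸ hpN')
  have e7 : keep (bdd N)ᶜ (sgz k u) = sgz k u := by
    refine keep_eq_of_subset ?_ e5
    rintro _ ⟨i, hi, rfl⟩
    exact hout _ hi.2
  rw [e4, e6] at e2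
  rw [← hN, ← e2, ← e7, keep_inter, Set.inter_compl_self, keep_empty]

theorem Good.hl_letter (hΨ : Good Ψ) {p j : Lab} (hj : j ≠ p) {g : Path (pt p) (pt p)}
    (hg : ∀ t, g t ∈ XE {p}ᶜ) (hgj : hl {p}ᶜ g = .of j) : hl {p}ᶜ (Ψ ∘ g) = .of j := by
  set u := hl {p}ᶜ (Ψ ∘ g) with hu
  have huc : Continuous (Ψ ∘ g) := Ψ.continuous.comp g.continuous
  have huX : ∀ t, (Ψ ∘ g) t ∈ XE {p}ᶜ := fun t => hΨ.mapsTo _ (hg t)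
  obtain ⟨N, hN⟩ := exists_bdd u
  let q : Lab := (j.1, N + j.2.natAbs + p.2.natAbs + 1)
  have hqj : j ≠ q := fun h => by
    have : j.2 = N + j.2.natAbs + p.2.natAbs + 1 := congrArg Prod.snd h
    omega
  have hqN : q ∉ bdd N := fun h => by
    simp only [bdd, q, Set.mem_ofPred_eq] at h
    omega
  let Q : Set Lab := {p, q}ᶜ
  have hsub : Q ⊆ {p}ᶜ := fun i hi e => hi (Or.inl e)
  have hjQ : j ∈ Q := by simp [Q, hj, hqj]
  have e1 : hl Q g = .of j := by rw [hl_keep hsub g.continuous hg, hgj, keep_of, un_mem hjQ]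
  have e2 := hΨ.hl_conj_link (Q := Q) (p := p) (p' := q) (by simp [Q]) (by simp [Q]) hjQ rfl
    (fun t => XE_anti hsub (hg t)) e1
  rw [hΨ.hl_link_eq_one, one_mul, inv_one, mul_one, hl_keep hsub huc huX, ← hu] at e2
  rw [← e2]
  have hup : keep {p}ᶜ u = u := keep_hl huc huX
  have e3 : keep ({p}ᶜ ∩ bdd N) u = u := by rw [← keep_inter, hN, hup]
  refine (keep_eq_of_subset (fun i hi => ?_) e3).symm
  rintro (rfl | rfl)
  · exact hi.1 rfl
  · exact hqN hi.2

/-- A homeomorphism commuting with the Reeb class and fixing the punctures acts trivially on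
words. -/
theorem Good.hl_eq (hΨ : Good Ψ) {p : Lab} (hp : p ∉ Q) {g : Path (pt p) (pt p)}
    (hg : ∀ t, g t ∈ XE Q) : hl Q (Ψ ∘ g) = hl Q g := by
  obtain ⟨α, h1, -, -, h2⟩ := hΨ.exists_act hp
  have : α = keep Q := by
    ext i
    by_cases hi : i ∈ Q
    · obtain ⟨γ, hγ, e⟩ := exists_loop (pt_strip p) (pt_mem_XE hp) (.of i)
      rw [keep_of, un_mem hi] at e
      rw [← e, ← h2 γ hγ, e, keep_of, un_mem hi]
      exact hΨ.hl_of hp hi (fun g hg h => hΨ.hl_letter (fun e : i = p => hp (e ▸ hi)) hg h) hγ e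
    · rw [← h1, keep_of, un_notMem hi, map_one]
  rw [h2 g hg, this, keep_hl g.continuous hg]

end Triviality

section Push

open Filter Topology unitInterval

theorem IsHomeoFun.comp {f g : Plane → Plane} (hf : IsHomeoFun f) (hg : IsHomeoFun g) :
    IsHomeoFun (f ∘ g) := by
  obtain ⟨e, he⟩ := hf
  obtain ⟨e', he'⟩ := hg
  exact ⟨e'.trans e, fun x => by simp [he, he']⟩

theorem IsHomeoFun.bijective {f : Plane → Plane} (hf : IsHomeoFun f) : Function.Bijective f := by
  obtain ⟨e, he⟩ := hf
  rw [show f = e from funext fun x => (he x).symm]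
  exact e.bijective

theorem isHomeoFun_id : IsHomeoFun fun x => x := ⟨Homeomorph.refl _, fun _ => rfl⟩

/-- `F` is an isotopy from the identity to `f`. -/
structure Isot (F : I × Plane → Plane) (f : Plane → Plane) : Prop where
  cont : Continuous F
  homeo : ∀ t, IsHomeoFun fun x => F (t, x)
  zero : ∀ x, F (0, x) = x
  one : ∀ x, F (1, x) = f x

theorem Isot.comp {F G : I × Plane → Plane} {f g : Plane → Plane} (hG : Isot G g) (hF : Isot F f) :
    Isot (fun z => G (z.1, F z)) (g ∘ f) where
  cont := hG.cont.comp (continuous_fst.prodMk hF.cont)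
  homeo t := (hG.homeo t).comp (hF.homeo t)
  zero x := by rw [hF.zero, hG.zero]
  one x := by rw [hF.one, hG.one]; rfl

/-- `H` is an isotopy from the identity to itself fixing the complement of `W`. -/
structure SuppIn (W : Set Plane) (H : I × Plane → Plane) : Prop extends Isot H id where
  off : ∀ t, ∀ x ∉ W, H (t, x) = x

variable {W : Set Plane}

theorem suppIn_snd (W : Set Plane) : SuppIn W fun z => z.2 where
  cont := continuous_snd
  homeo _ := isHomeoFun_id
  zero _ := rfl
  one _ := rfl
  off _ _ _ := rfl

theorem SuppIn.comp {H H' : I × Plane → Plane} (h : SuppIn W H) (h' : SuppIn W H') :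
    SuppIn W fun z => H (z.1, H' z) where
  toIsot := h.toIsot.comp h'.toIsot
  off t x hx := by rw [h'.off t x hx, h.off t x hx]

theorem SuppIn.mono {W' : Set Plane} {H : I × Plane → Plane} (h : SuppIn W H) (hW : W ⊆ W') :
    SuppIn W' H where
  toIsot := h.toIsot
  off t x hx := h.off t x fun h' => hx (hW h')

theorem SuppIn.mem_iff {H : I × Plane → Plane} (h : SuppIn W H) (t : I) (x : Plane) :
    H (t, x) ∈ W ↔ x ∈ W := by
  constructor
  · intro hx
    by_contra hn
    exact hn (h.off t x hn ▸ hx)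
  · intro hx
    by_contra hn
    have : H (t, x) = x := (h.homeo t).bijective.1 (h.off t _ hn)
    exact hn (this.symm ▸ hx)

/-- The cone shaped bump of radius `r` about `a`. -/
noncomputable def bump (r : ℝ) (a x : Plane) : ℝ := max 0 (1 - dist x a / r)

theorem abs_bump_sub {r : ℝ} (hr : 0 < r) (a x y : Plane) :
    |bump r a x - bump r a y| ≤ dist x y / r := by
  have h := abs_max_sub_max_le_abs (1 - dist x a / r) (1 - dist y a / r) 0
  rw [max_comm _ 0, max_comm _ 0] at h
  refine h.trans ?_
  rw [show 1 - dist x a / r - (1 - dist y a / r) = (dist y a - dist x a) / r by ring, abs_div,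
    abs_of_pos hr, dist_comm x y]
  gcongr
  exact abs_dist_sub_le y x a

theorem continuous_bump (r : ℝ) : Continuous fun z : Plane × Plane => bump r z.1 z.2 :=
  continuous_const.max (continuous_const.sub ((continuous_snd.dist continuous_fst).div_const r))

theorem bump_self (r : ℝ) (a : Plane) : bump r a a = 1 := by simp [bump]

theorem bump_eq_zero {r : ℝ} (hr : 0 < r) {a x : Plane} (h : r ≤ dist x a) : bump r a x = 0 := by
  rw [bump, max_eq_left]
  rw [sub_nonpos, le_div_iff₀ hr]
  linarith

theorem isHomeoFun_bump {r : ℝ} (hr : 0 < r) (a : Plane) {v : Plane} (hv : ‖v‖ ≤ r / 2) :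
    IsHomeoFun fun x => x + bump r a x • v := by
  let c : NNReal := 1 / 2
  have hf : ApproximatesLinearOn (fun x : Plane => x + bump r a x • v)
      ((ContinuousLinearEquiv.refl ℝ Plane : Plane ≃L[ℝ] Plane) : Plane →L[ℝ] Plane) Set.univ c := by
    intro x _ y _
    simp only [ContinuousLinearEquiv.coe_refl, ContinuousLinearMap.coe_id', id_eq]
    rw [show x + bump r a x • v - (y + bump r a y • v) - (x - y) = (bump r a x - bump r a y) • v by
      rw [sub_smul]; abel, norm_smul, Real.norm_eq_abs, ← dist_eq_norm x y]
    calc _ ≤ dist x y / r * (r / 2) := by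
          gcongr
          exact abs_bump_sub hr a x y
      _ = (c : ℝ) * dist x y := by
          simp only [c, NNReal.coe_div, NNReal.coe_one, NNReal.coe_ofNat]
          field_simp
  refine ⟨hf.toHomeomorph _ (Or.inr ?_), fun x => rfl⟩
  have h1 : ‖((ContinuousLinearEquiv.refl ℝ Plane).symm : Plane →L[ℝ] Plane)‖₊ = 1 := by
    rw [← NNReal.coe_inj]
    exact ContinuousLinearMap.norm_id
  rw [h1, inv_one]
  exact NNReal.half_lt_self one_ne_zero

theorem exists_push_step {r : ℝ} (hr : 0 < r) {p : Plane} {α β : I → Plane} (hα : Continuous α)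
    (hβ : Continuous β) (h0 : α 0 = p ∧ β 0 = p) (h1 : α 1 = p ∧ β 1 = p)
    (hd : ∀ t, dist (β t) (α t) ≤ r / 2) (hW : ∀ t, Metric.ball (α t) r ⊆ W) :
    ∃ H, SuppIn W H ∧ ∀ t, H (t, α t) = β t := by
  let H : I × Plane → Plane := fun z => z.2 + bump r (α z.1) z.2 • (β z.1 - α z.1)
  refine ⟨H, ⟨⟨?_, fun t => ?_, fun x => ?_, fun x => ?_⟩, fun t x hx => ?_⟩, fun t => ?_⟩
  · have c3 : Continuous fun z : I × Plane => bump r (α z.1) z.2 :=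
      (continuous_bump r).comp ((hα.comp continuous_fst).prodMk continuous_snd)
    have c4 : Continuous fun z : I × Plane => β z.1 - α z.1 :=
      (hβ.comp continuous_fst).sub (hα.comp continuous_fst)
    have c5 : Continuous fun z : I × Plane => bump r (α z.1) z.2 • (β z.1 - α z.1) := c3.smul c4
    exact continuous_snd.add c5
  · have hv : ‖β t - α t‖ ≤ r / 2 := (dist_eq_norm (β t) (α t)).symm.trans_le (hd t)
    exact isHomeoFun_bump hr (α t) hv
  · simp [H, h0.1, h0.2]
  · simp [H, h1.1, h1.2]
  · have : r ≤ dist x (α t) := by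
      by_contra! h
      exact hx (hW t h)
    simp [H, bump_eq_zero hr this]
  · simp [H, bump_self]

/-- A null homotopy in an open set is undone by an isotopy supported in that set. -/
theorem exists_push (hW : IsOpen W) {p : Plane} {K : I × I → Plane} (hK : Continuous K)
    (hKW : ∀ z, K z ∈ W) (h1 : ∀ t, K (1, t) = p) (hl : ∀ s, K (s, 0) = p)
    (hr : ∀ s, K (s, 1) = p) :
    ∃ H, SuppIn W H ∧ ∀ t, H (t, K (0, t)) = p := by
  obtain ⟨r, hr0, hrW⟩ := (isCompact_range hK).exists_thickening_subset_open hW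
    (Set.range_subset_iff.2 hKW)
  have hball : ∀ z, Metric.ball (K z) r ⊆ W := fun z =>
    (Metric.ball_subset_thickening (Set.mem_range_self z) r).trans hrW
  obtain ⟨δ, hδ, hu⟩ := Metric.uniformContinuous_iff.1
    (CompactSpace.uniformContinuous_of_continuous hK) (r / 2) (by positivity)
  have step : ∀ s s' : I, dist s s' < δ →
      ∃ H, SuppIn W H ∧ ∀ t, H (t, K (s, t)) = K (s', t) := by
    intro s s' hs
    refine exists_push_step hr0 (p := p) (hK.comp (Continuous.prodMk_right s))
      (hK.comp (Continuous.prodMk_right s')) ⟨hl _, hl _⟩ ⟨hr _, hr _⟩ (fun t => ?_)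
      fun t => hball _
    refine (hu (a := (s', t)) (b := (s, t)) ?_).le
    rw [Prod.dist_eq, dist_self, max_eq_left dist_nonneg, dist_comm]
    exact hs
  obtain ⟨N, hN⟩ := exists_nat_one_div_lt hδ
  let τ : ℕ → I := fun n => Set.projIcc 0 1 zero_le_one ((n : ℝ) / (N + 1))
  have hN0 : (0 : ℝ) < N + 1 := by positivity
  have hτ : ∀ n, dist (τ n) (τ (n + 1)) < δ := by
    intro n
    refine lt_of_le_of_lt ?_ hN
    refine (LipschitzWith.projIcc (zero_le_one (α := ℝ))).dist_le_mul _ _ |>.trans ?_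
    rw [NNReal.coe_one, one_mul, Real.dist_eq, Nat.cast_succ, ← sub_div,
      show (n : ℝ) - (n + 1) = -1 by ring, abs_div, abs_neg, abs_one, abs_of_pos hN0]
  have key : ∀ n, ∃ H, SuppIn W H ∧ ∀ t, H (t, K (0, t)) = K (τ n, t) := by
    intro n
    induction n with
    | zero =>
      refine ⟨_, suppIn_snd W, fun t => ?_⟩
      simp [τ]
    | succ n ih =>
      obtain ⟨H, hH, e⟩ := ih
      obtain ⟨H', hH', e'⟩ := step _ _ (hτ n)
      exact ⟨_, hH'.comp hH, fun t => by simp only [e, e']⟩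
  obtain ⟨H, hH, e⟩ := key (N + 1)
  refine ⟨H, hH, fun t => ?_⟩
  rw [e, ← h1 t]
  congr 2
  simp only [τ, Nat.cast_succ, div_self hN0.ne']
  exact Set.projIcc_right (h := zero_le_one)

end Push

section Annuli

open Filter Topology unitInterval

variable {F : I × Plane → Plane} {Ψ : Plane ≃ₜ Plane} {Q : Set Lab}

theorem Isot.null (hF : Isot F Ψ) (hΨ : Good Ψ) (hQ : ∀ i ∈ Q, ∀ t, F (t, pt i) = pt i)
    {i j p : Lab} (hij : i ≠ j) (hi : i ∈ Q) (hj : j ∈ Q) (hp : p ∉ Q) :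
    ∃ K : I × I → Plane, Continuous K ∧ (∀ z, K z ∈ XE Q) ∧ (∀ t, K (0, t) = F (t, pt p)) ∧
      (∀ t, K (1, t) = pt p) ∧ (∀ s, K (s, 0) = pt p) ∧ ∀ s, K (s, 1) = pt p := by
  have hm : ∀ t, Set.MapsTo (fun x => F (t, x)) (XE Q) (XE Q) := fun t =>
    mapsTo_XE_of_fix (hF.homeo t).bijective.1 fun i hi => hQ i hi t
  have hpX : pt p ∈ XE Q := pt_mem_XE hp
  let f : I → Plane := fun t => F (t, pt p)
  have hfc : Continuous f := hF.cont.comp (Continuous.prodMk_left _)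
  have hfX : ∀ t, f t ∈ XE Q := fun t => hm t hpX
  have hf0 : f 0 = pt p := hF.zero _
  have hf1 : f 1 = pt p := (hF.one _).trans (hΨ.fix p)
  have comm : ∀ k ∈ Q, Commute (hl Q f) (.of k) := by
    intro k hk
    obtain ⟨g, hg, e⟩ := exists_loop (pt_strip p) hpX (.of k)
    rw [keep_of, un_mem hk] at e
    have sq := hol_square (isLoc_un Q) (K := fun z : I × I => F (z.1, g z.2))
      (hF.cont.comp (continuous_fst.prodMk (g.continuous.comp continuous_snd)))
      fun z => hm _ (hg _)
    simp only [hF.zero, hF.one, g.source, g.target] at sq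
    have e2 : hl Q (fun t => Ψ (g t)) = hl Q g := hΨ.hl_eq hp hg
    change hl Q g * hl Q f = hl Q f * hl Q (fun t => Ψ (g t)) at sq
    rw [e2, e] at sq
    exact sq.symm
  have h1 : hl Q f = 1 := eq_one_of_commute hij (comm i hi) (comm j hj)
  let a : XE Q := ⟨pt p, hpX⟩
  let γ : Path a a :=
    { toFun := fun t => ⟨f t, hfX t⟩
      continuous_toFun := hfc.subtype_mk _
      source' := Subtype.ext hf0
      target' := Subtype.ext hf1 }
  have hom : γ.Homotopic (Path.refl a) := by
    refine homotopic_of_hol_eq ?_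
    exact h1.trans (hol_const (isLoc_un Q) hpX).symm
  obtain ⟨h⟩ := hom
  refine ⟨fun z => h z, continuous_subtype_val.comp h.continuous, fun z => (h z).2, fun t => ?_,
    fun t => ?_, fun s => ?_, fun s => ?_⟩
  · exact congrArg Subtype.val (h.apply_zero t)
  · exact congrArg Subtype.val (h.apply_one t)
  · exact congrArg Subtype.val (h.source s)
  · exact congrArg Subtype.val (h.target s)

/-- The basepoint of the annuli. -/
def cor : Plane := pt (false, 0)

theorem dist_pt_cor (i : Lab) : ∃ m : ℕ, dist (pt i) cor = m ∧ i.2.natAbs ≤ m := by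
  rcases i with ⟨_ | _, n⟩
  · refine ⟨n.natAbs, ?_, le_rfl⟩
    simp [cor, pt, Prod.dist_eq]
  · refine ⟨max n.natAbs 1, ?_, le_max_left _ _⟩
    simp [cor, pt, Prod.dist_eq]
    norm_num [Real.dist_eq]

theorem dist_pt_cor_ne {i : Lab} {ρ : ℝ} (h : Irrational ρ) : dist (pt i) cor ≠ ρ := by
  obtain ⟨m, hm, -⟩ := dist_pt_cor i
  exact fun e => h.ne_nat m (e.symm.trans hm)

theorem finite_dist_pt_lt (s : ℝ) : {i : Lab | dist (pt i) cor < s}.Finite := by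
  refine (Set.finite_univ.prod (Set.finite_Icc (-⌈s⌉) ⌈s⌉)).subset fun i hi => ⟨trivial, ?_⟩
  obtain ⟨m, hm, h⟩ := dist_pt_cor i
  have h1 : (m : ℝ) < s := hm.symm.trans_lt hi
  have h2 : (m : ℤ) ≤ ⌈s⌉ := by exact_mod_cast h1.le.trans (Int.le_ceil s)
  rw [Set.mem_Icc]
  omega

/-- Open annulus about `cor`. -/
def Ann (r s : ℝ) : Set Plane := {y | r < dist y cor ∧ dist y cor < s}

theorem isOpen_Ann (r s : ℝ) : IsOpen (Ann r s) := by
  have h : Continuous fun y : Plane => dist y cor := continuous_id.dist continuous_const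
  exact (isOpen_lt continuous_const h).inter (isOpen_lt h continuous_const)

/-- Radial retraction onto a closed annulus. -/
noncomputable def retr (r s : ℝ) (y : Plane) : Plane :=
  cor + (max r (min s (dist y cor)) / dist y cor) • (y - cor)

theorem dist_retr {r s : ℝ} (hr : 0 < r) {y : Plane} (hy : y ≠ cor) :
    dist (retr r s y) cor = max r (min s (dist y cor)) := by
  have h : 0 < dist y cor := dist_pos.2 hy
  rw [retr, dist_eq_norm, add_sub_cancel_left, norm_smul, ← dist_eq_norm, Real.norm_eq_abs,
    abs_of_nonneg (div_nonneg (hr.le.trans (le_max_left _ _)) h.le), div_mul_cancel₀ _ h.ne']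

theorem retr_of_mem {r s : ℝ} {y : Plane} (hy : y ≠ cor) (h1 : r ≤ dist y cor)
    (h2 : dist y cor ≤ s) : retr r s y = y := by
  rw [retr, min_eq_right h2, max_eq_right h1, div_self (dist_pos.2 hy).ne', one_smul,
    add_sub_cancel]

theorem continuousOn_retr (r s : ℝ) : ContinuousOn (retr r s) {cor}ᶜ := by
  have h : Continuous fun y : Plane => dist y cor := continuous_id.dist continuous_const
  have h1 : ContinuousOn (fun y : Plane => max r (min s (dist y cor)) / dist y cor) {cor}ᶜ :=
    ContinuousOn.div (continuous_const.max (continuous_const.min h)).continuousOn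
      h.continuousOn fun y hy => (dist_pos.2 hy).ne'
  have h2 : ContinuousOn (fun y : Plane => y - cor) {cor}ᶜ :=
    (continuous_id.sub continuous_const).continuousOn
  exact continuousOn_const.add (h1.smul h2)

theorem Isot.squeeze (hF : Isot F Ψ) (hΨ : Good Ψ) (hQ : ∀ i ∈ Q, ∀ t, F (t, pt i) = pt i)
    (h0 : (false, 0) ∈ Q) (h1 : (false, 1) ∈ Q) {p : Lab} (hp : p ∉ Q) {r s : ℝ} (hr : 0 ≤ r)
    (hpA : ∀ t, F (t, pt p) ∈ Ann r s) :
    ∃ H, SuppIn (XE Q ∩ Ann r s) H ∧ ∀ t, H (t, F (t, pt p)) = pt p := by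
  obtain ⟨K, hK, hKX, hK0, hK1, hKl, hKr⟩ := hF.null hΨ hQ (by simp) h0 h1 hp
  have hd : Continuous fun t => dist (F (t, pt p)) cor :=
    (hF.cont.comp (Continuous.prodMk_left _)).dist continuous_const
  obtain ⟨t₁, -, ht₁⟩ := isCompact_univ.exists_isMinOn Set.univ_nonempty hd.continuousOn
  obtain ⟨t₂, -, ht₂⟩ := isCompact_univ.exists_isMaxOn Set.univ_nonempty hd.continuousOn
  obtain ⟨a, ha, hra, ham⟩ := exists_irrational_btwn (hpA t₁).1
  obtain ⟨b, hb, hMb, hbs⟩ := exists_irrational_btwn (hpA t₂).2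
  have ha0 : 0 < a := hr.trans_lt hra
  have lo : ∀ t, a ≤ dist (F (t, pt p)) cor := fun t => ham.le.trans (ht₁ (Set.mem_univ t))
  have hi : ∀ t, dist (F (t, pt p)) cor ≤ b := fun t =>
    le_trans (ht₂ (Set.mem_univ t)) hMb.le
  have hab : a ≤ b := (lo 0).trans (hi 0)
  have hcor : ∀ z, K z ≠ cor := fun z => hKX z _ h0
  have hfix : ∀ t, retr a b (F (t, pt p)) = F (t, pt p) := fun t =>
    retr_of_mem (hK0 t ▸ hcor _) (lo t) (hi t)
  have hfix0 : retr a b (pt p) = pt p := by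
    have := hfix 0
    rwa [hF.zero] at this
  have hW : ∀ z, retr a b (K z) ∈ XE Q ∩ Ann r s := by
    intro z
    have e := dist_retr (s := b) ha0 (hcor z)
    refine ⟨fun i hi h => ?_, ?_⟩
    · rcases le_or_gt a (dist (K z) cor) with h1 | h1
      · rcases le_or_gt (dist (K z) cor) b with h2 | h2
        · rw [retr_of_mem (hcor z) h1 h2] at h
          exact hKX z i hi h
        · rw [min_eq_left h2.le, max_eq_right hab, h] at e
          exact dist_pt_cor_ne hb e
      · rw [max_eq_left ((min_le_right _ _).trans h1.le), h] at e
        exact dist_pt_cor_ne ha e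
    · change r < dist _ _ ∧ dist _ _ < s
      rw [e]
      exact ⟨hra.trans_le (le_max_left _ _),
        (max_le hab (min_le_left _ _)).trans_lt hbs⟩
  have hK' : Continuous fun z => retr a b (K z) :=
    (continuousOn_retr a b).comp_continuous hK hcor
  obtain ⟨H, hH, e⟩ := exists_push ((isOpen_XE Q).inter (isOpen_Ann r s)) hK' hW
    (fun t => by rw [hK1, hfix0]) (fun s => by rw [hKl, hfix0]) fun s => by rw [hKr, hfix0]
  exact ⟨H, hH, fun t => by have := e t; rwa [hK0, hfix] at this⟩

theorem Isot.annulus (hF : Isot F Ψ) (hΨ : Good Ψ) (h0 : ∀ t, F (t, pt (false, 0)) = pt (false, 0))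
    (h1 : ∀ t, F (t, pt (false, 1)) = pt (false, 1)) {r s : ℝ} (hr : 0 ≤ r) :
    ∃ H, SuppIn (Ann r s) H ∧ ∀ i, ((∀ t, F (t, pt i) = pt i) ∨ ∀ t, F (t, pt i) ∈ Ann r s) →
      ∀ t, H (t, F (t, pt i)) = pt i := by
  have key : ∀ S : Set Lab, S.Finite → ∃ H, SuppIn (Ann r s) H ∧ ∀ i, ((∀ t, F (t, pt i) = pt i) ∨
      (i ∈ S ∧ ∀ t, F (t, pt i) ∈ Ann r s)) → ∀ t, H (t, F (t, pt i)) = pt i := by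
    intro S hS
    induction S, hS using Set.Finite.induction_on with
    | empty =>
      refine ⟨_, suppIn_snd _, fun i hi t => ?_⟩
      rcases hi with h | h
      · exact h t
      · exact h.1.elim
    | @insert j S _ _ ih =>
      obtain ⟨H, hH, e⟩ := ih
      by_cases hj : (∀ t, F (t, pt j) ∈ Ann r s) ∧ ¬ ∀ t, H (t, F (t, pt j)) = pt j
      · have hF' : Isot (fun z => H (z.1, F z)) Ψ := hH.toIsot.comp hF
        obtain ⟨H', hH', e'⟩ := hF'.squeeze (Q := {i | ∀ t, H (t, F (t, pt i)) = pt i}) hΨ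
          (fun i hi => hi) (e _ (Or.inl h0)) (e _ (Or.inl h1)) hj.2 hr
          fun t => (hH.mem_iff t _).2 (hj.1 t)
        refine ⟨_, (hH'.mono Set.inter_subset_right).comp hH, fun i hi => ?_⟩
        by_cases hij : i = j
        · subst hij
          exact e'
        · have hi' : ∀ t, H (t, F (t, pt i)) = pt i := by
            refine e i (hi.imp_right fun h => ⟨?_, h.2⟩)
            exact h.1.resolve_left hij
          intro t
          simp only [hi']
          exact hH'.off t _ fun h => h.1 i hi' rfl
      · refine ⟨H, hH, fun i hi => ?_⟩
        by_cases hij : i = j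
        · subst hij
          rcases hi with h | h
          · exact e i (Or.inl h)
          · by_contra hn
            exact hj ⟨h.2, hn⟩
        · refine e i (hi.imp_right fun h => ⟨?_, h.2⟩)
          exact h.1.resolve_left hij
  obtain ⟨H, hH, e⟩ := key _ (finite_dist_pt_lt s)
  refine ⟨H, hH, fun i hi => e i (hi.imp_right fun h => ⟨?_, h⟩)⟩
  have := (h 0).2
  rwa [hF.zero] at this

end Annuli

section Round

open Filter Topology unitInterval

variable {F : I × Plane → Plane} {Ψ : Plane ≃ₜ Plane} {r : ℕ → ℝ} {X : Type*}

/-- Glue maps that agree with `π` away from the annuli bounded by the radii `r`. -/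
noncomputable def glue (π : X → Plane) (h : ℕ → X → Plane) (x : X) : Plane :=
  π x + ∑ᶠ k, (h k x - π x)

theorem glue_of_forall {π : X → Plane} {h : ℕ → X → Plane} {x : X} (hx : ∀ k, h k x = π x) :
    glue π h x = π x := by
  simp [glue, hx]

theorem Ann_unique (hr : StrictMono r) {y : Plane} {j k : ℕ} (hj : y ∈ Ann (r j) (r (j + 1)))
    (hk : y ∈ Ann (r k) (r (k + 1))) : j = k := by
  rcases lt_trichotomy j k with h | h | h
  · have := hr.monotone (show j + 1 ≤ k from h)
    linarith [hj.2, hk.1]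
  · exact h
  · have := hr.monotone (show k + 1 ≤ j from h)
    linarith [hj.1, hk.2]

theorem glue_of_mem (hr : StrictMono r) {π : X → Plane} {h : ℕ → X → Plane}
    (hh : ∀ k x, π x ∉ Ann (r k) (r (k + 1)) → h k x = π x) {k : ℕ} {x : X}
    (hx : π x ∈ Ann (r k) (r (k + 1))) : glue π h x = h k x := by
  rw [glue, finsum_eq_single _ k, add_sub_cancel]
  intro j hj
  rw [hh j x fun h => hj (Ann_unique hr h hx), sub_self]

theorem continuous_glue [TopologicalSpace X] (hr' : Tendsto r atTop atTop)
    {π : X → Plane} {h : ℕ → X → Plane} (hπ : Continuous π) (hc : ∀ k, Continuous (h k))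
    (hh : ∀ k x, π x ∉ Ann (r k) (r (k + 1)) → h k x = π x) : Continuous (glue π h) := by
  refine hπ.add (continuous_finsum (fun k => (hc k).sub hπ) fun x => ?_)
  refine ⟨{y | dist (π y) cor < dist (π x) cor + 1},
    (isOpen_lt (hπ.dist continuous_const) continuous_const).mem_nhds
      (show dist (π x) cor < _ from lt_add_one _), ?_⟩
  obtain ⟨N, hN⟩ := eventually_atTop.1 (hr'.eventually_ge_atTop (dist (π x) cor + 1))
  refine (Set.finite_Iio N).subset ?_
  rintro k ⟨y, hy, hy'⟩
  by_contra hk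
  have h1 : r k < dist (π y) cor := by
    by_contra hn
    exact hy (sub_eq_zero.2 (hh k y fun h => hn h.1))
  exact absurd (h1.trans hy') (not_lt.2 (hN k (not_lt.1 hk)))

theorem glue_glue (hr : StrictMono r) {h h' : ℕ → Plane → Plane}
    (hh : ∀ k x, x ∉ Ann (r k) (r (k + 1)) → h k x = x)
    (hh' : ∀ k x, x ∉ Ann (r k) (r (k + 1)) → h' k x = x)
    (hm : ∀ k, ∀ x ∈ Ann (r k) (r (k + 1)), h' k x ∈ Ann (r k) (r (k + 1)))
    (hinv : ∀ k x, h k (h' k x) = x) (x : Plane) : glue id h (glue id h' x) = x := by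
  by_cases hx : ∃ k, x ∈ Ann (r k) (r (k + 1))
  · obtain ⟨k, hk⟩ := hx
    rw [glue_of_mem (π := id) hr hh' hk, glue_of_mem (π := id) hr hh (hm k x hk), hinv]
  · push Not at hx
    have e' : glue id h' x = x := glue_of_forall (π := id) fun k => hh' k x (hx k)
    have e : glue id h x = x := glue_of_forall (π := id) fun k => hh k x (hx k)
    rw [e', e]

theorem SuppIn.glue (hr : StrictMono r) (hr' : Tendsto r atTop atTop) {H : ℕ → I × Plane → Plane}
    (hH : ∀ k, SuppIn (Ann (r k) (r (k + 1))) (H k)) : Isot (glue Prod.snd H) id where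
  cont := continuous_glue hr' continuous_snd (fun k => (hH k).cont)
    fun k x hx => (hH k).off x.1 x.2 hx
  homeo t := by
    choose e he using fun k => (hH k).homeo t
    have off : ∀ k x, x ∉ Ann (r k) (r (k + 1)) → e k x = x := fun k x hx =>
      (he k x).trans ((hH k).off t x hx)
    have off' : ∀ k x, x ∉ Ann (r k) (r (k + 1)) → (e k).symm x = x := fun k x hx =>
      (e k).symm_apply_eq.2 (off k x hx).symm
    have mem : ∀ k, ∀ x, e k x ∈ Ann (r k) (r (k + 1)) ↔ x ∈ Ann (r k) (r (k + 1)) :=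
      fun k x => by rw [he k x]; exact (hH k).mem_iff t x
    exact ⟨{
      toFun := _root_.glue id fun k => e k
      invFun := _root_.glue id fun k => (e k).symm
      left_inv := glue_glue hr off' off (fun k x hx => (mem k x).2 hx)
        fun k x => (e k).symm_apply_apply x
      right_inv := glue_glue hr off off'
        (fun k x hx => (mem k _).1 (by rwa [(e k).apply_symm_apply]))
        fun k x => (e k).apply_symm_apply x
      continuous_toFun := continuous_glue hr' continuous_id (fun k => (e k).continuous) off
      continuous_invFun := continuous_glue hr' continuous_id (fun k => (e k).symm.continuous)
        off' }, fun x => by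
          change x + _ = x + _
          congr 1
          exact finsum_congr fun k => congrArg (· - x) (he k x)⟩
  zero x := glue_of_forall fun k => (hH k).zero x
  one x := glue_of_forall fun k => (hH k).one x

theorem Isot.round (hF : Isot F Ψ) (hΨ : Good Ψ) (h0 : ∀ t, F (t, pt (false, 0)) = pt (false, 0))
    (h1 : ∀ t, F (t, pt (false, 1)) = pt (false, 1)) (hr : StrictMono r)
    (hr' : Tendsto r atTop atTop) (hr0 : 0 ≤ r 0) :
    ∃ F', Isot F' Ψ ∧ ∀ i, ((∀ t, F (t, pt i) = pt i) ∨
      ∃ k, ∀ t, F (t, pt i) ∈ Ann (r k) (r (k + 1))) → ∀ t, F' (t, pt i) = pt i := by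
  choose H hH e using fun k => hF.annulus hΨ h0 h1 (r := r k) (s := r (k + 1))
    (hr0.trans (hr.monotone (Nat.zero_le k)))
  have off : ∀ k (x : I × Plane), x.2 ∉ Ann (r k) (r (k + 1)) → H k x = x.2 := fun k x hx =>
    (hH k).off x.1 x.2 hx
  refine ⟨_, (SuppIn.glue hr hr' hH).comp hF, fun i hi t => ?_⟩
  rcases hi with h | ⟨k, hk⟩
  · have : ∀ k, H k (t, F (t, pt i)) = F (t, pt i) := fun k =>
      (e k i (Or.inl h) t).trans (h t).symm
    exact (glue_of_forall (π := Prod.snd) this).trans (h t)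
  · exact (glue_of_mem (π := Prod.snd) hr off (hk t)).trans (e k i (Or.inr hk) t)

end Round

section Gather

open Filter Topology unitInterval

/-- Piecewise linear interpolation of a function on the integers. -/
noncomputable def interp (H : ℤ → ℝ) (x : ℝ) : ℝ :=
  H ⌊x⌋ + Int.fract x * (H (⌊x⌋ + 1) - H ⌊x⌋)

theorem interp_intCast (H : ℤ → ℝ) (n : ℤ) : interp H n = H n := by simp [interp]

theorem strictMono_interp {H : ℤ → ℝ} (hH : StrictMono H) : StrictMono (interp H) := by
  intro x y hxy
  have hx := hH (Int.lt_succ ⌊x⌋)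
  have hy := hH (Int.lt_succ ⌊y⌋)
  rcases (Int.floor_mono hxy.le).eq_or_lt with h | h
  · have : Int.fract x < Int.fract y := by
      rw [Int.fract, Int.fract, h]
      linarith
    rw [interp, interp, h] at *
    have := mul_lt_mul_of_pos_right this (sub_pos.2 hy)
    linarith
  · calc interp H x < H (⌊x⌋ + 1) := by
          have := mul_lt_mul_of_pos_right (Int.fract_lt_one x) (sub_pos.2 hx)
          rw [interp]
          linarith
      _ ≤ H ⌊y⌋ := hH.monotone h
      _ ≤ interp H y := by
          have := mul_nonneg (Int.fract_nonneg y) (sub_pos.2 hy).le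
          rw [interp]
          linarith

theorem surjective_interp {H : ℤ → ℝ} (hH : StrictMono H) (hu : ∀ y, ∃ n, y < H n)
    (hl : ∀ y, ∃ n, H n ≤ y) : Function.Surjective (interp H) := by
  intro y
  obtain ⟨N, hN⟩ := hu y
  obtain ⟨n, hn, hmax⟩ := Int.exists_greatest_of_bdd (P := fun n => H n ≤ y)
    ⟨N, fun z hz => (hH.lt_iff_lt.1 (hz.trans_lt hN)).le⟩ (hl y)
  have h1 : y < H (n + 1) := by
    by_contra! h
    exact absurd (hmax _ h) (by omega)
  have h2 : 0 < H (n + 1) - H n := sub_pos.2 (hH (Int.lt_succ n))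
  have hf : ⌊(n : ℝ) + (y - H n) / (H (n + 1) - H n)⌋ = n := by
    rw [Int.floor_eq_iff]
    constructor
    · have := div_nonneg (sub_nonneg.2 hn) h2.le
      linarith
    · have : (y - H n) / (H (n + 1) - H n) < 1 := by
        rw [div_lt_one h2]
        linarith
      linarith
  refine ⟨n + (y - H n) / (H (n + 1) - H n), ?_⟩
  rw [interp, Int.fract, hf, add_sub_cancel_left, div_mul_cancel₀ _ h2.ne']
  ring

theorem isHomeoFun_fst {f : ℝ → ℝ} (hf : StrictMono f) (hs : Function.Surjective f) :
    IsHomeoFun fun p => (f p.1, p.2) :=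
  ⟨(hf.orderIsoOfSurjective f hs).toHomeomorph.prodCongr (Homeomorph.refl ℝ), fun _ => rfl⟩

theorem isot_fst {h : ℝ → ℝ} (hh : StrictMono h) (hs : Function.Surjective h) :
    Isot (fun z => ((1 - (z.1 : ℝ)) * z.2.1 + z.1 * h z.2.1, z.2.2)) fun p => (h p.1, p.2) where
  cont := by
    have hc : Continuous h := hh.monotone.continuous_of_surjective hs
    fun_prop
  homeo t := by
    have hc : Continuous h := hh.monotone.continuous_of_surjective hs
    have h0 : (0 : ℝ) ≤ t := t.2.1
    have h1 : (0 : ℝ) ≤ 1 - t := sub_nonneg.2 t.2.2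
    have hm : StrictMono fun x : ℝ => (1 - (t : ℝ)) * x + t * h x := by
      intro x y hxy
      rcases h0.eq_or_lt with e | e
      · simp [← e, hxy]
      · exact add_lt_add_of_le_of_lt (mul_le_mul_of_nonneg_left hxy.le h1)
          (mul_lt_mul_of_pos_left (hh hxy) e)
    refine isHomeoFun_fst hm (Continuous.surjective (by fun_prop) ?_ ?_)
    · refine tendsto_atTop_atTop_of_monotone hm.monotone fun b => ?_
      obtain ⟨a, ha⟩ := hs b
      refine ⟨max a b, ?_⟩
      have e1 : b ≤ h (max a b) := ha.symm.trans_le (hh.monotone (le_max_left _ _))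
      have e2 : b ≤ max a b := le_max_right _ _
      nlinarith [mul_le_mul_of_nonneg_left e1 h0, mul_le_mul_of_nonneg_left e2 h1]
    · refine tendsto_atBot_atBot_of_monotone hm.monotone fun b => ?_
      obtain ⟨a, ha⟩ := hs b
      refine ⟨min a b, ?_⟩
      have e1 : h (min a b) ≤ b := (hh.monotone (min_le_left _ _)).trans_eq ha
      have e2 : min a b ≤ b := min_le_right _ _
      nlinarith [mul_le_mul_of_nonneg_left e1 h0, mul_le_mul_of_nonneg_left e2 h1]
  zero x := by simp
  one x := by simp

/-- The natural number `m` lies in the `j`-th gap of the sequence `a`. -/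
def InGap (a : ℕ → ℕ) (j m : ℕ) : Prop := a (8 * j + 1) ≤ m ∧ m < a (8 * j + 6)

theorem InGap.eq {a : ℕ → ℕ} (ha : StrictMono a) {j k m n : ℕ} (hm : InGap a j m)
    (hn : InGap a k n) (h1 : m ≤ n + 1) (h2 : n ≤ m + 1) : j = k := by
  have key : ∀ {j k m n : ℕ}, InGap a j m → InGap a k n → n ≤ m + 1 → ¬ j < k := by
    intro j k m n hm hn h hjk
    have e1 := ha (show 8 * j + 6 < 8 * j + 7 by omega)
    have e2 := ha.monotone (show 8 * j + 7 ≤ 8 * k + 1 by omega)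
    have := hm.2
    have := hn.1
    omega
  exact le_antisymm (not_lt.1 (key hn hm h1)) (not_lt.1 (key hm hn h2))

theorem exists_compress {a : ℕ → ℕ} (ha : StrictMono a) {ε : ℕ → ℝ} (hε : ∀ j, 0 < ε j) :
    ∃ G : ℕ → ℝ, StrictMono G ∧ (∀ m, (∀ j, ¬ InGap a j m) → G m = m) ∧
      ∀ j m, InGap a j m → |G m - a (8 * j + 3)| < ε j ∧ (a (8 * j + 1) : ℝ) ≤ G m ∧
        G m < a (8 * j + 6) := by
  classical
  have hδ : ∀ j, ∃ δ : ℝ, 0 < δ ∧ δ ≤ 1 ∧ δ * a (8 * j + 6) < ε j := by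
    intro j
    have h6 : (0 : ℝ) < a (8 * j + 6) := by
      exact_mod_cast (Nat.zero_le _).trans_lt (ha (show 8 * j + 5 < 8 * j + 6 by omega))
    refine ⟨min 1 (ε j / 2 / a (8 * j + 6)), lt_min one_pos (by have := hε j; positivity),
      min_le_left _ _, ?_⟩
    calc _ ≤ ε j / 2 / a (8 * j + 6) * a (8 * j + 6) := by
          gcongr
          exact min_le_right _ _
      _ = ε j / 2 := div_mul_cancel₀ _ h6.ne'
      _ < ε j := half_lt_self (hε j)
  choose δ hδ0 hδ1 hδε using hδ
  let c : ℕ → ℕ → ℝ := fun j m => a (8 * j + 3) + δ j * (m - a (8 * j + 3))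
  let G : ℕ → ℝ := fun m => if h : ∃ j, InGap a j m then c h.choose m else m
  have G1 : ∀ m, (∀ j, ¬ InGap a j m) → G m = m := fun m hm => dif_neg (by push Not; exact hm)
  have G2 : ∀ j m, InGap a j m → G m = c j m := by
    intro j m hm
    have h : ∃ j, InGap a j m := ⟨j, hm⟩
    have e : h.choose = j := h.choose_spec.eq ha hm (by omega) (by omega)
    change dite _ _ _ = _
    rw [dif_pos h, e]
  have bd : ∀ j m, InGap a j m → (a (8 * j + 1) : ℝ) ≤ c j m ∧ c j m ≤ a (8 * j + 6) - 1 ∧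
      |c j m - a (8 * j + 3)| < ε j := by
    intro j m hm
    have e1 : (a (8 * j + 1) : ℝ) ≤ m := by exact_mod_cast hm.1
    have e2 : (m : ℝ) ≤ a (8 * j + 6) - 1 := by
      rw [le_sub_iff_add_le]
      exact_mod_cast hm.2
    have e3 : (a (8 * j + 1) : ℝ) ≤ a (8 * j + 3) := by
      exact_mod_cast ha.monotone (by omega)
    have e4 : (a (8 * j + 3) : ℝ) ≤ a (8 * j + 6) - 1 := by
      rw [le_sub_iff_add_le]
      exact_mod_cast ha (show 8 * j + 3 < 8 * j + 6 by omega)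
    have e5 : c j m = (1 - δ j) * a (8 * j + 3) + δ j * m := by ring
    have h0 := (hδ0 j).le
    have h1 := sub_nonneg.2 (hδ1 j)
    refine ⟨?_, ?_, ?_⟩
    · rw [e5]
      nlinarith [mul_le_mul_of_nonneg_left e1 h0, mul_le_mul_of_nonneg_left e3 h1]
    · rw [e5]
      nlinarith [mul_le_mul_of_nonneg_left e2 h0, mul_le_mul_of_nonneg_left e4 h1]
    · rw [show c j m - a (8 * j + 3) = δ j * (m - a (8 * j + 3)) by simp only [c]; ring, abs_mul,
        abs_of_pos (hδ0 j)]
      refine lt_of_le_of_lt (mul_le_mul_of_nonneg_left ?_ h0) (hδε j)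
      rw [abs_le]
      have : (0 : ℝ) ≤ m := Nat.cast_nonneg m
      have : (0 : ℝ) ≤ a (8 * j + 3) := Nat.cast_nonneg _
      constructor <;> linarith
  refine ⟨G, strictMono_nat_of_lt_succ fun m => ?_, G1, fun j m hm => ?_⟩
  · by_cases h : ∃ j, InGap a j m <;> by_cases h' : ∃ j, InGap a j (m + 1)
    · obtain ⟨j, hj⟩ := h
      obtain ⟨k, hk⟩ := h'
      obtain rfl := hj.eq ha hk (by omega) (by omega)
      rw [G2 _ _ hj, G2 _ _ hk]
      simp only [c, Nat.cast_succ]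
      linarith [hδ0 j]
    · obtain ⟨j, hj⟩ := h
      rw [G2 _ _ hj, G1 _ (by push Not at h'; exact h')]
      have h1 : a (8 * j + 6) ≤ m + 1 := by
        by_contra hn
        exact h' ⟨j, hj.1.trans (Nat.le_succ m), not_le.1 hn⟩
      have h2 : (a (8 * j + 6) : ℝ) ≤ ((m + 1 : ℕ) : ℝ) := by exact_mod_cast h1
      linarith [(bd j m hj).2.1]
    · obtain ⟨k, hk⟩ := h'
      rw [G2 _ _ hk, G1 _ (by push Not at h; exact h)]
      have h1 : m < a (8 * k + 1) := by
        by_contra hn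
        exact h ⟨k, not_lt.1 hn, (Nat.lt_succ_self m).trans hk.2⟩
      have h2 : (m : ℝ) < a (8 * k + 1) := by exact_mod_cast h1
      exact h2.trans_le (bd k _ hk).1
    · push Not at h h'
      rw [G1 _ h, G1 _ h']
      exact_mod_cast Nat.lt_succ_self m
  · rw [G2 _ _ hm]
    obtain ⟨h1, h2, h3⟩ := bd j m hm
    exact ⟨h3, h1, by linarith⟩

theorem exists_odd_extension {G : ℕ → ℝ} (hG : StrictMono G) (h0 : G 0 = 0) :
    ∃ H : ℤ → ℝ, StrictMono H ∧ (∀ n : ℕ, H n = G n) ∧ ∀ n : ℕ, H (-n) = -G n := by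
  have e1 : ∀ n : ℕ, (Int.sign (n : ℤ) : ℝ) * G (Int.natAbs n) = G n := by
    intro n
    rcases Nat.eq_zero_or_pos n with rfl | h
    · simp [h0]
    · rw [Int.sign_eq_one_of_pos (by exact_mod_cast h)]
      simp
  have e2 : ∀ n : ℕ, (Int.sign (-(n : ℤ)) : ℝ) * G (Int.natAbs (-n)) = -G n := by
    intro n
    rw [Int.sign_neg, Int.natAbs_neg, Int.cast_neg, neg_mul, e1]
  refine ⟨fun n => Int.sign n * G n.natAbs, strictMono_int_of_lt_succ fun n => ?_, e1, e2⟩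
  rcases le_or_gt 0 n with h | h
  · obtain ⟨k, rfl⟩ := Int.eq_ofNat_of_zero_le h
    have := e1 (k + 1)
    push_cast at this
    rw [e1, this]
    exact hG (Nat.lt_succ_self k)
  · obtain ⟨k, rfl⟩ : ∃ k : ℕ, n = -((k + 1 : ℕ) : ℤ) := ⟨(-n - 1).toNat, by omega⟩
    have := e2 k
    rw [e2, show -((k + 1 : ℕ) : ℤ) + 1 = -k by push_cast; ring, this]
    exact neg_lt_neg (hG (Nat.lt_succ_self k))

end Gather

section Fixing

open Filter Topology unitInterval

variable {F : I × Plane → Plane} {Ψ : Plane ≃ₜ Plane} {a : ℕ → ℕ}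

/-- The radii `a` control the isotopy `F`. -/
structure Controls (a : ℕ → ℕ) (F : I × Plane → Plane) : Prop where
  mono : StrictMono a
  zero : a 0 = 1
  up : ∀ k t x, dist x cor ≤ a k → dist (F (t, x)) cor < a (k + 1)
  down : ∀ k t x, dist (F (t, x)) cor ≤ a k → dist x cor < a (k + 1)

theorem Isot.exists_controls (hF : Isot F Ψ) : ∃ a, Controls a F := by
  have step : ∀ R : ℕ, ∃ R' : ℕ, R < R' ∧ (∀ t x, dist x cor ≤ R → dist (F (t, x)) cor < R') ∧
      ∀ t x, dist (F (t, x)) cor ≤ R → dist x cor < R' := by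
    intro R
    obtain ⟨A, hA⟩ := isotopy_bounded hF.cont hF.homeo cor R
    have hc : IsCompact ((Set.univ : Set I) ×ˢ Metric.closedBall cor (R : ℝ)) :=
      isCompact_univ.prod (isCompact_closedBall _ _)
    obtain ⟨B, hB⟩ := (hc.image hF.cont).isBounded.subset_ball cor
    obtain ⟨N, hN⟩ := exists_nat_gt (max A B)
    refine ⟨max N (R + 1), (Nat.lt_succ_self R).trans_le (le_max_right _ _), fun t x hx => ?_,
      fun t x hx => ?_⟩
    · have h1 : dist (F (t, x)) cor < B := hB ⟨(t, x), ⟨trivial, hx⟩, rfl⟩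
      rw [Nat.cast_max]
      exact (h1.trans ((le_max_right _ _).trans_lt hN)).trans_le (le_max_left _ _)
    · have h1 := hA t x hx
      rw [Nat.cast_max]
      exact (h1.trans ((le_max_left _ _).trans_lt hN)).trans_le (le_max_left _ _)
  choose s hs hup hdn using step
  have e : ∀ k, s^[k + 1] 1 = s (s^[k] 1) := fun k => Function.iterate_succ_apply' s k 1
  refine ⟨fun k => s^[k] 1, strictMono_nat_of_lt_succ fun k => ?_, rfl, fun k t x hx => ?_,
    fun k t x hx => ?_⟩
  · rw [e]
    exact hs _
  · rw [e]
    exact hup _ t x hx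
  · rw [e]
    exact hdn _ t x hx

theorem Controls.lt (ha : Controls a F) {j k : ℕ} (h : j < k) : (a j : ℝ) < a k := by
  exact_mod_cast ha.mono h

theorem Controls.mem_Ann (ha : Controls a F) {j k : ℕ} {t : I} {x : Plane}
    (h1 : (a (j + 1) : ℝ) ≤ dist x cor) (h2 : dist x cor ≤ a k) :
    F (t, x) ∈ Ann (a j) (a (k + 1)) :=
  ⟨not_le.1 fun h => (ha.down j t x h).not_ge h1, ha.up k t x h2⟩

theorem dist_strip {x y : ℝ} (hx : 1 ≤ |x|) (hy : 1 ≤ y ∧ y ≤ 2) :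
    dist ((x, y) : Plane) cor = |x| := by
  rw [Prod.dist_eq, max_eq_left] <;> simp only [cor, pt, Real.dist_eq]
  · simp
  · have : |y - 1| ≤ 1 := abs_le.2 ⟨by linarith, by linarith⟩
    simpa using this.trans hx

theorem dist_pt_of_ne {i : Lab} (h : i.2 ≠ 0) : dist (pt i) cor = i.2.natAbs := by
  have h1 : (1 : ℝ) ≤ |(i.2 : ℝ)| := by exact_mod_cast Int.one_le_abs h
  have := dist_strip h1 (pt_strip i)
  rw [Nat.cast_natAbs, Int.cast_abs]
  exact this

/-- Radii of the first round of annuli. -/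
def outerRadius (a : ℕ → ℕ) : ℕ → ℝ
  | 0 => 0
  | k + 1 => a (4 * k + 2 - k % 2)

theorem outerRadius_odd (a : ℕ → ℕ) (j : ℕ) : outerRadius a (2 * j + 1) = a (8 * j + 2) := by
  rw [outerRadius]
  congr 2
  omega

theorem outerRadius_even (a : ℕ → ℕ) (j : ℕ) : outerRadius a (2 * j + 2) = a (8 * j + 5) := by
  rw [outerRadius]
  congr 2
  omega

theorem Controls.strictMono_outerRadius (ha : Controls a F) : StrictMono (outerRadius a) := by
  refine strictMono_nat_of_lt_succ fun k => ?_
  rcases k with _ | k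
  · change (0 : ℝ) < a 2
    exact_mod_cast (Nat.zero_le _).trans_lt (ha.mono (show 0 < 2 by norm_num))
  · exact ha.lt (by omega)

theorem StrictMono.tendsto_atTop_of_nat_le {r : ℕ → ℝ} (hr : StrictMono r)
    (h : ∀ k : ℕ, ∃ j, (k : ℝ) ≤ r j) : Tendsto r atTop atTop := by
  refine tendsto_atTop_atTop_of_monotone hr.monotone fun b => ?_
  obtain ⟨k, hk⟩ := exists_nat_ge b
  exact (h k).imp fun j hj => hk.trans hj

theorem Controls.nat_le (ha : Controls a F) {k j : ℕ} (h : k ≤ j) : (k : ℝ) ≤ a j := by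
  exact_mod_cast h.trans (ha.mono.id_le j)

theorem exists_index (ha : Controls a F) {m : ℕ} (h : a 1 ≤ m) (hg : ∀ j, ¬ InGap a j m) :
    ∃ j, a (8 * j + 6) ≤ m ∧ m < a (8 * j + 9) := by
  have hex : ∃ k, m < a k := ⟨m + 1, (Nat.lt_succ_self m).trans_le (ha.mono.id_le _)⟩
  classical
  obtain ⟨k, hk, hmin⟩ : ∃ k, m < a k ∧ ∀ j < k, a j ≤ m :=
    ⟨Nat.find hex, Nat.find_spec hex, fun j hj => not_lt.1 (Nat.find_min hex hj)⟩
  have hk1 : 1 < k := by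
    by_contra hn
    exact absurd (ha.mono.monotone (not_lt.1 hn)) (by omega)
  let j := (k - 2) / 8
  have hj1 : a (8 * j + 1) ≤ m := hmin _ (by omega)
  have hj2 : a (8 * j + 6) ≤ m := by
    by_contra hn
    exact hg j ⟨hj1, not_le.1 hn⟩
  refine ⟨j, hj2, hk.trans_le (ha.mono.monotone ?_)⟩
  omega

/-- The first round fixes the punctures outside the gaps and one reference in each gap. -/
theorem Isot.first_round (hF : Isot F Ψ) (hΨ : Good Ψ)
    (h0 : ∀ t, F (t, pt (false, 0)) = pt (false, 0))
    (h1 : ∀ t, F (t, pt (false, 1)) = pt (false, 1)) (ha : Controls a F) :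
    ∃ F', Isot F' Ψ ∧ ∀ i : Lab, ((∀ j, ¬ InGap a j i.2.natAbs) ∨ ∃ j, i.2.natAbs = a (8 * j + 3)) →
      ∀ t, F' (t, pt i) = pt i := by
  have hr' : Tendsto (outerRadius a) atTop atTop :=
    ha.strictMono_outerRadius.tendsto_atTop_of_nat_le fun k => ⟨2 * k + 1, by
      rw [outerRadius_odd]
      exact ha.nat_le (by omega)⟩
  obtain ⟨F', hF', e⟩ := hF.round hΨ h0 h1 ha.strictMono_outerRadius hr' le_rfl
  refine ⟨F', hF', fun i hi => e i ?_⟩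
  rcases hi with hg | ⟨j, hj⟩
  · by_cases hi0 : i = (false, 0)
    · exact Or.inl (hi0 ▸ h0)
    · right
      rcases lt_or_ge i.2.natAbs (a 1) with h | h
      · refine ⟨0, fun t => ⟨?_, ?_⟩⟩
        · refine dist_pos.2 fun h' => hi0 ?_
          have := (hF.homeo t).bijective.1 (h'.trans (h0 t).symm)
          exact pt_injective this
        · refine ha.up 1 t _ ?_
          by_cases hz : i.2 = 0
          · have h2 : (1 : ℝ) ≤ a 1 := by
              exact_mod_cast ha.zero.symm.trans_le (ha.mono.monotone (Nat.zero_le 1))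
            refine le_trans ?_ h2
            obtain ⟨b, n⟩ := i
            obtain rfl : n = 0 := hz
            rcases b <;> simp [cor, pt, Prod.dist_eq, Real.dist_eq]
            norm_num
          · rw [dist_pt_of_ne hz]
            exact_mod_cast h.le
      · obtain ⟨j, hj, hj'⟩ := exists_index ha h hg
        have hz : i.2 ≠ 0 := by
          have := ha.mono (show 0 < 8 * j + 6 by omega)
          omega
        refine ⟨2 * j + 2, fun t => ?_⟩
        rw [outerRadius_even, show 2 * j + 2 + 1 = 2 * (j + 1) + 1 by ring, outerRadius_odd]
        refine ha.mem_Ann (k := 8 * j + 9) ?_ ?_ <;> rw [dist_pt_of_ne hz]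
        · exact_mod_cast hj
        · exact_mod_cast hj'.le
  · right
    have hz : i.2 ≠ 0 := by
      have := ha.mono (show 0 < 8 * j + 3 by omega)
      omega
    refine ⟨2 * j + 1, fun t => ?_⟩
    rw [outerRadius_odd, show 2 * j + 1 + 1 = 2 * j + 2 by ring, outerRadius_even]
    refine ha.mem_Ann (k := 8 * j + 4) ?_ ?_ <;> rw [dist_pt_of_ne hz, hj]
    exact (ha.lt (by omega)).le

end Fixing

section Fixing

open Filter Topology unitInterval

variable {F F' : I × Plane → Plane} {Ψ : Plane ≃ₜ Plane} {a : ℕ → ℕ}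

theorem exists_modulus (hF : Continuous F) (z : Plane) :
    ∃ ε > 0, (∀ t, F (t, z) = z) → ∀ t x, dist x z < ε → dist (F (t, x)) z < 1 / 2 := by
  by_cases h : ∀ t, F (t, z) = z
  · have hev : ∀ᶠ x in 𝓝 z, ∀ t ∈ (Set.univ : Set I), dist (F (t, x)) z < 1 / 2 := by
      refine isCompact_univ.eventually_forall_of_forall_eventually fun t _ => ?_
      have hc : Continuous fun w : Plane × I => dist (F (w.2, w.1)) z :=
        (hF.comp continuous_swap).dist continuous_const
      refine (isOpen_lt hc continuous_const).mem_nhds ?_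
      change dist (F (t, z)) z < 1 / 2
      rw [h, dist_self]
      norm_num
    obtain ⟨ε, hε, h'⟩ := Metric.eventually_nhds_iff.1 hev
    exact ⟨ε, hε, fun _ t x hx => h' hx t trivial⟩
  · exact ⟨1, one_pos, fun h' => (h h').elim⟩

theorem not_inGap (ha : StrictMono a) (j k : ℕ) : ¬ InGap a j (a (8 * k + 7)) := fun h => by
  have h1 := ha.le_iff_le.1 h.1
  have h2 := ha.lt_iff_lt.1 h.2
  omega

/-- Time change that is constant outside the middle third. -/
noncomputable def midTime (t : I) : I := Set.projIcc 0 1 zero_le_one (3 * (t : ℝ) - 1)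

/-- Time change that rises, stays at one in the middle third, and falls. -/
noncomputable def plateau (t : I) : I :=
  Set.projIcc 0 1 zero_le_one (min (3 * (t : ℝ)) (3 - 3 * t))

theorem midTime_plateau (t : I) : midTime t = 0 ∨ midTime t = 1 ∨ plateau t = 1 := by
  rcases le_or_gt (3 * (t : ℝ)) 1 with h | h
  · exact Or.inl (Set.projIcc_of_le_left _ (by linarith))
  rcases le_or_gt 2 (3 * (t : ℝ)) with h' | h'
  · exact Or.inr (Or.inl (Set.projIcc_of_right_le _ (by linarith)))
  · exact Or.inr (Or.inr (Set.projIcc_of_right_le _ (le_min h.le (by linarith))))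

/-- Run `F` in the middle third, after the preparatory isotopy `ρ`, which is undone at the end. -/
theorem Isot.prepare {ρ : I × Plane → Plane} {f g : Plane → Plane} (hF : Isot F f)
    (hρ : Isot ρ g) : Isot (fun z => F (midTime z.1, ρ (plateau z.1, z.2))) f where
  cont := by
    have h1 : Continuous midTime := continuous_projIcc.comp (by fun_prop)
    have h2 : Continuous plateau := continuous_projIcc.comp (by fun_prop)
    exact hF.cont.comp ((h1.comp continuous_fst).prodMk
      (hρ.cont.comp ((h2.comp continuous_fst).prodMk continuous_snd)))
  homeo t := (hF.homeo (midTime t)).comp (hρ.homeo (plateau t))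
  zero x := by
    have h1 : midTime 0 = 0 := Set.projIcc_of_le_left _ (by norm_num)
    have h2 : plateau 0 = 0 := Set.projIcc_of_le_left _ (by norm_num)
    simp only [h1, h2, hF.zero, hρ.zero]
  one x := by
    have h1 : midTime 1 = 1 := Set.projIcc_of_right_le _ (by norm_num)
    have h2 : plateau 1 = 0 := Set.projIcc_of_le_left _ (by norm_num)
    simp only [h1, h2, hF.one, hρ.zero]

theorem Isot.gather (hF : Isot F Ψ) (hF' : Isot F' Ψ) (ha : Controls a F)
    (hfix : ∀ i : Lab, ((∀ j, ¬ InGap a j i.2.natAbs) ∨ ∃ j, i.2.natAbs = a (8 * j + 3)) →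
      ∀ t, F' (t, pt i) = pt i) :
    ∃ G, Isot G Ψ ∧ ∀ i : Lab, ((∀ j, ¬ InGap a j i.2.natAbs) → ∀ t, G (t, pt i) = pt i) ∧
      ∀ j, InGap a j i.2.natAbs → ∀ t, G (t, pt i) ∈ Ann (a (8 * j)) (a (8 * (j + 1))) := by
  choose ε hε0 hε using fun i => exists_modulus hF'.cont (pt i)
  let η : ℕ → ℝ := fun j => min
    (min (ε (false, (a (8 * j + 3) : ℤ))) (ε (false, -(a (8 * j + 3) : ℤ))))
    (min (ε (true, (a (8 * j + 3) : ℤ))) (ε (true, -(a (8 * j + 3) : ℤ))))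
  have hη : ∀ j, 0 < η j := fun j => lt_min (lt_min (hε0 _) (hε0 _)) (lt_min (hε0 _) (hε0 _))
  have hηp : ∀ b j, η j ≤ ε (b, (a (8 * j + 3) : ℤ)) := by
    rintro (_ | _) j
    · exact (min_le_left _ _).trans (min_le_left _ _)
    · exact (min_le_right _ _).trans (min_le_left _ _)
  have hηn : ∀ b j, η j ≤ ε (b, -(a (8 * j + 3) : ℤ)) := by
    rintro (_ | _) j
    · exact (min_le_left _ _).trans (min_le_right _ _)
    · exact (min_le_right _ _).trans (min_le_right _ _)
  obtain ⟨G, hG, hG1, hG2⟩ := exists_compress ha.mono hη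
  have hG0 : G 0 = 0 := by
    refine (hG1 0 fun j h => ?_).trans Nat.cast_zero
    have := ha.mono (show 0 < 8 * j + 1 by omega)
    have := h.1
    omega
  obtain ⟨H, hH, hHp, hHn⟩ := exists_odd_extension hG hG0
  have hlarge : ∀ y : ℝ, ∃ m : ℕ, |y| < G m := by
    intro y
    obtain ⟨k, hk⟩ := exists_nat_gt |y|
    refine ⟨a (8 * k + 7), ?_⟩
    rw [hG1 _ fun j => not_inGap ha.mono j k]
    exact hk.trans_le (ha.nat_le (by omega))
  have hs : Function.Surjective (interp H) := by
    refine surjective_interp hH (fun y => ?_) fun y => ?_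
    · obtain ⟨m, hm⟩ := hlarge y
      exact ⟨m, by rw [hHp]; exact (le_abs_self y).trans_lt hm⟩
    · obtain ⟨m, hm⟩ := hlarge y
      exact ⟨-m, by rw [hHn]; linarith [neg_abs_le y]⟩
  have hρ := isot_fst (strictMono_interp hH) hs
  refine ⟨_, hF'.prepare hρ, ?_⟩
  rintro ⟨b, n⟩
  obtain ⟨m, s₀, c, hm, hs₀, hn, hHm, hc⟩ : ∃ m : ℕ, ∃ s₀ : ℝ, ∃ c : ℕ → ℤ,
      n.natAbs = m ∧ |s₀| = 1 ∧
      (n : ℝ) = s₀ * m ∧ H n = s₀ * G m ∧ ∀ j, (c j : ℝ) = s₀ * a (8 * j + 3) ∧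
        (c j).natAbs = a (8 * j + 3) ∧ η j ≤ ε (b, c j) := by
    rcases n.natAbs_eq with h | h
    · refine ⟨n.natAbs, 1, fun j => a (8 * j + 3), rfl, abs_one, ?_, ?_, fun j => ⟨?_, ?_, hηp b j⟩⟩
      · rw [one_mul]
        exact (congrArg ((↑) : ℤ → ℝ) h).trans (Int.cast_natCast _)
      · rw [one_mul, ← hHp, ← h]
      · simp
      · simp
    · refine ⟨n.natAbs, -1, fun j => -a (8 * j + 3), rfl, by simp, ?_, ?_,
        fun j => ⟨?_, ?_, hηn b j⟩⟩
      · rw [neg_one_mul]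
        exact (congrArg ((↑) : ℤ → ℝ) h).trans ((Int.cast_neg _).trans
          (congrArg _ (Int.cast_natCast _)))
      · rw [neg_one_mul, ← hHn, ← h]
      · simp
      · simp
  have val : ∀ u : ℝ, (1 - u) * (pt (b, n)).1 + u * interp H (pt (b, n)).1 =
      s₀ * ((1 - u) * m + u * G m) := by
    intro u
    change (1 - u) * (n : ℝ) + u * interp H n = _
    rw [interp_intCast, hHm, hn]
    ring
  simp only [val, hm]
  refine ⟨fun hg t => ?_, ?_⟩
  · have e : ∀ u : ℝ, s₀ * ((1 - u) * m + u * G m) = n := by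
      intro u
      rw [hG1 m hg, hn]
      ring
    rw [e]
    exact hfix (b, n) (Or.inl (by rw [hm]; exact hg)) _
  · intro j hj
    obtain ⟨g1, g2, g3⟩ := hG2 j m hj
    have m1 : (a (8 * j + 1) : ℝ) ≤ m := by exact_mod_cast hj.1
    have m2 : (m : ℝ) < a (8 * j + 6) := by exact_mod_cast hj.2
    have hA1 : (1 : ℝ) ≤ a (8 * j + 1) := by exact_mod_cast ha.nat_le (show 1 ≤ 8 * j + 1 by omega)
    intro t
    set u : I := plateau t with hu
    have u0 : (0 : ℝ) ≤ u := u.2.1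
    have u1 : (0 : ℝ) ≤ 1 - u := sub_nonneg.2 u.2.2
    set v : ℝ := (1 - u) * m + u * G m with hv
    have v1 : (a (8 * j + 1) : ℝ) ≤ v := by
      nlinarith [mul_le_mul_of_nonneg_left m1 u1, mul_le_mul_of_nonneg_left g2 u0]
    have v2 : v ≤ a (8 * j + 6) := by
      nlinarith [mul_le_mul_of_nonneg_left m2.le u1, mul_le_mul_of_nonneg_left g3.le u0]
    have hav : |s₀ * v| = v := by rw [abs_mul, hs₀, one_mul, abs_of_nonneg (by linarith)]
    have dv : dist ((s₀ * v, (pt (b, n)).2) : Plane) cor = v := by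
      rw [dist_strip (by rw [hav]; linarith) (pt_strip (b, n)), hav]
    have outer : ∀ s : I, F (s, (s₀ * v, (pt (b, n)).2)) ∈ Ann (a (8 * j)) (a (8 * (j + 1))) := by
      intro s
      have := ha.mem_Ann (j := 8 * j) (k := 8 * j + 6) (t := s) (v1.trans_eq dv.symm)
        (dv.trans_le v2)
      exact ⟨this.1, this.2.trans (ha.lt (by omega))⟩
    rcases midTime_plateau t with h | h | h
    · rw [h, hF'.zero, ← hF.zero (s₀ * v, (pt (b, n)).2)]
      exact outer 0
    · rw [h, hF'.one, ← hF.one (s₀ * v, (pt (b, n)).2)]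
      exact outer 1
    · obtain ⟨c1, c2, c3⟩ := hc j
      have hvG : v = G m := by rw [hv, hu, h]; simp
      have hcl : dist ((s₀ * v, (pt (b, n)).2) : Plane) (pt (b, c j)) < ε (b, c j) := by
        refine lt_of_lt_of_le ?_ c3
        rw [Prod.dist_eq]
        refine max_lt ?_ ?_
        · change dist (s₀ * v) (c j : ℝ) < _
          rw [c1, Real.dist_eq, ← mul_sub, abs_mul, hs₀, one_mul, hvG]
          exact g1
        · change dist (pt (b, n)).2 (pt (b, n)).2 < _
          rw [dist_self]
          exact hη j
      have hd := hε (b, c j) (hfix (b, c j) (Or.inr ⟨j, c2⟩)) (midTime t) _ hcl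
      have hne : c j ≠ 0 := by
        have := ha.mono (show 0 < 8 * j + 3 by omega)
        intro h0
        rw [h0] at c2
        simp only [Int.natAbs_zero] at c2
        omega
      have dz : dist (pt (b, c j)) cor = a (8 * j + 3) := by
        rw [dist_pt_of_ne (i := (b, c j)) hne]
        exact_mod_cast c2
      have s1 : (a (8 * j) : ℝ) + 1 ≤ a (8 * j + 3) := by
        exact_mod_cast ha.mono (show 8 * j < 8 * j + 3 by omega)
      have s2 : (a (8 * j + 3) : ℝ) + 1 ≤ a (8 * (j + 1)) := by
        exact_mod_cast ha.mono (show 8 * j + 3 < 8 * (j + 1) by omega)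
      have t1 := dist_triangle (F' (midTime t, (s₀ * v, (pt (b, n)).2))) (pt (b, c j)) cor
      have t2 := dist_triangle_left (pt (b, c j)) cor (F' (midTime t, (s₀ * v, (pt (b, n)).2)))
      exact ⟨by linarith, by linarith⟩

theorem Isot.exists_fixing (hF : Isot F Ψ) (hΨ : Good Ψ)
    (h0 : ∀ t, F (t, pt (false, 0)) = pt (false, 0))
    (h1 : ∀ t, F (t, pt (false, 1)) = pt (false, 1)) :
    ∃ G, Isot G Ψ ∧ ∀ i t, G (t, pt i) = pt i := by
  obtain ⟨a, ha⟩ := hF.exists_controls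
  obtain ⟨F', hF', hfix⟩ := hF.first_round hΨ h0 h1 ha
  obtain ⟨G, hG, hG'⟩ := hF.gather hF' ha hfix
  have small : ∀ n : ℤ, n.natAbs ≤ 1 → ∀ j, ¬ InGap a j n.natAbs := fun n hn j h => by
    have h2 := ha.mono (show 0 < 8 * j + 1 by omega)
    have h3 := h.1
    have h4 := ha.zero
    omega
  have hr : StrictMono fun j => (a (8 * j) : ℝ) := fun j k h => ha.lt (by omega)
  obtain ⟨H, hH, hH'⟩ := hG.round hΨ ((hG' (false, 0)).1 (small 0 (by simp)))
    ((hG' (false, 1)).1 (small 1 (by simp))) hr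
    (hr.tendsto_atTop_of_nat_le fun k => ⟨k, ha.nat_le (by omega)⟩) (Nat.cast_nonneg _)
  refine ⟨H, hH, fun i => hH' i ?_⟩
  by_cases hi : ∃ j, InGap a j i.2.natAbs
  · obtain ⟨j, hj⟩ := hi
    exact Or.inr ⟨j, (hG' i).2 j hj⟩
  · exact Or.inl ((hG' i).1 fun j hj => hi ⟨j, hj⟩)

end Fixing

section Normalise

open Filter Topology unitInterval

variable {F : I × Plane → Plane} {Ψ : Plane ≃ₜ Plane}

theorem normSq_pos {d : Plane} (hd : d ≠ 0) : 0 < d.1 ^ 2 + d.2 ^ 2 := by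
  rcases eq_or_ne d.1 0 with h1 | h1
  · have h2 : d.2 ≠ 0 := fun h2 => hd (Prod.ext h1 h2)
    positivity
  · positivity

/-- The complex affine map taking `p` to `(0, 1)` and `p + d` to `(1, 1)`. -/
noncomputable def simil (p d w : Plane) : Plane :=
  (((w.1 - p.1) * d.1 + (w.2 - p.2) * d.2) / (d.1 ^ 2 + d.2 ^ 2),
    1 + ((w.2 - p.2) * d.1 - (w.1 - p.1) * d.2) / (d.1 ^ 2 + d.2 ^ 2))

theorem isHomeoFun_simil (p : Plane) {d : Plane} (hd : d ≠ 0) : IsHomeoFun (simil p d) := by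
  have hN := (normSq_pos hd).ne'
  refine ⟨⟨⟨simil p d, fun v => (p.1 + (v.1 * d.1 - (v.2 - 1) * d.2),
    p.2 + (v.1 * d.2 + (v.2 - 1) * d.1)), fun w => ?_, fun v => ?_⟩, ?_, ?_⟩, fun _ => rfl⟩
  · ext
    · simp only [simil]
      field_simp
      ring
    · simp only [simil]
      field_simp
      ring
  · ext
    · simp only [simil]
      field_simp
      ring
    · simp only [simil]
      field_simp
      ring
  · change Continuous fun w : Plane => simil p d w
    unfold simil
    fun_prop
  · change Continuous fun v : Plane => (p.1 + (v.1 * d.1 - (v.2 - 1) * d.2),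
      p.2 + (v.1 * d.2 + (v.2 - 1) * d.1))
    fun_prop

theorem simil_id (w : Plane) : simil (pt (false, 0)) (pt (false, 1) - pt (false, 0)) w = w := by
  ext <;> simp [simil, pt]

theorem simil_base (p d : Plane) : simil p d p = pt (false, 0) := by
  ext <;> simp [simil, pt]

theorem simil_tip (p : Plane) {q : Plane} (h : q - p ≠ 0) : simil p (q - p) q = pt (false, 1) := by
  have hN := (normSq_pos h).ne'
  simp only [Prod.fst_sub, Prod.snd_sub] at hN
  ext
  · simp only [simil, pt, Prod.fst_sub, Prod.snd_sub]
    rw [div_eq_iff hN]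
    push_cast
    ring
  · simp only [simil, pt, Prod.fst_sub, Prod.snd_sub]
    rw [mul_comm (q.2 - p.2), sub_self, zero_div, add_zero]
    simp

theorem Isot.normalise (hF : Isot F Ψ) (hΨ : ∀ i, Ψ (pt i) = pt i) :
    ∃ G, Isot G Ψ ∧ (∀ t, G (t, pt (false, 0)) = pt (false, 0)) ∧
      ∀ t, G (t, pt (false, 1)) = pt (false, 1) := by
  let p : I → Plane := fun t => F (t, pt (false, 0))
  let q : I → Plane := fun t => F (t, pt (false, 1))
  have hp : Continuous p := hF.cont.comp (Continuous.prodMk_left _)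
  have hq : Continuous q := hF.cont.comp (Continuous.prodMk_left _)
  have hd : ∀ t, q t - p t ≠ 0 := fun t h => by
    have := pt_injective ((hF.homeo t).bijective.1 (sub_eq_zero.1 h))
    simp at this
  have hA : Isot (fun z => simil (p z.1) (q z.1 - p z.1) z.2) id := by
    refine ⟨?_, fun t => isHomeoFun_simil (p t) (hd t), fun x => ?_, fun x => ?_⟩
    · have hp' : Continuous fun z : I × Plane => p z.1 := hp.comp continuous_fst
      have hd' : Continuous fun z : I × Plane => q z.1 - p z.1 :=
        (hq.comp continuous_fst).sub hp'
      have hw : Continuous fun z : I × Plane => z.2 - p z.1 := continuous_snd.sub hp'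
      have hN : Continuous fun z : I × Plane => (q z.1 - p z.1).1 ^ 2 + (q z.1 - p z.1).2 ^ 2 :=
        (hd'.fst.pow 2).add (hd'.snd.pow 2)
      have hN0 : ∀ z : I × Plane, (q z.1 - p z.1).1 ^ 2 + (q z.1 - p z.1).2 ^ 2 ≠ 0 :=
        fun z => (normSq_pos (hd z.1)).ne'
      exact (((hw.fst.mul hd'.fst).add (hw.snd.mul hd'.snd)).div hN hN0).prodMk
        (continuous_const.add (((hw.snd.mul hd'.fst).sub (hw.fst.mul hd'.snd)).div hN hN0))
    · simp only [p, q, hF.zero, simil_id]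
    · simp only [p, q, hF.one, hΨ, simil_id, id]
  exact ⟨_, hA.comp hF, fun t => simil_base _ _, fun t => simil_tip _ (hd t)⟩

theorem Good.exists_fixing (hΨ : Good Ψ) : ∃ G, Isot G Ψ ∧ ∀ i t, G (t, pt i) = pt i := by
  obtain ⟨F, hc, hh, h0, h1⟩ := hΨ.iso
  obtain ⟨F', hF', hb, ht⟩ := Isot.normalise ⟨hc, hh, h0, h1⟩ hΨ.fix
  exact hF'.exists_fixing hΨ hb ht

end Normalise

section Centralizer

open Filter Topology unitInterval

variable {Ψ : Plane ≃ₜ Plane}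

theorem shear_zpow (f : ℝ → ℝ) (hf : Continuous f) (n : ℤ) (p : Plane) :
    ((shear f hf).toEquiv ^ n) p = (p.1 + n * f p.2, p.2) := by
  have hs : ∀ p, (shear f hf).toEquiv p = (p.1 + f p.2, p.2) := fun _ => rfl
  have hs' : ∀ p, (shear f hf).toEquiv⁻¹ p = (p.1 - f p.2, p.2) := fun _ => rfl
  induction n using Int.induction_on generalizing p with
  | zero => simp
  | succ k ih =>
    rw [zpow_add_one, Equiv.Perm.mul_apply, ih, hs]
    push_cast
    ext
    · simp only
      ring
    · rfl
  | pred k ih =>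
    rw [zpow_sub_one, Equiv.Perm.mul_apply, ih, hs']
    push_cast
    ext
    · simp only
      ring
    · rfl

theorem mem_Z1_union_Z2 {x : Plane} : x ∈ Z1 ∪ Z2 ↔ ∃ i, x = pt i := by
  constructor
  · rintro (⟨n, rfl⟩ | ⟨n, rfl⟩)
    · exact ⟨(false, n), by simp [pt]⟩
    · exact ⟨(true, n), by simp [pt]⟩
  · rintro ⟨⟨_ | _, n⟩, rfl⟩
    · exact Or.inl ⟨n, by simp [pt]⟩
    · exact Or.inr ⟨n, by simp [pt]⟩

/-- A permutation of the punctures of the strip that preserves both lines and commutes with `R₀`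
is a translation on each line. -/
theorem exists_translation (h1 : Ψ '' Z1 = Z1) (h2 : Ψ '' Z2 = Z2)
    (hc : ∀ i, Ψ (R₀ (pt i)) = R₀ (Ψ (pt i))) (b : Bool) :
    ∃ n : ℤ, ∀ m : ℤ, Ψ (pt (b, m)) = pt (b, m + n) := by
  have hex : ∀ m : ℤ, ∃ k : ℤ, Ψ (pt (b, m)) = pt (b, k) := by
    intro m
    cases b
    · have hm : Ψ (pt (false, m)) ∈ Ψ '' Z1 := ⟨_, ⟨m, by simp [pt]⟩, rfl⟩
      rw [h1] at hm
      obtain ⟨k, hk⟩ := hm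
      exact ⟨k, by rw [hk]; simp [pt]⟩
    · have hm : Ψ (pt (true, m)) ∈ Ψ '' Z2 := ⟨_, ⟨m, by simp [pt]⟩, rfl⟩
      rw [h2] at hm
      obtain ⟨k, hk⟩ := hm
      exact ⟨k, by rw [hk]; simp [pt]⟩
  choose f hf using hex
  have hstep : ∀ m, f (m + 1) = f m + 1 := by
    intro m
    cases b
    · have h := hc (false, m)
      rw [R₀_pt, hf, R₀_pt] at h
      change Ψ (pt (false, m + 1)) = pt (false, f m + 1) at h
      rw [hf] at h
      exact (Prod.ext_iff.1 (pt_injective h)).2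
    · have h := hc (true, m + 1)
      rw [R₀_pt, hf, R₀_pt] at h
      change Ψ (pt (true, m + 1 - 1)) = pt (true, f (m + 1) - 1) at h
      rw [add_sub_cancel_right, hf] at h
      have := (Prod.ext_iff.1 (pt_injective h)).2
      simp only at this
      omega
  refine ⟨f 0, fun m => ?_⟩
  have : f m = m + f 0 := by
    induction m using Int.induction_on with
    | zero => simp
    | succ k ih =>
      rw [hstep, ih]
      ring
    | pred k ih =>
      have := hstep (-k - 1)
      rw [sub_add_cancel] at this
      omega
  rw [hf, this]

/-- The shear `T₁ ^ n₁ ∘ T₂ ^ n₂`. -/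
def twist (n₁ n₂ : ℤ) : Plane ≃ₜ Plane :=
  shear (fun y => n₁ * (2 - y) + n₂ * (y - 1)) (by fun_prop)

theorem twist_apply (n₁ n₂ : ℤ) (p : Plane) :
    twist n₁ n₂ p = (p.1 + (n₁ * (2 - p.2) + n₂ * (p.2 - 1)), p.2) := rfl

theorem twist_symm_apply (n₁ n₂ : ℤ) (p : Plane) :
    (twist n₁ n₂).symm p = (p.1 - (n₁ * (2 - p.2) + n₂ * (p.2 - 1)), p.2) := rfl

theorem twist_eq_zpow (n₁ n₂ : ℤ) (p : Plane) :
    twist n₁ n₂ p = (T₁.toEquiv ^ n₁) ((T₂.toEquiv ^ n₂) p) := by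
  rw [T₁, T₂, shear_zpow, shear_zpow, twist_apply]
  ext
  · simp only
    ring
  · rfl

theorem twist_pt (n₁ n₂ : ℤ) (b : Bool) (m : ℤ) :
    twist n₁ n₂ (pt (b, m)) = pt (b, m + if b then n₂ else n₁) := by
  cases b <;> ext <;> simp [twist_apply, pt] <;> norm_num

theorem twist_symm_R₀ (n₁ n₂ : ℤ) (p : Plane) :
    (twist n₁ n₂).symm (R₀ (twist n₁ n₂ p)) = R₀ p := by
  have hR : ∀ p, R₀ p = (p.1 + (3 - 2 * p.2), p.2) := fun _ => rfl
  rw [hR, hR, twist_symm_apply, twist_apply]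
  ext
  · simp only
    ring
  · rfl

theorem isot_twist_symm (n₁ n₂ : ℤ) :
    Isot (fun z => (z.2.1 - z.1 * (n₁ * (2 - z.2.2) + n₂ * (z.2.2 - 1)), z.2.2))
      (twist n₁ n₂).symm where
  cont := by fun_prop
  homeo t := ⟨(shear (fun y => t * (n₁ * (2 - y) + n₂ * (y - 1))) (by fun_prop)).symm, fun _ => rfl⟩
  zero x := by simp
  one x := by simp [twist_symm_apply]

theorem OrientationPreserving.exists_isot (h : OrientationPreserving Ψ) : ∃ F, Isot F Ψ := by
  obtain ⟨F, hF, hh, h0, h1, -⟩ := h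
  exact ⟨fun z => F (z.1, z.2),
    hF.comp ((continuous_subtype_val.comp continuous_fst).prodMk continuous_snd),
    fun t => hh t t.2, h0, h1⟩

theorem centralizer (hOP : OrientationPreserving Ψ) (h1 : Ψ '' Z1 = Z1) (h2 : Ψ '' Z2 = Z2)
    (hcomm : IsotopicRel (conjH Ψ R₀) R₀ (Z1 ∪ Z2)) :
    ∃ n₁ n₂ : ℤ, IsotopicRel Ψ (fun p => (T₁.toEquiv ^ n₁) ((T₂.toEquiv ^ n₂) p)) (Z1 ∪ Z2) := by
  obtain ⟨F, hF, hFh, hF0, hF1, hFO⟩ := hcomm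
  have hO : ∀ t ∈ Set.Icc (0 : ℝ) 1, ∀ i, F (t, pt i) = R₀ (pt i) := fun t ht i => by
    have hi : pt i ∈ Z1 ∪ Z2 := mem_Z1_union_Z2.2 ⟨i, rfl⟩
    rw [hFO t ht _ hi, ← hF1, hFO 1 ⟨zero_le_one, le_rfl⟩ _ hi]
  have hmem : ∀ i, ∃ j, Ψ (pt i) = pt j := fun i => by
    have hi : Ψ (pt i) ∈ Ψ '' (Z1 ∪ Z2) := ⟨_, mem_Z1_union_Z2.2 ⟨i, rfl⟩, rfl⟩
    rw [Set.image_union, h1, h2] at hi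
    exact mem_Z1_union_Z2.1 hi
  have hc : ∀ i, Ψ (R₀ (pt i)) = R₀ (Ψ (pt i)) := fun i => by
    obtain ⟨j, hj⟩ := hmem i
    rw [hj, ← hO 0 ⟨le_rfl, zero_le_one⟩ j, hF0, ← hj]
    change _ = Ψ (R₀ (Ψ.symm (Ψ (pt i))))
    rw [Ψ.symm_apply_apply]
  obtain ⟨n₁, hn₁⟩ := exists_translation h1 h2 hc false
  obtain ⟨n₂, hn₂⟩ := exists_translation h1 h2 hc true
  let S := twist n₁ n₂
  have hΨS : ∀ i, S (pt i) = Ψ (pt i) := by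
    rintro ⟨_ | _, m⟩
    · exact (twist_pt n₁ n₂ false m).trans (hn₁ m).symm
    · exact (twist_pt n₁ n₂ true m).trans (hn₂ m).symm
  let Ψ₀ : Plane ≃ₜ Plane := Ψ.trans S.symm
  have hfix : ∀ i, Ψ₀ (pt i) = pt i := fun i => by
    change S.symm (Ψ (pt i)) = pt i
    rw [← hΨS, S.symm_apply_apply]
  have hgood : Good Ψ₀ := by
    refine ⟨hfix, ?_, fun E g hg hX h0 h1 => ?_⟩
    · obtain ⟨F', hF'⟩ := hOP.exists_isot
      have h := (isot_twist_symm n₁ n₂).comp hF'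
      exact ⟨_, h.cont, h.homeo, h.zero, h.one⟩
    · let G : I × Plane → Plane := fun z => S.symm (F (z.1, S z.2))
      have hG : Continuous G := S.symm.continuous.comp (hF.comp
        ((continuous_subtype_val.comp continuous_fst).prodMk (S.continuous.comp continuous_snd)))
      have hGi : ∀ u, Function.Injective fun x => G (u, x) := fun u =>
        S.symm.injective.comp (((hFh u u.2).bijective.1).comp S.injective)
      refine hl_comm hfix hG hGi (fun x => ?_) (fun x => ?_) (fun u i => ?_) E hg hX h0 h1
      · exact congrArg S.symm (hF0 (S x))
      · exact (congrArg S.symm (hF1 (S x))).trans (twist_symm_R₀ n₁ n₂ x)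
      · obtain ⟨j, hj⟩ := hmem i
        have hS : F (u, S (pt i)) = R₀ (S (pt i)) := by
          rw [hΨS, hj]
          exact hO u u.2 j
        exact (congrArg S.symm hS).trans (twist_symm_R₀ n₁ n₂ (pt i))
  obtain ⟨G, hG, hGfix⟩ := hgood.exists_fixing
  let κ : ℝ → I := fun t => Set.projIcc 0 1 zero_le_one (1 - t)
  have hκ : Continuous κ := continuous_projIcc.comp (by fun_prop)
  have hκ0 : κ 0 = 1 := Set.projIcc_of_right_le _ (by norm_num)
  have hκ1 : κ 1 = 0 := Set.projIcc_of_le_left _ (by norm_num)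
  refine ⟨n₁, n₂, fun z => S (G (κ z.1, z.2)), ?_, fun t _ => ?_, fun x => ?_, fun x => ?_,
    fun t _ x hx => ?_⟩
  · exact S.continuous.comp (hG.cont.comp ((hκ.comp continuous_fst).prodMk continuous_snd))
  · exact IsHomeoFun.comp (f := S) ⟨S, fun _ => rfl⟩ (hG.homeo (κ t))
  · change S (G (κ 0, x)) = Ψ x
    rw [hκ0, hG.one]
    exact S.apply_symm_apply (Ψ x)
  · change S (G (κ 1, x)) = _
    rw [hκ1, hG.zero]
    exact twist_eq_zpow n₁ n₂ x
  · obtain ⟨i, rfl⟩ := mem_Z1_union_Z2.1 hx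
    change S (G (κ t, pt i)) = Ψ (pt i)
    rw [hGfix, hΨS]

end Centralizer

/-- Centralizer of the Reeb class: any mapping class commuting
with that of `R₀` is `[T₁]ⁿ¹ [T₂]ⁿ²`. -/
theorem reeb_centralizer
    (Ψ : Plane ≃ₜ Plane) (hOP : OrientationPreserving Ψ)
    (h1 : Ψ '' Z1 = Z1) (h2 : Ψ '' Z2 = Z2)
    (hcomm : IsotopicRel (⇑(conjH Ψ R₀)) (⇑R₀) (Z1 ∪ Z2)) :
    ∃ n₁ n₂ : ℤ, IsotopicRel (⇑Ψ)
      (fun p => (T₁.toEquiv ^ n₁) ((T₂.toEquiv ^ n₂) p)) (Z1 ∪ Z2) := by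
  exact centralizer hOP h1 h2 hcomm
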